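/- Let k ≥ 5 be an integer, λ₂ and λ₇ fixed nonzero real numbers, and ε > 0. There is a constant C such that for all sufficiently large X and all τ with 0 < τ < 1, ∫_ℝ |S₃(λ₂α)|⁴ |S_k(λ₇α)|^{m₂(k)} K_τ(α) dα ≤ C τ X^{m₂(k)/k + 1/3 + ε}, where m₂(k) = 2⌈(2k/3 + 1 − ⌊2k/3⌋)·2^{⌊2k/3⌋−1}⌉ if k = 5, m₂(k) = 2⌈14k/3 − 20⌉ if k = 6 or 7, and m₂(k) = 2⌈(2k/3 − ⌊2k/3⌋/2)(⌊2k/3⌋ + 1)⌉ if k ≥ 8. -/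

import Mathlib

open MeasureTheory Finset
open scoped Classical

/-- `e(x) = exp(2πix)`. -/
noncomputable def e (x : ℝ) : ℂ := Complex.exp (2 * Real.pi * Complex.I * x)

/-- Fejér-type kernel `K_τ(α)`. -/
noncomputable def Kf (τ α : ℝ) : ℝ :=
  if α = 0 then τ ^ 2 else (Real.sin (Real.pi * τ * α) / (Real.pi * α)) ^ 2

/-- `ψ(m,z) = 1` if every prime factor of `m` is `≥ z`, else `0`. -/
noncomputable def psi (m : ℕ) (z : ℝ) : ℝ :=
  if ∀ p : ℕ, p.Prime → p ∣ m → z ≤ (p : ℝ) then 1 else 0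

/-- `z(p)` in the sieve weights. -/
noncomputable def zP (X : ℝ) (p : ℕ) : ℝ :=
  if (p : ℝ) < X ^ ((1:ℝ)/7) then X ^ ((5:ℝ)/28) * (p : ℝ) ^ (-(1:ℝ)/2)
  else if (p : ℝ) ≤ X ^ ((3:ℝ)/14) then (p : ℝ)
  else X ^ ((5:ℝ)/14) / (p : ℝ)

/-- The sieve function `ρ(m)` of Harman–Kumchev. -/
noncomputable def rho (X : ℝ) (m : ℕ) : ℝ :=
  psi m (X ^ ((5:ℝ)/42)) -
    ∑ p ∈ m.primeFactors.filter
        (fun p : ℕ => X ^ ((5:ℝ)/42) ≤ (p:ℝ) ∧ (p:ℝ) ≤ X ^ ((1:ℝ)/4)),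
      psi (m / p) (zP X p)

/-- `S_k(α) = Σ_{p ∈ [(ηX)^{1/k}, X^{1/k}]} (log p) e(p^k α)`, sum over primes. -/
noncomputable def SS (η X : ℝ) (k : ℕ) (α : ℝ) : ℂ :=
  ∑ p ∈ (Finset.Icc 1 ⌊X ^ ((1:ℝ)/(k:ℝ))⌋₊).filter
      (fun p : ℕ => p.Prime ∧ (η * X) ^ ((1:ℝ)/(k:ℝ)) ≤ (p : ℝ)),
    (Real.log p : ℂ) * e ((p : ℝ) ^ k * α)

/-- `S₂(α, ρ) = Σ_{m ∈ [(ηX)^{1/2}, X^{1/2}]} ρ(m) e(m²α)`. -/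
noncomputable def S2 (η X α : ℝ) : ℂ :=
  ∑ m ∈ (Finset.Icc 1 ⌊X ^ ((1:ℝ)/2)⌋₊).filter
      (fun m : ℕ => (η * X) ^ ((1:ℝ)/2) ≤ (m : ℝ)),
    (rho X m : ℂ) * e ((m : ℝ) ^ 2 * α)

/-- `S_r(α)` for real `r ≥ 1`. -/
noncomputable def Sr (η X r α : ℝ) : ℂ :=
  ∑ p ∈ (Finset.Icc 1 ⌊X ^ (1/r)⌋₊).filter
      (fun p : ℕ => p.Prime ∧ (η * X) ^ (1/r) ≤ (p : ℝ)),
    (Real.log p : ℂ) * e ((p : ℝ) ^ r * α)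

/-- `U_r(α)` for real `r ≥ 1`. -/
noncomputable def Ur (η X r α : ℝ) : ℂ :=
  ∑ n ∈ (Finset.Icc 1 ⌊X ^ (1/r)⌋₊).filter
      (fun n : ℕ => (η * X) ^ (1/r) ≤ (n : ℝ)),
    e ((n : ℝ) ^ r * α)

/-- Chebyshev's function `θ(x) = Σ_{p ≤ x} log p`. -/
noncomputable def theta (x : ℝ) : ℝ :=
  ∑ p ∈ (Finset.Icc 1 ⌊x⌋₊).filter Nat.Prime, Real.log p

/-- `J_r(X,h)`. -/
noncomputable def J (ε r X h : ℝ) : ℝ :=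
  ∫ x in Set.Icc (ε * X) X,
    (theta ((x + h) ^ (1/r)) - theta (x ^ (1/r)) - ((x + h) ^ (1/r) - x ^ (1/r))) ^ 2

/-- `T_n(α) = ∫_{(ηX)^{1/n}}^{X^{1/n}} e(t^n α) dt`. -/
noncomputable def T (η X : ℝ) (n : ℕ) (α : ℝ) : ℂ :=
  ∫ t in Set.Icc ((η * X) ^ ((1:ℝ)/(n:ℝ))) (X ^ ((1:ℝ)/(n:ℝ))), e (t ^ n * α)

/-- `m₁(k)`. -/
noncomputable def m1 (k : ℕ) : ℝ :=
  if k = 5 then 2 * (⌈343 * (k:ℝ) / 50 - 20⌉ : ℝ)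
  else 2 * (⌈(49 * (k:ℝ) / 50 - (⌊49 * (k:ℝ) / 50⌋ : ℝ) / 2)
      * ((⌊49 * (k:ℝ) / 50⌋ : ℝ) + 1)⌉ : ℝ)

/-- `σ(k) = 44/45 − 24/(25 m₁(k))`. -/
noncomputable def sigma' (k : ℕ) : ℝ := 44/45 - 24 / (25 * m1 k)

/-- `m(k)` depending on `δ`. -/
noncomputable def mδ (k : ℕ) (δ : ℝ) : ℝ :=
  if ⌊(k:ℝ) * δ⌋ ≤ 3 then
    2 * (⌈((k:ℝ) * δ + 1 - (⌊(k:ℝ) * δ⌋ : ℝ)) * (2:ℝ) ^ (⌊(k:ℝ) * δ - 1⌋)⌉ : ℝ)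
  else if ⌊(k:ℝ) * δ⌋ = 4 then 2 * (⌈7 * (k:ℝ) * δ - 20⌉ : ℝ)
  else 2 * (⌈((k:ℝ) * δ - (⌊(k:ℝ) * δ⌋ : ℝ)/2) * ((⌊(k:ℝ) * δ⌋ : ℝ) + 1)⌉ : ℝ)

/-- `m₂(k)`. -/
noncomputable def m2 (k : ℕ) : ℝ :=
  if k = 5 then
    2 * (⌈(2 * (k:ℝ)/3 + 1 - (⌊2 * (k:ℝ)/3⌋ : ℝ)) * (2:ℝ) ^ (⌊2 * (k:ℝ)/3⌋ - 1)⌉ : ℝ)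
  else if k ≤ 7 then 2 * (⌈14 * (k:ℝ)/3 - 20⌉ : ℝ)
  else 2 * (⌈(2 * (k:ℝ)/3 - (⌊2 * (k:ℝ)/3⌋ : ℝ)/2) * ((⌊2 * (k:ℝ)/3⌋ : ℝ) + 1)⌉ : ℝ)


open MeasureTheory Finset
open scoped Classical

set_option linter.unusedSectionVars false
set_option linter.all false
namespace VM

/-- triangular numbers -/
@[irreducible] def tri (k : ℕ) : ℕ := k * (k + 1) / 2

lemma tri_zero : tri 0 = 0 := by unfold tri; rfl
lemma tri_one : tri 1 = 1 := by unfold tri; rfl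

lemma two_tri (k : ℕ) : 2 * tri k = k * (k + 1) := by
  unfold tri
  exact Nat.mul_div_cancel' (Nat.even_mul_succ_self k).two_dvd

lemma tri_mono {a b : ℕ} (h : a ≤ b) : tri a ≤ tri b := by
  have h1 := two_tri a
  have h2 := two_tri b
  have : a * (a + 1) ≤ b * (b + 1) := by gcongr
  omega

lemma tri_pos {k : ℕ} (h : 1 ≤ k) : 1 ≤ tri k := by
  have := tri_mono h
  have h1 := tri_one
  omega

/-! ### transversality -/

lemma transv_field {K : Type*} [Field K] (m l : ℕ) (z : K) (hz : z ≠ 0)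
    (hch : ∀ j : ℕ, 1 ≤ j → j ≤ m + l → (j : K) ≠ 0) (v : Fin l → K)
    (hv : ∀ i : Fin l, ∑ s : Fin l,
      ((Nat.choose (m + 1 + s) (i + 1) : ℕ) : K) * z ^ (m + 1 + s - (i + 1)) * v s = 0) :
    v = 0 := by
  open Polynomial in
  let Q : K[X] := ∑ s : Fin l, monomial (m + 1 + s) (v s)
  let P : K[X] := ∑ s : Fin l, monomial (s : ℕ) (((m + 1 + s : ℕ) : K) * v s)
  have hQP : derivative Q = X ^ m * P := by
    simp only [Q, P, derivative_sum, derivative_monomial, Finset.mul_sum, X_pow_mul_monomial]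
    refine Finset.sum_congr rfl fun s _ => ?_
    have : m + 1 + (s : ℕ) - 1 = s + m := by omega
    rw [this, mul_comm]
  have hT : ∀ i < l, (taylor z Q).coeff (i + 1) = 0 := by
    intro i hi
    rw [taylor_coeff]
    simp only [Q, map_sum, hasseDeriv_monomial, eval_finsetSum, eval_monomial]
    rw [← hv ⟨i, hi⟩]
    refine Finset.sum_congr rfl fun s _ => ?_
    ring
  have hdvd : (X - C z) ^ l ∣ derivative Q := by
    rw [X_sub_C_pow_dvd_iff, X_pow_dvd_iff]
    intro i hi
    have : (derivative Q).comp (X + C z) = derivative (taylor z Q) := by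
      rw [taylor_apply, derivative_comp]; simp
    rw [this, coeff_derivative, hT i hi, zero_mul]
  rw [hQP] at hdvd
  have hcop : IsCoprime ((X - C z) ^ l) (X ^ m : K[X]) := by
    apply IsCoprime.pow
    have := isCoprime_X_sub_C_of_isUnit_sub (R := K) (a := z) (b := 0) (by simpa using hz)
    simpa using this
  have hdP : (X - C z) ^ l ∣ P := hcop.dvd_of_dvd_mul_left hdvd
  have hP0 : P = 0 := by
    by_cases hl : l = 0
    · subst hl; simp [P]
    refine Polynomial.eq_zero_of_dvd_of_degree_lt hdP ?_
    rw [degree_pow, degree_X_sub_C]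
    refine lt_of_le_of_lt (degree_sum_le _ _) ?_
    rw [Finset.sup_lt_iff (by simpa using WithBot.bot_lt_coe l)]
    intro s _
    refine lt_of_le_of_lt (degree_monomial_le _ _) ?_
    simpa using s.2
  funext s
  have h1 : P.coeff s = ((m + 1 + s : ℕ) : K) * v s := by
    simp only [P, finsetSum_coeff, coeff_monomial]
    rw [Finset.sum_eq_single s]
    · simp
    · intro b _ hb
      rw [if_neg]; intro h; exact hb (Fin.ext h)
    · simp
  rw [hP0, coeff_zero] at h1
  have h2 := hch (m + 1 + s) (by omega) (by have := s.2; omega)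
  exact (mul_eq_zero.mp h1.symm).resolve_left h2

section
variable {R : Type} [CommRing R] (π : R)

lemma transv_det (hπ : ∀ x : R, ¬ π ∣ x → IsUnit x) (hπ0 : ¬ IsUnit π) (m l : ℕ) (z : R)
    (hz : IsUnit z)
    (hch : ∀ j : ℕ, 1 ≤ j → j ≤ m + l → IsUnit (j : R)) (B : Matrix (Fin l) (Fin l) R) :
    IsUnit (Matrix.det (Matrix.of fun i s : Fin l =>
      ((Nat.choose (m + 1 + s) (i + 1) : ℕ) : R) * z ^ (m + 1 + s - (i + 1) : ℕ) + π * B i s)) := by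
  apply hπ
  intro hd
  let I := Ideal.span {π}
  have hmax : I.IsMaximal := by
    rw [Ideal.isMaximal_iff]
    refine ⟨?_, ?_⟩
    · rw [Ideal.mem_span_singleton]; exact fun h => hπ0 (isUnit_of_dvd_one h)
    · intro J x _ hx hxJ
      have := hπ x (by rwa [Ideal.mem_span_singleton] at hx)
      rw [← Ideal.eq_top_iff_one]
      exact Ideal.eq_top_of_isUnit_mem J hxJ this
  letI : Field (R ⧸ I) := Ideal.Quotient.field I
  let φ := Ideal.Quotient.mk I
  have hφπ : φ π = 0 := by
    rw [Ideal.Quotient.eq_zero_iff_mem]; exact Ideal.mem_span_singleton_self π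
  have h0 : φ (Matrix.det (Matrix.of fun i s : Fin l =>
      ((Nat.choose (m + 1 + s) (i + 1) : ℕ) : R) * z ^ (m + 1 + s - (i + 1) : ℕ) + π * B i s)) = 0 := by
    rw [Ideal.Quotient.eq_zero_iff_mem, Ideal.mem_span_singleton]; exact hd
  rw [RingHom.map_det] at h0
  obtain ⟨v, hv0, hv⟩ := Matrix.exists_mulVec_eq_zero_iff.mpr h0
  apply hv0
  have hU : ∀ u : R, IsUnit u → φ u ≠ 0 := fun u hu => (hu.map φ).ne_zero
  refine transv_field m l (φ z) (hU z hz) (fun j h1 h2 => ?_) v (fun i => ?_)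
  · have := hU _ (hch j h1 h2)
    simpa using this
  · have := congrFun hv i
    simp only [Matrix.mulVec, dotProduct, RingHom.mapMatrix_apply, Matrix.map_apply, Matrix.of_apply,
      map_add, map_mul, map_pow, map_natCast, hφπ, zero_mul, add_zero, Pi.zero_apply] at this
    exact this
end

end VM

open MeasureTheory Finset
open scoped Classical

set_option linter.unusedSectionVars false
set_option linter.all false
namespace VM

/-! ### spectra -/
section spec
variable {R : Type} [CommRing R] {Γ : Type} [AddCommGroup Γ] [Module R Γ]
  {G : Type} [Fintype G]

/-- a system of orthogonal characters -/
structure CharSys (e : Γ → G → ℂ) : Prop where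
  zero : ∀ g, e 0 g = 1
  add : ∀ a b g, e (a + b) g = e a g * e b g
  conj : ∀ a g, (starRingEnd ℂ) (e a g) = e (-a) g
  orth : ∀ a, a ≠ 0 → ∑ g, e a g = 0

/-- functions with spectrum in `c + L` -/
def Sp (e : Γ → G → ℂ) (c : Γ) (L : Submodule R Γ) : Submodule ℂ (G → ℂ) :=
  Submodule.span ℂ (e '' {ξ | ξ - c ∈ L})

variable {e : Γ → G → ℂ}

lemma mem_Sp {c ξ : Γ} {L : Submodule R Γ} (h : ξ - c ∈ L) : e ξ ∈ Sp e c L :=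
  Submodule.subset_span ⟨ξ, h, rfl⟩

lemma Sp_mono {c c' : Γ} {L L' : Submodule R Γ} (h : L ≤ L') (hc : c - c' ∈ L') :
    Sp e c L ≤ Sp e c' L' := by
  apply Submodule.span_mono
  apply Set.image_mono
  intro ξ hξ
  have : ξ - c' = (ξ - c) + (c - c') := by abel
  simp only [Set.mem_ofPred_eq] at *
  rw [this]
  exact L'.add_mem (h hξ) hc

lemma Sp_mul (he : CharSys e) {c c' : Γ} {L : Submodule R Γ} {f g : G → ℂ}
    (hf : f ∈ Sp e c L) (hg : g ∈ Sp e c' L) : f * g ∈ Sp e (c + c') L := by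
  induction hf using Submodule.span_induction with
  | zero => simp
  | add x y _ _ hx hy => rw [add_mul]; exact Submodule.add_mem _ hx hy
  | smul a x _ hx => rw [smul_mul_assoc]; exact Submodule.smul_mem _ _ hx
  | mem x hx =>
    obtain ⟨ξ, hξ, rfl⟩ := hx
    induction hg using Submodule.span_induction with
    | zero => simp
    | add x y _ _ hx hy => rw [mul_add]; exact Submodule.add_mem _ hx hy
    | smul a x _ hx => rw [mul_smul_comm]; exact Submodule.smul_mem _ _ hx
    | mem x hx =>
      obtain ⟨ξ', hξ', rfl⟩ := hx
      have h1 : e ξ * e ξ' = e (ξ + ξ') := by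
        funext g; simp [he.add]
      rw [h1]
      apply mem_Sp
      have : ξ + ξ' - (c + c') = (ξ - c) + (ξ' - c') := by abel
      rw [this]
      exact L.add_mem hξ hξ'

lemma Sp_conj (he : CharSys e) {c : Γ} {L : Submodule R Γ} {f : G → ℂ}
    (hf : f ∈ Sp e c L) : (fun g => (starRingEnd ℂ) (f g)) ∈ Sp e (-c) L := by
  induction hf using Submodule.span_induction with
  | zero => simp only [Pi.zero_apply, map_zero]; exact Submodule.zero_mem _
  | add x y _ _ hx hy => 
    simp only [Pi.add_apply, map_add]; exact Submodule.add_mem _ hx hy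
  | smul a x _ hx =>
    have := Submodule.smul_mem _ ((starRingEnd ℂ) a) hx
    convert this using 1
    funext g; simp
  | mem x hx =>
    obtain ⟨ξ, hξ, rfl⟩ := hx
    simp only [he.conj]
    apply mem_Sp
    have : -ξ - -c = -(ξ - c) := by abel
    rw [this]
    exact L.neg_mem hξ

lemma Sp_orth (he : CharSys e) {c : Γ} {L : Submodule R Γ} {f : G → ℂ}
    (hf : f ∈ Sp e c L) (hc : c ∉ L) : ∑ g, f g = 0 := by
  induction hf using Submodule.span_induction with
  | zero => simp
  | add x y _ _ hx hy => simp [Finset.sum_add_distrib, hx, hy]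
  | smul a x _ hx => simp [← Finset.mul_sum, hx]
  | mem x hx =>
    obtain ⟨ξ, hξ, rfl⟩ := hx
    apply he.orth
    rintro rfl
    apply hc
    have := L.neg_mem hξ
    simpa using this

lemma Sp_pow (he : CharSys e) {L : Submodule R Γ} {f : G → ℂ}
    (hf : f ∈ Sp e 0 L) (n : ℕ) : f ^ n ∈ Sp e 0 L := by
  induction n with
  | zero =>
    have : (1 : G → ℂ) = e 0 := by funext g; simp [he.zero]
    rw [pow_zero, this]
    apply mem_Sp; simp
  | succ n ih => 
    rw [pow_succ]; simpa using Sp_mul he ih hf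

lemma Sp_normSq (he : CharSys e) {c : Γ} {L : Submodule R Γ} {f : G → ℂ}
    (hf : f ∈ Sp e c L) : (fun g => ((‖f g‖ ^ 2 : ℝ) : ℂ)) ∈ Sp e 0 L := by
  have := Sp_mul he hf (Sp_conj he hf)
  rw [add_neg_cancel] at this
  convert this using 1
  funext g
  simp only [Pi.mul_apply]
  rw [Complex.mul_conj, Complex.normSq_eq_norm_sq]

lemma Sp_weight (he : CharSys e) {c : Γ} {L W : Submodule R Γ} {f : G → ℂ} {w : G → ℝ}
    (hf : f ∈ Sp e c L) (hw : (fun g => (w g : ℂ)) ∈ Sp e 0 W) (hWL : W ≤ L) (n : ℕ) :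
    (fun g => ((w g * (‖f g‖ ^ 2) ^ n : ℝ) : ℂ)) ∈ Sp e 0 L := by
  have h1 := Sp_mul he (Sp_mono hWL (by simp) hw : _ ∈ Sp e 0 L) (Sp_pow he (Sp_normSq he hf) n)
  rw [add_zero] at h1
  convert h1 using 1
  funext g
  simp

end spec

/-! ### systems -/
section sys
variable {R : Type} [CommRing R] (π : R) {Γ : Type} [AddCommGroup Γ] [Module R Γ]

/-- a nondegenerate `k`-dimensional curve system of depth `N`, modulo `W` -/
structure Sys (D : ℕ → R → Γ) (d : ℕ) (W : Submodule R Γ) (k N : ℕ) : Prop where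
  kd : k ≤ d
  taylor : ∀ i x y, D i (x + y) = ∑ j ∈ range (d + 1), ((Nat.choose j i : R) * y ^ (j - i)) • D j x
  high : ∀ x j, k < j → j ≤ d → ∃ c : ℕ → R, D j x - ∑ i ∈ Icc 1 k, (π * c i) • D i x ∈ W
  indep : ∀ x (c : ℕ → R), ∑ i ∈ Icc 1 k, c i • D i x ∈ W → ∀ i ∈ Icc 1 k, π ^ (N * i) ∣ c i

/-- the uncertainty lattice -/
def Lw (D : ℕ → R → Γ) (d : ℕ) (W : Submodule R Γ) (x : R) (n : ℕ) : Submodule R Γ :=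
  Submodule.span R ((fun i => π ^ (n * i) • D i x) '' (Set.Icc 1 d)) ⊔ W

/-- restricted curve -/
def rst (D : ℕ → R → Γ) (m : ℕ) (x0 : R) : ℕ → R → Γ := fun i y => π ^ (m * i) • D i (x0 + π ^ m * y)

variable {π} {D : ℕ → R → Γ} {d : ℕ} {W : Submodule R Γ} {k N : ℕ}

lemma W_le_Lw (x : R) (n : ℕ) : W ≤ Lw π D d W x n := le_sup_right

lemma mem_Lw {x : R} {n i : ℕ} (h1 : 1 ≤ i) (h2 : i ≤ d) : π ^ (n * i) • D i x ∈ Lw π D d W x n :=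
  Submodule.mem_sup_left (Submodule.subset_span ⟨i, ⟨h1, h2⟩, rfl⟩)

lemma Lw_mono_W {W' : Submodule R Γ} (h : W ≤ W') (x : R) (n : ℕ) :
    Lw π D d W x n ≤ Lw π D d W' x n := sup_le_sup_left h _

lemma Lw_le (hT : ∀ i x y, D i (x + y) =
      ∑ j ∈ range (d + 1), ((Nat.choose j i : R) * y ^ (j - i)) • D j x)
    {x x' : R} {n n' : ℕ} (hx : π ^ n ∣ x' - x) (hn : n ≤ n') :
    Lw π D d W x' n' ≤ Lw π D d W x n := by
  apply sup_le _ (W_le_Lw x n)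
  rw [Submodule.span_le]
  rintro _ ⟨i, ⟨hi1, hi2⟩, rfl⟩
  obtain ⟨y, hy⟩ := hx
  have hx' : x' = x + π ^ n * y := by rw [← hy]; ring
  simp only [SetLike.mem_coe]
  rw [hx', hT, Finset.smul_sum]
  refine Submodule.sum_mem _ fun j hj => ?_
  rw [smul_smul]
  by_cases hij : j < i
  · rw [Nat.choose_eq_zero_of_lt hij]; simp
  push Not at hij
  have : π ^ (n' * i) * ((Nat.choose j i : R) * (π ^ n * y) ^ (j - i)) =
      (π ^ ((n' - n) * i) * (Nat.choose j i : R) * y ^ (j - i)) * π ^ (n * j) := by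
    obtain ⟨t, rfl⟩ := Nat.exists_eq_add_of_le hij
    obtain ⟨s, rfl⟩ := Nat.exists_eq_add_of_le hn
    simp only [Nat.add_sub_cancel_left]
    ring
  rw [this, ← smul_smul]
  exact Submodule.smul_mem _ _ (mem_Lw (by omega) (by simp at hj; omega))

lemma D0_sub (hT : ∀ i x y, D i (x + y) =
      ∑ j ∈ range (d + 1), ((Nat.choose j i : R) * y ^ (j - i)) • D j x) (x y : R) :
    D 0 (x + y) - D 0 x = ∑ j ∈ Icc 1 d, y ^ j • D j x := by
  rw [hT 0 x y, Finset.sum_range_succ']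
  simp only [Nat.choose_zero_right, Nat.cast_one, one_mul, Nat.sub_zero, pow_zero, one_smul,
    add_sub_cancel_right]
  rw [Finset.range_eq_Ico, Finset.sum_Ico_add' (fun j => y ^ j • D j x) 0 d 1]
  refine Finset.sum_congr ?_ fun _ _ => rfl
  ext j; simp

lemma D0_sub_mem (hT : ∀ i x y, D i (x + y) =
      ∑ j ∈ range (d + 1), ((Nat.choose j i : R) * y ^ (j - i)) • D j x)
    {x x' : R} {n : ℕ} (hx : π ^ n ∣ x' - x) :
    D 0 x' - D 0 x ∈ Lw π D d W x n := by
  obtain ⟨y, hy⟩ := hx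
  have hx' : x' = x + π ^ n * y := by rw [← hy]; ring
  rw [hx', D0_sub hT]
  refine Submodule.sum_mem _ fun j hj => ?_
  rw [mul_pow, ← pow_mul, mul_comm, ← smul_smul]
  simp at hj
  exact Submodule.smul_mem _ _ (mem_Lw hj.1 hj.2)

lemma rst_taylor (hT : ∀ i x y, D i (x + y) =
      ∑ j ∈ range (d + 1), ((Nat.choose j i : R) * y ^ (j - i)) • D j x) (m : ℕ) (x0 : R) (i x y) :
    rst π D m x0 i (x + y) = ∑ j ∈ range (d + 1), ((Nat.choose j i : R) * y ^ (j - i)) •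
      rst π D m x0 j x := by
  unfold rst
  rw [mul_add, ← add_assoc, hT, Finset.smul_sum]
  refine Finset.sum_congr rfl fun j hj => ?_
  rw [smul_smul, smul_smul]
  by_cases hij : j < i
  · rw [Nat.choose_eq_zero_of_lt hij]; simp
  push Not at hij
  congr 1
  obtain ⟨t, rfl⟩ := Nat.exists_eq_add_of_le hij
  simp only [Nat.add_sub_cancel_left]
  ring

lemma rst_Lw (m n : ℕ) (x0 y : R) :
    Lw π (rst π D m x0) d W y n = Lw π D d W (x0 + π ^ m * y) (m + n) := by
  unfold Lw rst
  congr 2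
  refine Set.image_congr fun i _ => ?_
  rw [smul_smul, ← pow_add]
  congr 2
  ring

lemma Sys.rst [IsDomain R] (hπ : π ≠ 0) (h : Sys π D d W k N) {m : ℕ} (hm : m ≤ N) (x0 : R) :
    Sys π (rst π D m x0) d W k (N - m) where
  kd := h.kd
  taylor := rst_taylor h.taylor m x0
  high := by
    intro x j hj hjd
    obtain ⟨c, hc⟩ := h.high (x0 + π ^ m * x) j hj hjd
    refine ⟨fun i => π ^ (m * (j - i)) * c i, ?_⟩
    have := W.smul_mem (π ^ (m * j)) hc
    convert this using 1
    rw [smul_sub, Finset.smul_sum]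
    unfold VM.rst
    congr 1
    refine Finset.sum_congr rfl fun i hi => ?_
    rw [smul_smul, smul_smul]
    congr 1
    simp at hi
    obtain ⟨t, rfl⟩ := Nat.exists_eq_add_of_le (show i ≤ j by omega)
    simp only [Nat.add_sub_cancel_left]
    ring
  indep := by
    intro x c hc i hi
    unfold VM.rst at hc
    simp only [smul_smul] at hc
    have := h.indep (x0 + π ^ m * x) (fun i => c i * π ^ (m * i)) hc i hi
    have h2 : N * i = (N - m) * i + m * i := by
      rw [← add_mul]; congr 1; omega
    rw [h2, pow_add] at this
    exact (mul_dvd_mul_iff_right (pow_ne_zero _ hπ)).mp this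

end sys
end VM

open MeasureTheory Finset
open scoped Classical

set_option linter.unusedSectionVars false
set_option linter.all false
namespace VM
section transv
variable {R : Type} [CommRing R] [IsDomain R] {π : R} {Γ : Type} [AddCommGroup Γ] [Module R Γ]
variable {D : ℕ → R → Γ} {d : ℕ} {W : Submodule R Γ} {k n : ℕ}

/-- the lattice used for a transversal ball -/
def Wt (π : R) (D : ℕ → R → Γ) (d : ℕ) (W : Submodule R Γ) (x2 : R) (m b : ℕ) : Submodule R Γ :=
  Submodule.span R ((fun i => D i x2) '' (Set.Icc 1 m)) ⊔ Lw π D d W x2 b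

lemma Lw_le_Wt (x2 : R) (m b : ℕ) : Lw π D d W x2 b ≤ Wt π D d W x2 m b := le_sup_right

lemma Wt_char (h : Sys π D d W k n) (x2 : R) {m b : ℕ} (hm : m ≤ k) {y : Γ}
    (hy : y ∈ Wt π D d W x2 m b) : ∃ t : ℕ → R, (∀ j, m < j → j ≤ k → π ^ (b * j) ∣ t j) ∧
      y - ∑ j ∈ Icc 1 k, t j • D j x2 ∈ W := by
  let P : Submodule R Γ :=
    { carrier := {y | ∃ t : ℕ → R, (∀ j, m < j → j ≤ k → π ^ (b * j) ∣ t j) ∧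
        y - ∑ j ∈ Icc 1 k, t j • D j x2 ∈ W}
      zero_mem' := ⟨0, by simp, by simp⟩
      add_mem' := by
        rintro y y' ⟨t, h1, h2⟩ ⟨t', h1', h2'⟩
        refine ⟨t + t', fun j a b => dvd_add (h1 j a b) (h1' j a b), ?_⟩
        convert W.add_mem h2 h2' using 1
        simp only [Pi.add_apply, add_smul, Finset.sum_add_distrib]
        abel
      smul_mem' := by
        rintro c y ⟨t, h1, h2⟩
        refine ⟨fun j => c * t j, fun j a b => (h1 j a b).mul_left c, ?_⟩
        convert W.smul_mem c h2 using 1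
        simp only [smul_sub, Finset.smul_sum, smul_smul] }
  have single : ∀ i, 1 ≤ i → i ≤ k → ∀ u : R,
      u • D i x2 = ∑ j ∈ Icc 1 k, (if j = i then u else 0) • D j x2 := by
    intro i h1 h2 u
    rw [Finset.sum_eq_single i]
    · simp
    · intro j _ hj; simp [hj]
    · intro hi; simp at hi; omega
  suffices Wt π D d W x2 m b ≤ P from this hy
  refine sup_le ?_ (sup_le ?_ ?_)
  · rw [Submodule.span_le]
    rintro _ ⟨i, ⟨h1, h2⟩, rfl⟩
    refine ⟨fun j => if j = i then 1 else 0, fun j hj _ => ?_, ?_⟩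
    · simp [show j ≠ i by omega]
    · rw [← single i h1 (by omega) 1]; simp
  · rw [Submodule.span_le]
    rintro _ ⟨i, ⟨h1, h2⟩, rfl⟩
    by_cases hik : i ≤ k
    · refine ⟨fun j => if j = i then π ^ (b * i) else 0, fun j hj _ => ?_, ?_⟩
      · by_cases hj : j = i
        · simp [hj]
        · simp [hj]
      · rw [← single i h1 (by omega)]; simp
    · obtain ⟨c, hc⟩ := h.high x2 i (by omega) h2
      refine ⟨fun j => π ^ (b * i) * (π * c j), fun j hj hjk => ?_, ?_⟩
      · exact (pow_dvd_pow π (Nat.mul_le_mul_left b (by omega))).mul_right _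
      · convert W.smul_mem (π ^ (b * i)) hc using 1
        simp only [smul_sub, Finset.smul_sum, smul_smul]
  · intro y hy
    exact ⟨0, by simp, by simpa using hy⟩

lemma Wt_indep (h : Sys π D d W k n) (x2 : R) {l b : ℕ} (hl : l ≤ k) (hb : b ≤ n) (v : Fin l → R)
    (hv : ∑ s : Fin l, v s • D (k - l + 1 + s) x2 ∈ Wt π D d W x2 (k - l) b) (s : Fin l) :
    π ^ (b * (k - l + 1)) ∣ v s := by
  obtain ⟨t, h1, h2⟩ := Wt_char h x2 (Nat.sub_le _ _) hv
  let v' : ℕ → R := fun j => if hj : k - l + 1 ≤ j ∧ j - (k - l + 1) < l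
    then v ⟨j - (k - l + 1), hj.2⟩ else 0
  have e1 : ∑ s : Fin l, v s • D (k - l + 1 + s) x2 = ∑ j ∈ Icc 1 k, v' j • D j x2 := by
    apply Finset.sum_of_injOn (e := fun s : Fin l => k - l + 1 + (s : ℕ))
    · intro a _ b _ hab
      simp at hab
      exact Fin.ext hab
    · intro a _; have := a.2; simp; omega
    · intro j hj hj'
      have : v' j = 0 := by
        simp only [v']
        rw [dif_neg]
        rintro ⟨g1, g2⟩
        apply hj'
        refine ⟨⟨j - (k - l + 1), g2⟩, by simp, ?_⟩
        simp; omega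
      rw [this, zero_smul]
    · intro a _
      have : v' (k - l + 1 + a) = v a := by
        simp only [v']
        rw [dif_pos ⟨by omega, by have := a.2; omega⟩]
        congr 1
        apply Fin.ext; simp
      rw [this]
  rw [e1, ← Finset.sum_sub_distrib] at h2
  simp only [← sub_smul] at h2
  have hs := s.2
  have h3 := h.indep x2 _ h2 (k - l + 1 + s) (by simp; omega)
  have hv' : v' (k - l + 1 + s) = v s := by
    simp only [v']
    rw [dif_pos ⟨by omega, by have := s.2; omega⟩]
    congr 1
    apply Fin.ext; simp
  rw [hv'] at h3
  have h4 := h1 (k - l + 1 + s) (by omega) (by omega)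
  have h5 : π ^ (b * (k - l + 1)) ∣ π ^ (b * (k - l + 1 + s)) :=
    pow_dvd_pow _ (Nat.mul_le_mul_left _ (by omega))
  have h6 : π ^ (b * (k - l + 1)) ∣ π ^ (n * (k - l + 1 + s)) :=
    pow_dvd_pow _ (Nat.mul_le_mul hb (by omega))
  have := dvd_add (h6.trans h3) (h5.trans h4)
  simpa using this

lemma Wt_mat (h : Sys π D d W k n) (x2 z : R) {l b : ℕ} (hl : l ≤ k) :
    ∃ B : ℕ → Fin l → R, ∀ i, 1 ≤ i → D i (x2 + z) - ∑ s : Fin l,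
      ((Nat.choose (k - l + 1 + s) i : R) * z ^ (k - l + 1 + s - i) + π * B i s) •
        D (k - l + 1 + s) x2 ∈ Wt π D d W x2 (k - l) b := by
  have hW : W ≤ Wt π D d W x2 (k - l) b := (W_le_Lw x2 b).trans (Lw_le_Wt x2 _ b)
  have hhigh : ∀ j, ∃ c : ℕ → R, k < j → j ≤ d →
      D j x2 - ∑ i ∈ Icc 1 k, (π * c i) • D i x2 ∈ W := by
    intro j
    by_cases hj : k < j ∧ j ≤ d
    · obtain ⟨c, hc⟩ := h.high x2 j hj.1 hj.2
      exact ⟨c, fun _ _ => hc⟩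
    · exact ⟨0, fun a b => absurd ⟨a, b⟩ hj⟩
  choose c hc using hhigh
  let q := (Wt π D d W x2 (k - l) b).mkQ
  have hq0 : ∀ y, y ∈ Wt π D d W x2 (k - l) b ↔ q y = 0 := fun y => by
    simp [q]
  have hlow : ∀ j, 1 ≤ j → j ≤ k - l → q (D j x2) = 0 := by
    intro j h1 h2
    rw [← hq0]
    exact Submodule.mem_sup_left (Submodule.subset_span ⟨j, ⟨h1, h2⟩, rfl⟩)
  have hred : ∀ u : ℕ → R, ∑ i ∈ Icc 1 k, u i • q (D i x2) =
      ∑ s : Fin l, u (k - l + 1 + s) • q (D (k - l + 1 + s) x2) := by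
    intro u
    symm
    apply Finset.sum_of_injOn (e := fun s : Fin l => k - l + 1 + (s : ℕ))
    · intro a _ b _ hab
      simp at hab
      exact Fin.ext hab
    · intro a _; have := a.2; simp; omega
    · intro j hj hj'
      simp at hj
      rw [hlow j hj.1, smul_zero]
      by_contra hcon
      apply hj'
      refine ⟨⟨j - (k - l + 1), by omega⟩, by simp, ?_⟩
      simp; omega
    · intro a _; rfl
  refine ⟨fun i s => ∑ j ∈ Ioc k d, (Nat.choose j i : R) * z ^ (j - i) * c j (k - l + 1 + s),
    fun i hi => ?_⟩
  rw [hq0, map_sub, sub_eq_zero, h.taylor]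
  simp only [map_sum, map_smul]
  have e1 : range (d + 1) = insert 0 (Icc 1 k ∪ Ioc k d) := by
    ext j; simp; have := h.kd; omega
  rw [e1, Finset.sum_insert (by simp), Finset.sum_union, Nat.choose_eq_zero_of_lt (by omega),
    hred (fun j => (Nat.choose j i : R) * z ^ (j - i))]
  · have : ∀ j ∈ Ioc k d, ((Nat.choose j i : R) * z ^ (j - i)) • q (D j x2) =
      ∑ s : Fin l, (π * ((Nat.choose j i : R) * z ^ (j - i) * c j (k - l + 1 + s))) •
        q (D (k - l + 1 + s) x2) := by
      intro j hj
      simp at hj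
      have h1 := hW (hc j hj.1 hj.2)
      rw [hq0, map_sub, sub_eq_zero] at h1
      simp only [map_sum, map_smul] at h1
      rw [h1, hred (fun i => π * c j i), Finset.smul_sum]
      refine Finset.sum_congr rfl fun s _ => ?_
      rw [smul_smul]; congr 1; ring
    rw [Finset.sum_congr rfl this, Finset.sum_comm, ← Finset.sum_add_distrib]
    simp only [Nat.cast_zero, zero_mul, zero_smul, zero_add]
    refine Finset.sum_congr rfl fun s _ => ?_
    rw [← Finset.sum_smul, ← add_smul, ← Finset.mul_sum]
  · rw [Finset.disjoint_left]; intro j; simp; omega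

lemma Wt_T (hπ : ∀ x : R, ¬π ∣ x → IsUnit x) (hπ0 : ¬ IsUnit π)
    (hch : ∀ j : ℕ, 1 ≤ j → j ≤ k → IsUnit (j : R))
    (h : Sys π D d W k n) (x2 z : R) (hz : IsUnit z) {l b : ℕ} (hl : l ≤ k) (hb : b ≤ n) :
    (∀ j, 1 ≤ j → ∃ c : ℕ → R, D j (x2 + z) - ∑ i ∈ Icc 1 l, c i • D i (x2 + z) ∈
      Wt π D d W x2 (k - l) b) ∧
    (∀ c : ℕ → R, ∑ i ∈ Icc 1 l, c i • D i (x2 + z) ∈ Wt π D d W x2 (k - l) b →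
      ∀ i ∈ Icc 1 l, π ^ (b * (k - l + 1)) ∣ c i) := by
  obtain ⟨B, hB⟩ := Wt_mat (b := b) h x2 z hl
  let q := (Wt π D d W x2 (k - l) b).mkQ
  have hq0 : ∀ y, y ∈ Wt π D d W x2 (k - l) b ↔ q y = 0 := fun y => by
    simp [q]
  let M : ℕ → Fin l → R := fun i s => (Nat.choose (k - l + 1 + s) i : R) * z ^ (k - l + 1 + s - i)
    + π * B i s
  let A : Matrix (Fin l) (Fin l) R := Matrix.of fun i s => M (i + 1) s
  have hA : IsUnit A.det := by
    have := transv_det π hπ hπ0 (k - l) l z hz (fun j h1 h2 => hch j h1 (by omega))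
      (fun i s => B (i + 1) s)
    exact this
  let E : Fin l → _ := fun s => q (D (k - l + 1 + s) x2)
  have hV : ∀ i, 1 ≤ i → q (D i (x2 + z)) = ∑ s, M i s • E s := by
    intro i hi
    have := hB i hi
    rw [hq0, map_sub, sub_eq_zero] at this
    simpa only [map_sum, map_smul] using this
  have hE : ∀ s, E s = ∑ i : Fin l, A⁻¹ s i • q (D (i + 1) (x2 + z)) := by
    intro s
    have h1 : A⁻¹ * A = 1 := Matrix.nonsing_inv_mul _ hA
    have : ∀ i : Fin l, A⁻¹ s i • q (D (i + 1) (x2 + z)) = ∑ t, (A⁻¹ s i * A i t) • E t := by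
      intro i
      rw [hV _ (by omega), Finset.smul_sum]
      simp only [smul_smul]; rfl
    simp only [this]
    rw [Finset.sum_comm]
    simp only [← Finset.sum_smul, ← Matrix.mul_apply, h1]
    rw [Finset.sum_eq_single s]
    · simp
    · intro t _ ht; rw [Matrix.one_apply_ne (Ne.symm ht)]; simp
    · simp
  have hIcc : ∀ u : ℕ → R, ∑ i ∈ Icc 1 l, u i • q (D i (x2 + z)) =
      ∑ i : Fin l, u (i + 1) • q (D (i + 1) (x2 + z)) := by
    intro u
    symm
    apply Finset.sum_of_injOn (e := fun s : Fin l => (s : ℕ) + 1)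
    · intro a _ b _ hab
      simp at hab
      exact Fin.ext hab
    · intro a _; have := a.2; simp
    · intro j hj hj'
      simp at hj
      exact absurd ⟨⟨j - 1, by omega⟩, by simp, by simp; omega⟩ hj'
    · intro a _; rfl
  constructor
  · intro j hj
    refine ⟨fun i => if hi : i - 1 < l then ∑ s, M j s * A⁻¹ s ⟨i - 1, hi⟩ else 0, ?_⟩
    rw [hq0, map_sub, sub_eq_zero]
    simp only [map_sum, map_smul]
    rw [hIcc, hV j hj]
    simp only [hE, Finset.smul_sum, smul_smul]
    rw [Finset.sum_comm]
    refine Finset.sum_congr rfl fun i _ => ?_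
    rw [dif_pos (by simp), ← Finset.sum_smul]
    rfl
  · intro c hc
    rw [hq0] at hc
    simp only [map_sum, map_smul] at hc
    rw [hIcc] at hc
    let u : Fin l → R := fun s => ∑ i : Fin l, c (i + 1) * A i s
    have hu : ∑ s, u s • E s = 0 := by
      rw [← hc]
      have : ∀ i : Fin l, c (i + 1) • q (D (i + 1) (x2 + z)) = ∑ s, (c (i + 1) * A i s) • E s := by
        intro i
        rw [hV _ (by omega), Finset.smul_sum]
        simp only [smul_smul]; rfl
      simp only [this]
      rw [Finset.sum_comm]
      simp only [u, Finset.sum_smul]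
    have hu2 := Wt_indep h x2 hl hb u (by
      rw [hq0]; simp only [map_sum, map_smul]; exact hu)
    have h1 : A * A⁻¹ = 1 := Matrix.mul_nonsing_inv _ hA
    intro i hi
    simp at hi
    let i' : Fin l := ⟨i - 1, by omega⟩
    have : c i = ∑ s, u s * A⁻¹ s i' := by
      simp only [u, Finset.sum_mul, mul_assoc]
      rw [Finset.sum_comm]
      simp only [← Finset.mul_sum, ← Matrix.mul_apply, h1]
      rw [Finset.sum_eq_single i']
      · simp [i']; congr 1; omega
      · intro t _ ht; rw [Matrix.one_apply_ne ht]; simp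
      · simp
    rw [this]
    exact Finset.dvd_sum fun s _ => (hu2 s).mul_right _

lemma Sys.transv (hπ : ∀ x : R, ¬π ∣ x → IsUnit x) (hπ0 : ¬ IsUnit π) (hπz : π ≠ 0)
    (hch : ∀ j : ℕ, 1 ≤ j → j ≤ k → IsUnit (j : R))
    (h : Sys π D d W k n) (x1 x2 : R) (hz : IsUnit (x1 - x2)) {l b a a' : ℕ} (hl : l ≤ k)
    (hb : b ≤ n) (ha : 1 ≤ a) (haa : a ≤ a') (hab : a' * l ≤ b * (k - l + 1)) :
    Sys π (VM.rst π D a x1) d (Wt π D d W x2 (k - l) b) l (a' - a) := by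
  have hx : ∀ y, ∃ z, IsUnit z ∧ x1 + π ^ a * y = x2 + z := by
    intro y
    refine ⟨x1 - x2 + π ^ a * y, ?_, by ring⟩
    apply hπ
    intro hd
    have : π ∣ x1 - x2 := by
      have h2 : π ∣ π ^ a * y := (dvd_pow_self π (by omega)).mul_right _
      have := dvd_sub hd h2
      simpa using this
    exact hπ0 (isUnit_of_dvd_unit this hz)
  refine ⟨hl.trans h.kd, rst_taylor h.taylor a x1, ?_, ?_⟩
  · intro y j hj hjd
    obtain ⟨z, hz, hxz⟩ := hx y
    obtain ⟨c, hc⟩ := (Wt_T hπ hπ0 hch h x2 z hz hl hb).1 j (by omega)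
    refine ⟨fun i => π ^ (a * (j - i) - 1) * c i, ?_⟩
    convert Submodule.smul_mem _ (π ^ (a * j)) hc using 1
    rw [smul_sub, Finset.smul_sum]
    unfold VM.rst
    rw [hxz]
    congr 1
    refine Finset.sum_congr rfl fun i hi => ?_
    rw [smul_smul, smul_smul]
    congr 1
    simp at hi
    obtain ⟨t, rfl⟩ := Nat.exists_eq_add_of_lt (show i < j by omega)
    obtain ⟨a1, rfl⟩ := Nat.exists_eq_add_of_le ha
    have : i + t + 1 - i = t + 1 := by omega
    beta_reduce
    rw [this]
    have : (1 + a1) * (t + 1) - 1 = a1 * (t + 1) + t := by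
      have : (1 + a1) * (t + 1) = a1 * (t + 1) + t + 1 := by ring
      omega
    rw [this]
    ring
  · intro y c hc i hi
    obtain ⟨z, hz, hxz⟩ := hx y
    unfold VM.rst at hc
    rw [hxz] at hc
    simp only [smul_smul] at hc
    have := (Wt_T hπ hπ0 hch h x2 z hz hl hb).2 (fun i => c i * π ^ (a * i)) hc i hi
    simp at hi
    have h2 : π ^ ((a' - a) * i + a * i) ∣ π ^ (b * (k - l + 1)) := by
      apply pow_dvd_pow
      rw [← add_mul, Nat.sub_add_cancel haa]
      exact (Nat.mul_le_mul_left a' hi.2).trans hab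
    have h3 := h2.trans this
    rw [pow_add] at h3
    exact (mul_dvd_mul_iff_right (pow_ne_zero _ hπz)).mp h3

end transv
end VM

open MeasureTheory Finset
open scoped Classical

set_option linter.all false
namespace VM
section ineq
variable {G : Type} [Fintype G]

/-- weighted `L^s` norm of a nonnegative function -/
noncomputable def Ls (w : G → ℝ) (s : ℕ) (u : G → ℝ) : ℝ := (∑ g, w g * u g ^ s) ^ (1 / (s : ℝ))

variable {w : G → ℝ} {s : ℕ}

lemma Ls_sum_nonneg (hw : ∀ g, 0 ≤ w g) {u : G → ℝ} (hu : ∀ g, 0 ≤ u g) :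
    0 ≤ ∑ g, w g * u g ^ s :=
  Finset.sum_nonneg fun g _ => mul_nonneg (hw g) (pow_nonneg (hu g) s)

lemma Ls_nonneg (hw : ∀ g, 0 ≤ w g) {u : G → ℝ} (hu : ∀ g, 0 ≤ u g) : 0 ≤ Ls w s u :=
  Real.rpow_nonneg (Ls_sum_nonneg hw hu) _

lemma Ls_pow (hs : 1 ≤ s) (hw : ∀ g, 0 ≤ w g) {u : G → ℝ} (hu : ∀ g, 0 ≤ u g) :
    Ls w s u ^ s = ∑ g, w g * u g ^ s := by
  unfold Ls
  rw [one_div, Real.rpow_inv_natCast_pow (Ls_sum_nonneg hw hu) (by omega)]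

lemma Ls_le {C : ℝ} (hs : 1 ≤ s) (hw : ∀ g, 0 ≤ w g) {u : G → ℝ} (hu : ∀ g, 0 ≤ u g) (hC : 0 ≤ C)
    (h : ∑ g, w g * u g ^ s ≤ C ^ s) : Ls w s u ≤ C := by
  rw [← Ls_pow hs hw hu] at h
  exact le_of_pow_le_pow_left₀ (by omega) hC h

lemma Ls_mono (hs : 1 ≤ s) (hw : ∀ g, 0 ≤ w g) {u v : G → ℝ} (hu : ∀ g, 0 ≤ u g)
    (h : ∀ g, u g ≤ v g) : Ls w s u ≤ Ls w s v := by
  have hv : ∀ g, 0 ≤ v g := fun g => (hu g).trans (h g)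
  apply Ls_le hs hw hu (Ls_nonneg hw hv)
  rw [Ls_pow hs hw hv]
  exact Finset.sum_le_sum fun g _ => mul_le_mul_of_nonneg_left (pow_le_pow_left₀ (hu g) (h g) s) (hw g)

lemma Ls_add (hs : 1 ≤ s) (hw : ∀ g, 0 ≤ w g) {u v : G → ℝ} (hu : ∀ g, 0 ≤ u g)
    (hv : ∀ g, 0 ≤ v g) : Ls w s (fun g => u g + v g) ≤ Ls w s u + Ls w s v := by
  have hs' : (1 : ℝ) ≤ s := by exact_mod_cast hs
  have key : ∀ t : G → ℝ, (∀ g, 0 ≤ t g) → ∀ g,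
      (w g ^ (1 / (s : ℝ)) * t g) ^ (s : ℝ) = w g * t g ^ s := by
    intro t ht g
    rw [Real.mul_rpow (Real.rpow_nonneg (hw g) _) (ht g), ← Real.rpow_mul (hw g),
      one_div_mul_cancel (by positivity), Real.rpow_one, Real.rpow_natCast]
  have h := Real.Lp_add_le_of_nonneg (s := Finset.univ) (p := (s : ℝ)) hs'
    (f := fun g => w g ^ (1 / (s : ℝ)) * u g) (g := fun g => w g ^ (1 / (s : ℝ)) * v g)
    (fun g _ => mul_nonneg (Real.rpow_nonneg (hw g) _) (hu g))
    (fun g _ => mul_nonneg (Real.rpow_nonneg (hw g) _) (hv g))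
  simp only [← mul_add, key u hu, key v hv] at h
  unfold Ls
  rw [Finset.sum_congr rfl fun g _ => key (fun g => u g + v g)
    (fun g => add_nonneg (hu g) (hv g)) g] at h
  exact h

lemma Ls_sum {ι : Type} (T : Finset ι) (hs : 1 ≤ s) (hw : ∀ g, 0 ≤ w g) {u : ι → G → ℝ}
    (hu : ∀ i g, 0 ≤ u i g) : Ls w s (fun g => ∑ i ∈ T, u i g) ≤ ∑ i ∈ T, Ls w s (u i) := by
  induction T using Finset.induction_on with
  | empty =>
    simp only [Finset.sum_empty]
    apply Ls_le hs hw (by simp) le_rfl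
    simp [show s ≠ 0 by omega]
  | insert a T ha ih =>
    simp only [Finset.sum_insert ha]
    exact (Ls_add hs hw (hu a) (fun g => Finset.sum_nonneg fun i _ => hu i g)).trans
      (add_le_add le_rfl ih)

lemma Ls_smul (hs : 1 ≤ s) (hw : ∀ g, 0 ≤ w g) {u : G → ℝ} (hu : ∀ g, 0 ≤ u g) {c : ℝ}
    (hc : 0 ≤ c) : Ls w s (fun g => c * u g) ≤ c * Ls w s u := by
  apply Ls_le hs hw (fun g => mul_nonneg hc (hu g)) (mul_nonneg hc (Ls_nonneg hw hu))
  rw [mul_pow, Ls_pow hs hw hu, Finset.mul_sum]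
  apply le_of_eq
  refine Finset.sum_congr rfl fun g _ => ?_
  rw [mul_pow]; ring

/-- integer form of Hölder -/
lemma holder_int {ι : Type} (T : Finset ι) {a b : ℕ} (hab : 1 ≤ a + b) {u A B : ι → ℝ}
    (hu : ∀ i, 0 ≤ u i) (hA : ∀ i, 0 ≤ A i) (hB : ∀ i, 0 ≤ B i)
    (h : ∀ i, u i ^ (a + b) ≤ A i ^ a * B i ^ b) :
    (∑ i ∈ T, u i) ^ (a + b) ≤ (∑ i ∈ T, A i) ^ a * (∑ i ∈ T, B i) ^ b := by
  have hs0 : 0 ≤ ∑ i ∈ T, u i := Finset.sum_nonneg fun i _ => hu i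
  rcases Nat.eq_zero_or_pos a with rfl | ha
  · simp only [zero_add, pow_zero, one_mul] at *
    refine pow_le_pow_left₀ hs0 (Finset.sum_le_sum fun i _ => ?_) _
    exact le_of_pow_le_pow_left₀ (by omega) (hB i) (h i)
  rcases Nat.eq_zero_or_pos b with rfl | hb
  · simp only [add_zero, pow_zero, mul_one] at *
    refine pow_le_pow_left₀ hs0 (Finset.sum_le_sum fun i _ => ?_) _
    exact le_of_pow_le_pow_left₀ (by omega) (hA i) (h i)
  have ha' : (0 : ℝ) < a := by exact_mod_cast ha
  have hb' : (0 : ℝ) < b := by exact_mod_cast hb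
  have hs' : (0 : ℝ) < ((a + b : ℕ) : ℝ) := by push_cast; linarith
  set S : ℝ := ((a + b : ℕ) : ℝ) with hS
  have hSab : S = a + b := by rw [hS]; push_cast; ring
  have hconj : (S / a).HolderConjugate (S / b) := by
    rw [Real.holderConjugate_iff]
    constructor
    · rw [lt_div_iff₀ ha']; linarith
    · rw [inv_div, inv_div, ← add_div, ← hSab, div_self hs'.ne']
  have h1 := Real.inner_le_Lp_mul_Lq_of_nonneg T hconj (f := fun i => A i ^ ((a : ℝ) / S))
    (g := fun i => B i ^ ((b : ℝ) / S)) (fun i _ => Real.rpow_nonneg (hA i) _)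
    (fun i _ => Real.rpow_nonneg (hB i) _)
  have e1 : ∀ i, (A i ^ ((a : ℝ) / S)) ^ (S / a) = A i := by
    intro i
    rw [← Real.rpow_mul (hA i), div_mul_div_cancel₀ hs'.ne', div_self ha'.ne', Real.rpow_one]
  have e2 : ∀ i, (B i ^ ((b : ℝ) / S)) ^ (S / b) = B i := by
    intro i
    rw [← Real.rpow_mul (hB i), div_mul_div_cancel₀ hs'.ne', div_self hb'.ne', Real.rpow_one]
  simp only [e1, e2, one_div_div] at h1
  have h2 : ∑ i ∈ T, u i ≤ ∑ i ∈ T, A i ^ ((a : ℝ) / S) * B i ^ ((b : ℝ) / S) := by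
    refine Finset.sum_le_sum fun i _ => ?_
    apply le_of_pow_le_pow_left₀ (n := a + b) (by omega)
      (mul_nonneg (Real.rpow_nonneg (hA i) _) (Real.rpow_nonneg (hB i) _))
    refine (h i).trans (le_of_eq ?_)
    rw [mul_pow, ← Real.rpow_natCast (A i ^ _), ← Real.rpow_natCast (B i ^ _),
      ← Real.rpow_mul (hA i), ← Real.rpow_mul (hB i), ← hS, div_mul_cancel₀ _ hs'.ne',
      div_mul_cancel₀ _ hs'.ne', Real.rpow_natCast, Real.rpow_natCast]
  have hA' : 0 ≤ ∑ i ∈ T, A i := Finset.sum_nonneg fun i _ => hA i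
  have hB' : 0 ≤ ∑ i ∈ T, B i := Finset.sum_nonneg fun i _ => hB i
  refine (pow_le_pow_left₀ hs0 (h2.trans h1) _).trans (le_of_eq ?_)
  rw [mul_pow, ← Real.rpow_natCast (_ ^ _), ← Real.rpow_natCast (_ ^ ((b : ℝ) / S)),
      ← Real.rpow_mul hA', ← Real.rpow_mul hB', ← hS, div_mul_cancel₀ _ hs'.ne',
      div_mul_cancel₀ _ hs'.ne', Real.rpow_natCast, Real.rpow_natCast]

/-- if `n_r^t ≤ M S_r^t` then `(Σ n_r)^t ≤ M (Σ S_r)^t` -/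
lemma sum_pow_le {ι : Type} (T : Finset ι) {t : ℕ} (ht : 1 ≤ t) {u S : ι → ℝ} {M : ℝ}
    (hM : 0 ≤ M) (hu : ∀ i ∈ T, 0 ≤ u i) (hS : ∀ i ∈ T, 0 ≤ S i)
    (h : ∀ i ∈ T, u i ^ t ≤ M * S i ^ t) :
    (∑ i ∈ T, u i) ^ t ≤ M * (∑ i ∈ T, S i) ^ t := by
  obtain ⟨c, hc, hcM⟩ : ∃ c : ℝ, 0 ≤ c ∧ c ^ t = M :=
    ⟨M ^ ((t : ℝ)⁻¹), Real.rpow_nonneg hM _, Real.rpow_inv_natCast_pow hM (by omega)⟩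
  rw [← hcM, ← mul_pow, Finset.mul_sum]
  refine pow_le_pow_left₀ (Finset.sum_nonneg hu) (Finset.sum_le_sum fun i hi => ?_) _
  apply le_of_pow_le_pow_left₀ (n := t) (by omega) (mul_nonneg hc (hS i hi))
  rw [mul_pow, hcM]; exact h i hi

/-- squared `L^{2s}` norm -/
noncomputable def nrm (w : G → ℝ) (s : ℕ) (F : G → ℂ) : ℝ := Ls w s (fun g => ‖F g‖ ^ 2)

lemma nrm_nonneg (hw : ∀ g, 0 ≤ w g) (F : G → ℂ) : 0 ≤ nrm w s F :=
  Ls_nonneg hw fun g => sq_nonneg _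

lemma nrm_pow (hs : 1 ≤ s) (hw : ∀ g, 0 ≤ w g) (F : G → ℂ) :
    nrm w s F ^ s = ∑ g, w g * (‖F g‖ ^ 2) ^ s := Ls_pow hs hw fun g => sq_nonneg _

lemma norm_sum_sq {ι : Type} (T : Finset ι) (f : ι → ℂ) :
    ‖∑ i ∈ T, f i‖ ^ 2 ≤ (T.card : ℝ) * ∑ i ∈ T, ‖f i‖ ^ 2 := by
  have h1 : ‖∑ i ∈ T, f i‖ ≤ ∑ i ∈ T, ‖f i‖ := norm_sum_le _ _
  refine (pow_le_pow_left₀ (norm_nonneg _) h1 2).trans ?_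
  exact sq_sum_le_card_mul_sum_sq

lemma nrm_sum {ι : Type} (T : Finset ι) (hs : 1 ≤ s) (hw : ∀ g, 0 ≤ w g) (f : ι → G → ℂ) :
    nrm w s (fun g => ∑ i ∈ T, f i g) ≤ (T.card : ℝ) * ∑ i ∈ T, nrm w s (f i) := by
  have h1 := Ls_mono hs hw (fun g => sq_nonneg _) (fun g => norm_sum_sq T (fun i => f i g))
  refine h1.trans ((Ls_smul hs hw (fun g => Finset.sum_nonneg fun i _ => sq_nonneg _)
    (Nat.cast_nonneg _)).trans ?_)
  gcongr
  exact Ls_sum T hs hw fun i g => sq_nonneg _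

end ineq
end VM

open MeasureTheory Finset
open scoped Classical

set_option linter.all false
namespace VM

/-- ambient arithmetic data -/
structure Amb {R : Type} [CommRing R] (π : R) (p : ℕ) (ρ : ℕ → R → ℕ) (K : ℕ) : Prop where
  unit : ∀ x : R, ¬π ∣ x → IsUnit x
  nunit : ¬ IsUnit π
  ne : π ≠ 0
  ch : ∀ j : ℕ, 1 ≤ j → j ≤ K → IsUnit (j : R)
  rho : ∀ m x y, ρ m x = ρ m y ↔ π ^ m ∣ x - y
  lt : ∀ m x, ρ m x < p ^ m

section dec
variable {R : Type} [CommRing R] [IsDomain R] {Γ : Type} [AddCommGroup Γ] [Module R Γ]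
  {G : Type} [Fintype G]

/-- a family of functions adapted to a curve -/
structure Fam (π : R) (e : Γ → G → ℂ) (k N : ℕ) (D : ℕ → R → Γ) (d : ℕ) (W : Submodule R Γ)
    (w : G → ℝ) (S : Finset ℕ) (x : ℕ → R) (f : ℕ → G → ℂ) : Prop where
  sys : Sys π D d W k N
  wpos : ∀ g, 0 ≤ w g
  wsp : (fun g => (w g : ℂ)) ∈ Sp e 0 W
  sep : ∀ i ∈ S, ∀ j ∈ S, i ≠ j → ¬ π ^ N ∣ x i - x j
  fsp : ∀ i ∈ S, f i ∈ Sp e (D 0 (x i)) (Lw π D d W (x i) N)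

/-- decoupling at depth `N` with constant `C` -/
def Dec (π : R) (e : Γ → G → ℂ) (k N : ℕ) (C : ℝ) : Prop :=
  ∀ (D : ℕ → R → Γ) (d : ℕ) (W : Submodule R Γ) (w : G → ℝ) (S : Finset ℕ) (x : ℕ → R)
    (f : ℕ → G → ℂ), Fam π e k N D d W w S x f →
    nrm w (tri k) (fun g => ∑ i ∈ S, f i g) ≤ C * ∑ i ∈ S, nrm w (tri k) (f i)

/-- a ball -/
noncomputable def bal (π : R) (S : Finset ℕ) (x : ℕ → R) (m : ℕ) (c : R) : Finset ℕ :=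
  S.filter fun i => π ^ m ∣ x i - c

/-- bilinear decoupling -/
def BB (π : R) (e : Γ → G → ℂ) (k l a b n : ℕ) (C : ℝ) : Prop :=
  ∀ (D : ℕ → R → Γ) (d : ℕ) (W : Submodule R Γ) (w : G → ℝ) (S : Finset ℕ) (x : ℕ → R)
    (f : ℕ → G → ℂ), Fam π e k n D d W w S x f → ∀ x1 x2 : R, IsUnit (x1 - x2) →
    ∑ g, w g * ((‖∑ i ∈ bal π S x a x1, f i g‖ ^ 2) ^ (tri l) *
      (‖∑ i ∈ bal π S x b x2, f i g‖ ^ 2) ^ (tri k - tri l)) ≤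
    C * ((∑ i ∈ bal π S x a x1, nrm w (tri k) (f i)) ^ (tri l) *
      (∑ i ∈ bal π S x b x2, nrm w (tri k) (f i)) ^ (tri k - tri l))

variable {π : R} {e : Γ → G → ℂ} {p : ℕ} {ρ : ℕ → R → ℕ} {K : ℕ} {k n : ℕ}
  {D : ℕ → R → Γ} {d : ℕ} {W : Submodule R Γ} {w : G → ℝ} {S : Finset ℕ} {x : ℕ → R}
  {f : ℕ → G → ℂ}

lemma Fam.SI_nonneg (h : Fam π e k n D d W w S x f) (T : Finset ℕ) (s : ℕ) :
    0 ≤ ∑ i ∈ T, nrm w s (f i) := Finset.sum_nonneg fun i _ => nrm_nonneg h.wpos _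

lemma Dec.mono {C C' : ℝ} (h : Dec π e k n C) (hC : C ≤ C') : Dec π e k n C' := by
  intro D d W w S x f hF
  refine (h D d W w S x f hF).trans ?_
  gcongr
  exact hF.SI_nonneg S _

lemma BB.mono {l a b : ℕ} {C C' : ℝ} (h : BB π e k l a b n C) (hC : C ≤ C') :
    BB π e k l a b n C' := by
  intro D d W w S x f hF x1 x2 hx
  refine (h D d W w S x f hF x1 x2 hx).trans ?_
  have h1 := hF.SI_nonneg (bal π S x a x1) (tri k)
  have h2 := hF.SI_nonneg (bal π S x b x2) (tri k)
  gcongr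

lemma card_le (hA : Amb π p ρ K) {m : ℕ} (S : Finset ℕ)
    (hs : ∀ i ∈ S, ∀ j ∈ S, i ≠ j → ¬ π ^ m ∣ x i - x j) : S.card ≤ p ^ m := by
  have := Finset.card_le_card_of_injOn (s := S) (t := range (p ^ m)) (fun i => ρ m (x i))
    (fun i _ => by simpa using hA.lt m (x i)) (by
      intro i hi j hj hij
      by_contra hne
      exact hs i hi j hj hne ((hA.rho _ _ _).1 hij))
  simpa using this

lemma Dec_triv (hA : Amb π p ρ K) (hk : 1 ≤ k) : Dec π e k n ((p : ℝ) ^ n) := by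
  intro D d W w S x f h
  refine (nrm_sum S (tri_pos hk) h.wpos f).trans ?_
  gcongr
  · exact h.SI_nonneg S _
  · exact_mod_cast card_le hA S h.sep

lemma Dec_one (he : CharSys e) (hA : Amb π p ρ K) (N : ℕ) : Dec π e 1 N 1 := by
  intro D d W w S x f h
  have htri := tri_one
  rw [htri, one_mul]
  have hn : ∀ F : G → ℂ, nrm w 1 F = ∑ g, w g * ‖F g‖ ^ 2 := by
    intro F
    have := nrm_pow (s := 1) le_rfl h.wpos F
    simpa using this
  simp only [hn]
  have hsys := h.sys
  -- all derivatives are multiples of the first one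
  have hmul : ∀ x0 j, 1 ≤ j → j ≤ d → ∃ c : R, (1 < j → π ∣ c) ∧ (j = 1 → c = 1) ∧
      D j x0 - c • D 1 x0 ∈ W := by
    intro x0 j h1 h2
    by_cases hj : j = 1
    · subst hj; exact ⟨1, by simp, by simp, by simp⟩
    · obtain ⟨c, hc⟩ := hsys.high x0 j (by omega) h2
      exact ⟨π * c 1, by simp, by omega, by simpa using hc⟩
  have hspan : ∀ x0 y i, 1 ≤ i → ∃ c : R, D i (x0 + y) - c • D 1 x0 ∈ W := by
    intro x0 y i hi
    have : ∀ j, ∃ c : R, 1 ≤ j → j ≤ d → D j x0 - c • D 1 x0 ∈ W := by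
      intro j
      by_cases hj : 1 ≤ j ∧ j ≤ d
      · obtain ⟨c, _, _, hc⟩ := hmul x0 j hj.1 hj.2
        exact ⟨c, fun _ _ => hc⟩
      · exact ⟨0, fun a b => absurd ⟨a, b⟩ hj⟩
    choose c hc using this
    refine ⟨∑ j ∈ range (d + 1), (Nat.choose j i : R) * y ^ (j - i) * c j, ?_⟩
    rw [hsys.taylor, Finset.sum_smul, ← Finset.sum_sub_distrib]
    refine Submodule.sum_mem _ fun j hj => ?_
    by_cases hj0 : j = 0
    · subst hj0; rw [Nat.choose_eq_zero_of_lt (by omega)]; simp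
    · rw [mul_smul (_ * _) (c j), ← smul_sub]
      simp at hj
      exact W.smul_mem _ (hc j (by omega) (by omega))
  have horth : ∀ i ∈ S, ∀ j ∈ S, i ≠ j →
      ∑ g, (w g : ℂ) * (f i g * (starRingEnd ℂ) (f j g)) = 0 := by
    intro i hi j hj hij
    set L : Submodule R Γ := Submodule.span R {π ^ N • D 1 (x j)} ⊔ W with hL
    have hWL : W ≤ L := le_sup_right
    have hLw : ∀ x0, Lw π D d W x0 N ≤ L := by
      intro x0
      refine sup_le ?_ hWL
      rw [Submodule.span_le]
      rintro _ ⟨m, ⟨h1, h2⟩, rfl⟩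
      obtain ⟨c, hc⟩ := hspan (x j) (x0 - x j) m h1
      rw [add_sub_cancel] at hc
      have h3 : π ^ (N * m) • D m x0 = (π ^ (N * m)) • (D m x0 - c • D 1 (x j)) +
          (π ^ (N * (m - 1)) * c) • (π ^ N • D 1 (x j)) := by
        rw [smul_sub, smul_smul, smul_smul]
        have : π ^ (N * (m - 1)) * c * π ^ N = π ^ (N * m) * c := by
          obtain ⟨t, rfl⟩ := Nat.exists_eq_add_of_le h1
          rw [Nat.add_sub_cancel_left]; ring
        rw [this]; abel
      simp only [SetLike.mem_coe]
      rw [h3]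
      exact L.add_mem (hWL (W.smul_mem _ hc)) (Submodule.mem_sup_left
        (Submodule.smul_mem _ _ (Submodule.mem_span_singleton_self _)))
    have m1 : f i ∈ Sp e (D 0 (x i)) L := Sp_mono (hLw _) (by simp) (h.fsp i hi)
    have m2 : f j ∈ Sp e (D 0 (x j)) L := Sp_mono (hLw _) (by simp) (h.fsp j hj)
    have m3 : (fun g => (w g : ℂ)) ∈ Sp e 0 L := Sp_mono hWL (by simp) h.wsp
    have m4 := Sp_mul he m3 (Sp_mul he m1 (Sp_conj he m2))
    have m5 := Sp_orth he m4 ?_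
    · exact m5
    rw [zero_add, ← sub_eq_add_neg]
    intro hmem
    have : ∀ m, ∃ c : R, 1 ≤ m → m ≤ d → (1 < m → π ∣ c) ∧ (m = 1 → c = 1) ∧
        D m (x j) - c • D 1 (x j) ∈ W := by
      intro m
      by_cases hm : 1 ≤ m ∧ m ≤ d
      · obtain ⟨c, hc⟩ := hmul (x j) m hm.1 hm.2
        exact ⟨c, fun _ _ => hc⟩
      · exact ⟨0, fun a b => absurd ⟨a, b⟩ hm⟩
    choose c hc using this
    set y := x i - x j with hy
    have hxy : x i = x j + y := by rw [hy]; ring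
    rw [hxy, D0_sub hsys.taylor] at hmem
    obtain ⟨u, hu, v, hv, huv⟩ := Submodule.mem_sup.1 hmem
    obtain ⟨t, rfl⟩ := Submodule.mem_span_singleton.1 hu
    set q := ∑ m ∈ Icc 1 d, y ^ m * c m with hq
    have h5 : ∑ m ∈ Icc 1 d, y ^ m • D m (x j) - q • D 1 (x j) ∈ W := by
      rw [hq, Finset.sum_smul, ← Finset.sum_sub_distrib]
      refine Submodule.sum_mem _ fun m hm => ?_
      simp at hm
      rw [mul_smul, ← smul_sub]
      exact W.smul_mem _ (hc m hm.1 hm.2).2.2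
    have h6 : (q - t * π ^ N) • D 1 (x j) ∈ W := by
      have : (q - t * π ^ N) • D 1 (x j) =
          v - (∑ m ∈ Icc 1 d, y ^ m • D m (x j) - q • D 1 (x j)) := by
        rw [← huv, sub_smul, mul_smul]; abel
      rw [this]
      exact W.sub_mem hv h5
    have h7 := hsys.indep (x j) (fun _ => q - t * π ^ N) (by simpa using h6) 1 (by simp)
    rw [mul_one] at h7
    have h8 : π ^ N ∣ q := by
      have := dvd_add h7 (dvd_mul_left (π ^ N) t)
      simpa using this
    have hd : 1 ≤ d := hsys.kd
    obtain ⟨r, hr⟩ : ∃ r, q = y * (1 + π * r) := by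
      have : q = y + ∑ m ∈ Ioc 1 d, y ^ m * c m := by
        rw [hq, ← Finset.add_sum_Ioc_eq_sum_Icc hd, (hc 1 le_rfl hd).2.1 rfl]; simp
      have h9 : y * π ∣ ∑ m ∈ Ioc 1 d, y ^ m * c m := by
        refine Finset.dvd_sum fun m hm => ?_
        simp at hm
        exact mul_dvd_mul (dvd_pow_self _ (by omega)) ((hc m (by omega) hm.2).1 hm.1)
      obtain ⟨r, hr⟩ := h9
      exact ⟨r, by rw [this, hr]; ring⟩
    have hun : IsUnit (1 + π * r) := by
      apply hA.unit
      intro hdv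
      apply hA.nunit
      have := dvd_sub hdv (dvd_mul_right π r)
      rw [add_sub_cancel_right] at this
      exact isUnit_of_dvd_one this
    rw [hr, hun.dvd_mul_right] at h8
    exact h.sep i hi j hj hij h8
  apply le_of_eq
  have hC : ((∑ g, w g * ‖∑ i ∈ S, f i g‖ ^ 2 : ℝ) : ℂ) =
      ((∑ i ∈ S, ∑ g, w g * ‖f i g‖ ^ 2 : ℝ) : ℂ) := by
    push_cast
    have e1 : ∀ z : ℂ, ((‖z‖ : ℂ)) ^ 2 = z * (starRingEnd ℂ) z := by
      intro z; rw [Complex.mul_conj, Complex.normSq_eq_norm_sq]; push_cast; rfl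
    simp only [e1, map_sum, Finset.sum_mul_sum, Finset.mul_sum]
    rw [Finset.sum_comm]
    refine Finset.sum_congr rfl fun i hi => ?_
    simp only [Finset.sum_mul, Finset.mul_sum]
    rw [Finset.sum_comm, Finset.sum_eq_single i]
    · intro j hj hij
      exact horth j hj i hi hij
    · intro hi'; exact absurd hi hi'
  exact_mod_cast hC

end dec
end VM

open MeasureTheory Finset
open scoped Classical

set_option linter.all false
namespace VM
section dec
variable {R : Type} [CommRing R] [IsDomain R] {Γ : Type} [AddCommGroup Γ] [Module R Γ]
  {G : Type} [Fintype G]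
variable {π : R} {e : Γ → G → ℂ} {p : ℕ} {ρ : ℕ → R → ℕ} {K : ℕ} {k n : ℕ}
  {D : ℕ → R → Γ} {d : ℕ} {W : Submodule R Γ} {w : G → ℝ} {S : Finset ℕ} {x : ℕ → R}
  {f : ℕ → G → ℂ}

lemma Fam.ball (hA : Amb π p ρ K) (h : Fam π e k n D d W w S x f) {m : ℕ} (hm : m ≤ n) {C : ℝ}
    (hD : Dec π e k (n - m) C) (x0 : R) :
    nrm w (tri k) (fun g => ∑ i ∈ bal π S x m x0, f i g) ≤
      C * ∑ i ∈ bal π S x m x0, nrm w (tri k) (f i) := by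
  have : ∀ i, ∃ y, i ∈ bal π S x m x0 → x i = x0 + π ^ m * y := by
    intro i
    by_cases hi : i ∈ bal π S x m x0
    · obtain ⟨y, hy⟩ := (Finset.mem_filter.1 hi).2
      exact ⟨y, fun _ => by rw [← hy]; ring⟩
    · exact ⟨0, fun h => absurd h hi⟩
  choose y hy using this
  apply hD (VM.rst π D m x0) d W w (bal π S x m x0) y f
  refine ⟨h.sys.rst hA.ne hm x0, h.wpos, h.wsp, ?_, ?_⟩
  · intro i hi j hj hij hd
    apply h.sep i (Finset.mem_filter.1 hi).1 j (Finset.mem_filter.1 hj).1 hij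
    rw [hy i hi, hy j hj]
    have : x0 + π ^ m * y i - (x0 + π ^ m * y j) = π ^ m * (y i - y j) := by ring
    rw [this, ← Nat.add_sub_cancel' hm, pow_add]
    exact mul_dvd_mul_left _ hd
  · intro i hi
    rw [rst_Lw, Nat.add_sub_cancel' hm, ← hy i hi]
    have : VM.rst π D m x0 0 (y i) = D 0 (x i) := by
      unfold VM.rst; rw [← hy i hi]; simp
    rw [this]
    exact h.fsp i (Finset.mem_filter.1 hi).1

lemma BB_triv (hA : Amb π p ρ K) (hk : 1 ≤ k) {l a b : ℕ} (hl : l ≤ k) (ha : a ≤ n) (hb : b ≤ n)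
    {Ca Cb : ℝ} (hCa : 0 ≤ Ca) (hCb : 0 ≤ Cb) (h1 : Dec π e k (n - a) Ca)
    (h2 : Dec π e k (n - b) Cb) : BB π e k l a b n (Ca ^ tri l * Cb ^ (tri k - tri l)) := by
  intro D d W w S x f h x1 x2 hx
  have b1 := h.ball hA ha h1 x1
  have b2 := h.ball hA hb h2 x2
  have n1 := nrm_nonneg (s := tri k) h.wpos (fun g => ∑ i ∈ bal π S x a x1, f i g)
  have n2 := nrm_nonneg (s := tri k) h.wpos (fun g => ∑ i ∈ bal π S x b x2, f i g)
  have tl := tri_mono hl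
  have tk := tri_pos hk
  have s1 := h.SI_nonneg (bal π S x a x1) (tri k)
  have s2 := h.SI_nonneg (bal π S x b x2) (tri k)
  have hH := holder_int (a := tri l) (b := tri k - tri l) (Finset.univ : Finset G) (by omega)
    (u := fun g => w g * ((‖∑ i ∈ bal π S x a x1, f i g‖ ^ 2) ^ (tri l) *
      (‖∑ i ∈ bal π S x b x2, f i g‖ ^ 2) ^ (tri k - tri l)))
    (A := fun g => w g * (‖∑ i ∈ bal π S x a x1, f i g‖ ^ 2) ^ (tri k))
    (B := fun g => w g * (‖∑ i ∈ bal π S x b x2, f i g‖ ^ 2) ^ (tri k))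
    (fun g => by have := h.wpos g; positivity) (fun g => by have := h.wpos g; positivity)
    (fun g => by have := h.wpos g; positivity) (fun g => by
      apply le_of_eq
      rw [Nat.add_sub_cancel' tl]
      simp only [mul_pow, ← pow_mul]
      rw [show w g ^ tri k = w g ^ tri l * w g ^ (tri k - tri l) by
        rw [← pow_add, Nat.add_sub_cancel' tl]]
      ring_nf)
  rw [Nat.add_sub_cancel' tl, ← nrm_pow tk h.wpos, ← nrm_pow tk h.wpos, pow_right_comm,
    pow_right_comm _ (tri k) (tri k - tri l), ← mul_pow] at hH
  refine (le_of_pow_le_pow_left₀ (Nat.one_le_iff_ne_zero.1 tk)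
    (mul_nonneg (pow_nonneg n1 _) (pow_nonneg n2 _)) hH).trans ?_
  have e1 := pow_le_pow_left₀ n1 b1 (tri l)
  have e2 := pow_le_pow_left₀ n2 b2 (tri k - tri l)
  refine (mul_le_mul e1 e2 (pow_nonneg n2 _) (pow_nonneg (mul_nonneg hCa s1) _)).trans (le_of_eq ?_)
  rw [mul_pow, mul_pow]; ring

lemma BB_zero (hA : Amb π p ρ K) (hk : 1 ≤ k) {a b : ℕ} (hb : b ≤ n)
    {Cb : ℝ} (h2 : Dec π e k (n - b) Cb) : BB π e k 0 a b n (Cb ^ tri k) := by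
  intro D d W w S x f h x1 x2 hx
  have b2 := h.ball hA hb h2 x2
  have n2 := nrm_nonneg (s := tri k) h.wpos (fun g => ∑ i ∈ bal π S x b x2, f i g)
  have t0 : tri 0 = 0 := tri_zero
  simp only [t0, pow_zero, one_mul, Nat.sub_zero]
  rw [← nrm_pow (tri_pos hk) h.wpos, ← mul_pow]
  exact pow_le_pow_left₀ n2 b2 _

lemma fibre (hA : Amb π p ρ K) {a a' : ℕ} (haa : a ≤ a') {c : R} {i0 : ℕ}
    (hi : i0 ∈ bal π S x a c) :
    (bal π S x a c).filter (fun i => ρ a' (x i) = ρ a' (x i0)) = bal π S x a' (x i0) := by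
  ext i
  simp only [bal, Finset.mem_filter, hA.rho]
  constructor
  · rintro ⟨⟨h1, _⟩, h3⟩; exact ⟨h1, h3⟩
  · rintro ⟨h1, h3⟩
    refine ⟨⟨h1, ?_⟩, h3⟩
    have h4 := (Finset.mem_filter.1 hi).2
    have h5 := dvd_add ((pow_dvd_pow π haa).trans h3) h4
    simpa using h5

lemma fibres (hA : Amb π p ρ K) {a a' : ℕ} (haa : a ≤ a') (c : R) :
    ∃ (T : Finset ℕ) (j : ℕ → ℕ), (∀ r ∈ T, j r ∈ bal π S x a c ∧ ρ a' (x (j r)) = r) ∧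
      T.card ≤ p ^ a' ∧
      (∀ {M : Type} [AddCommMonoid M] (φ : ℕ → M), ∑ i ∈ bal π S x a c, φ i =
        ∑ r ∈ T, ∑ i ∈ bal π S x a' (x (j r)), φ i) := by
  let T := (bal π S x a c).image (fun i => ρ a' (x i))
  have : ∀ r, ∃ j, r ∈ T → j ∈ bal π S x a c ∧ ρ a' (x j) = r := by
    intro r
    by_cases hr : r ∈ T
    · obtain ⟨j, h1, h2⟩ := Finset.mem_image.1 hr
      exact ⟨j, fun _ => ⟨h1, h2⟩⟩
    · exact ⟨0, fun h => absurd h hr⟩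
  choose j hj using this
  refine ⟨T, j, hj, ?_, ?_⟩
  · have : T ⊆ range (p ^ a') := by
      intro r hr
      obtain ⟨i, h1, h2⟩ := Finset.mem_image.1 hr
      rw [Finset.mem_range, ← h2]
      exact hA.lt _ _
    simpa using Finset.card_le_card this
  · intro M _ φ
    rw [← Finset.sum_fiberwise_of_maps_to (t := T) (g := fun i => ρ a' (x i))
      (fun i hi => Finset.mem_image_of_mem _ hi)]
    refine Finset.sum_congr rfl fun r hr => ?_
    obtain ⟨h1, h2⟩ := hj r hr
    rw [← fibre hA haa h1, h2]

lemma unit_shift (hA : Amb π p ρ K) {x1 x2 y : R} {a : ℕ} (ha : 1 ≤ a) (h : IsUnit (x1 - x2))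
    (hy : π ^ a ∣ y - x1) : IsUnit (y - x2) := by
  apply hA.unit
  intro hd
  have h1 := dvd_sub hd ((dvd_pow_self π (by omega : a ≠ 0)).trans hy)
  rw [sub_sub_sub_cancel_left] at h1
  exact hA.nunit (isUnit_of_dvd_unit h1 h)

lemma BB_lower (he : CharSys e) (hA : Amb π p ρ K) (hkK : k ≤ K) {l a a' b : ℕ} (hl1 : 1 ≤ l)
    (hl : l ≤ k) (ha : 1 ≤ a) (haa : a ≤ a') (han : a' ≤ n) (hb : b ≤ n)
    (hab : a' * l ≤ b * (k - l + 1)) {C Dl : ℝ} (hC : 0 ≤ C) (hDl : 0 ≤ Dl)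
    (hD : Dec π e l (a' - a) Dl) (hB : BB π e k l a' b n C) :
    BB π e k l a b n (Dl ^ tri l * C) := by
  intro D d W w S x f h x1 x2 hx
  obtain ⟨T, j, hj, -, hsum⟩ := fibres (S := S) (x := x) hA haa x1
  set H : G → ℂ := fun g => ∑ i ∈ bal π S x b x2, f i g with hH
  set W' := Wt π D d W x2 (k - l) b with hW'
  have hWW : W ≤ W' := (W_le_Lw x2 b).trans (Lw_le_Wt x2 _ b)
  set w' : G → ℝ := fun g => w g * (‖H g‖ ^ 2) ^ (tri k - tri l) with hw'
  have hsys := h.sys.transv hA.unit hA.nunit hA.ne (fun j h1 h2 => hA.ch j h1 (h2.trans hkK))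
    x1 x2 hx hl hb ha haa hab
  have hHsp : H ∈ Sp e (D 0 x2) W' := by
    have : H = ∑ i ∈ bal π S x b x2, f i := by funext g; simp [hH]
    rw [this]
    refine Submodule.sum_mem _ fun i hi => ?_
    have h2 := Finset.mem_filter.1 hi
    have h3 : Lw π D d W (x i) n ≤ Lw π D d W x2 b := Lw_le h.sys.taylor h2.2 hb
    exact Sp_mono (h3.trans (Lw_le_Wt x2 _ b))
      (Lw_le_Wt x2 _ b (D0_sub_mem h.sys.taylor h2.2)) (h.fsp i h2.1)
  have hwpos : ∀ g, 0 ≤ w' g := fun g => mul_nonneg (h.wpos g) (by positivity)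
  have : ∀ r, ∃ y, r ∈ T → x (j r) = x1 + π ^ a * y := by
    intro r
    by_cases hr : r ∈ T
    · obtain ⟨y, hy⟩ := (Finset.mem_filter.1 (hj r hr).1).2
      exact ⟨y, fun _ => by rw [← hy]; ring⟩
    · exact ⟨0, fun h => absurd h hr⟩
  choose y hy using this
  let F : ℕ → G → ℂ := fun r g => ∑ i ∈ bal π S x a' (x (j r)), f i g
  have hfam : Fam π e l (a' - a) (VM.rst π D a x1) d W' w' T y F := by
    refine ⟨hsys, hwpos, ?_, ?_, ?_⟩
    · exact Sp_weight he hHsp h.wsp hWW _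
    · intro r hr r' hr' hne hd
      apply hne
      rw [← (hj r hr).2, ← (hj r' hr').2, hA.rho, hy r hr, hy r' hr']
      have : x1 + π ^ a * y r - (x1 + π ^ a * y r') = π ^ a * (y r - y r') := by ring
      rw [this, ← Nat.add_sub_cancel' haa, pow_add]
      exact mul_dvd_mul_left _ hd
    · intro r hr
      rw [rst_Lw, Nat.add_sub_cancel' haa, ← hy r hr]
      have : VM.rst π D a x1 0 (y r) = D 0 (x (j r)) := by
        unfold VM.rst; rw [← hy r hr]; simp
      rw [this]
      have : F r = ∑ i ∈ bal π S x a' (x (j r)), f i := by funext g; simp [F]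
      rw [this]
      refine Submodule.sum_mem _ fun i hi => ?_
      have h2 := Finset.mem_filter.1 hi
      refine Sp_mono ?_ ?_ (h.fsp i h2.1)
      · exact (Lw_le h.sys.taylor h2.2 han).trans (Lw_mono_W hWW _ _)
      · exact D0_sub_mem h.sys.taylor h2.2
  have hdec := hD _ _ _ _ _ _ _ hfam
  have tl := tri_pos hl1
  have hdec2 := pow_le_pow_left₀ (nrm_nonneg hwpos _) hdec (tri l)
  rw [nrm_pow tl hwpos, mul_pow] at hdec2
  have eq1 : ∀ g, ∑ r ∈ T, F r g = ∑ i ∈ bal π S x a x1, f i g := fun g =>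
    (hsum (fun i => f i g)).symm
  simp only [eq1] at hdec2
  have s2 := h.SI_nonneg (bal π S x b x2) (tri k)
  have hsp := sum_pow_le T (t := tri l) tl (u := fun r => nrm w' (tri l) (F r))
    (S := fun r => ∑ i ∈ bal π S x a' (x (j r)), nrm w (tri k) (f i))
    (M := C * (∑ i ∈ bal π S x b x2, nrm w (tri k) (f i)) ^ (tri k - tri l)) (by positivity)
    (fun r _ => nrm_nonneg hwpos _) (fun r _ => h.SI_nonneg _ _) (by
      intro r hr
      have hu : IsUnit (x (j r) - x2) := unit_shift hA ha hx (Finset.mem_filter.1 (hj r hr).1).2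
      have := hB D d W w S x f h (x (j r)) x2 hu
      rw [nrm_pow tl hwpos]
      refine (le_of_eq ?_).trans (this.trans (le_of_eq ?_))
      · refine Finset.sum_congr rfl fun g _ => ?_
        simp only [hw', hH, F]; ring
      · ring)
  rw [← hsum (fun i => nrm w (tri k) (f i))] at hsp
  refine (le_of_eq ?_).trans ((hdec2.trans (mul_le_mul_of_nonneg_left hsp
    (pow_nonneg hDl _))).trans (le_of_eq ?_))
  · refine Finset.sum_congr rfl fun g _ => ?_
    simp only [hw', hH]; ring
  · ring

lemma tri_id {k l : ℕ} (h1 : 1 ≤ l) (hl : l ≤ k) :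
    (k - l + 1) * tri l = (k - l) * tri (l - 1) + (tri k - tri (k - l)) := by
  obtain ⟨m, rfl⟩ := Nat.exists_eq_add_of_le hl
  obtain ⟨q, rfl⟩ := Nat.exists_eq_add_of_le h1
  simp only [Nat.add_sub_cancel_left]
  have a1 := two_tri (1 + q)
  have a2 := two_tri q
  have a3 := two_tri (1 + q + m)
  have a4 := two_tri m
  have a5 : tri m ≤ tri (1 + q + m) := tri_mono (by omega)
  zify [a5]
  zify at a1 a2 a3 a4
  refine mul_left_cancel₀ (two_ne_zero (α := ℤ)) ?_
  linear_combination ((m : ℤ) + 1) * a1 - (m : ℤ) * a2 - a3 + a4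

end dec
end VM

open MeasureTheory Finset
open scoped Classical

set_option linter.all false
namespace VM
section dec
variable {R : Type} [CommRing R] [IsDomain R] {Γ : Type} [AddCommGroup Γ] [Module R Γ]
  {G : Type} [Fintype G]
variable {π : R} {e : Γ → G → ℂ} {p : ℕ} {ρ : ℕ → R → ℕ} {K : ℕ} {k n : ℕ}
  {D : ℕ → R → Γ} {d : ℕ} {W : Submodule R Γ} {w : G → ℝ} {S : Finset ℕ} {x : ℕ → R}
  {f : ℕ → G → ℂ}

lemma BB_holder {l a b : ℕ} (h1 : 1 ≤ l) (hl : l ≤ k) {C1 C2 C : ℝ}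
    (hC1 : 0 ≤ C1) (hC : 0 ≤ C) (hCC : C1 ^ (k - l) * C2 ≤ C ^ (k - l + 1))
    (hB1 : BB π e k (l - 1) a b n C1) (hB2 : BB π e k (k - l) b a n C2) :
    BB π e k l a b n C := by
  intro D d W w S x f h x1 x2 hx
  have hx' : IsUnit (x2 - x1) := by rw [← neg_sub]; exact hx.neg
  have b1 := hB1 D d W w S x f h x1 x2 hx
  have b2 := hB2 D d W w S x f h x2 x1 hx'
  have s1 := h.SI_nonneg (bal π S x a x1) (tri k)
  have s2 := h.SI_nonneg (bal π S x b x2) (tri k)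
  set SA := ∑ i ∈ bal π S x a x1, nrm w (tri k) (f i)
  set SB := ∑ i ∈ bal π S x b x2, nrm w (tri k) (f i)
  have i1 := tri_id h1 hl
  have t1 : tri (k - l) ≤ tri k := tri_mono (by omega)
  have t2 : tri (l - 1) ≤ tri k := tri_mono (by omega)
  have t3 : tri l ≤ tri k := tri_mono (by omega)
  have i2 : (tri k - tri l) * (k - l + 1) = (tri k - tri (l - 1)) * (k - l) + tri (k - l) := by
    zify [t1, t2, t3, hl] at i1 ⊢
    linear_combination -i1
  have i1' : tri l * (k - l + 1) = tri (l - 1) * (k - l) + (tri k - tri (k - l)) := by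
    rw [mul_comm, i1, mul_comm (k - l)]
  have key : ∀ u v : ℝ, (u ^ tri l * v ^ (tri k - tri l)) ^ (k - l + 1) =
      (u ^ tri (l - 1) * v ^ (tri k - tri (l - 1))) ^ (k - l) *
      (v ^ tri (k - l) * u ^ (tri k - tri (k - l))) := by
    intro u v
    rw [mul_pow, mul_pow, ← pow_mul, ← pow_mul, ← pow_mul, ← pow_mul, i1', i2, pow_add, pow_add]
    ring
  have hH := holder_int (a := k - l) (b := 1) (Finset.univ : Finset G) (by omega)
    (u := fun g => w g * ((‖∑ i ∈ bal π S x a x1, f i g‖ ^ 2) ^ (tri l) *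
      (‖∑ i ∈ bal π S x b x2, f i g‖ ^ 2) ^ (tri k - tri l)))
    (A := fun g => w g * ((‖∑ i ∈ bal π S x a x1, f i g‖ ^ 2) ^ (tri (l - 1)) *
      (‖∑ i ∈ bal π S x b x2, f i g‖ ^ 2) ^ (tri k - tri (l - 1))))
    (B := fun g => w g * ((‖∑ i ∈ bal π S x b x2, f i g‖ ^ 2) ^ (tri (k - l)) *
      (‖∑ i ∈ bal π S x a x1, f i g‖ ^ 2) ^ (tri k - tri (k - l))))
    (fun g => mul_nonneg (h.wpos g) (by positivity))
    (fun g => mul_nonneg (h.wpos g) (by positivity))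
    (fun g => mul_nonneg (h.wpos g) (by positivity)) (fun g => by
      apply le_of_eq
      rw [mul_pow, key, mul_pow (w g), pow_succ, pow_one]
      ring)
  have p1 : 0 ≤ SA ^ tri l * SB ^ (tri k - tri l) := mul_nonneg (pow_nonneg s1 _) (pow_nonneg s2 _)
  have p2 : 0 ≤ SA ^ tri (l - 1) * SB ^ (tri k - tri (l - 1)) :=
    mul_nonneg (pow_nonneg s1 _) (pow_nonneg s2 _)
  have p3 : 0 ≤ SB ^ tri (k - l) * SA ^ (tri k - tri (k - l)) :=
    mul_nonneg (pow_nonneg s2 _) (pow_nonneg s1 _)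
  apply le_of_pow_le_pow_left₀ (n := k - l + 1) (by omega) (mul_nonneg hC p1)
  refine hH.trans ?_
  rw [pow_one, mul_pow, key]
  have n1 : 0 ≤ ∑ g, w g * ((‖∑ i ∈ bal π S x a x1, f i g‖ ^ 2) ^ (tri (l - 1)) *
      (‖∑ i ∈ bal π S x b x2, f i g‖ ^ 2) ^ (tri k - tri (l - 1))) :=
    Finset.sum_nonneg fun g _ => mul_nonneg (h.wpos g) (by positivity)
  have n2 : 0 ≤ ∑ g, w g * ((‖∑ i ∈ bal π S x b x2, f i g‖ ^ 2) ^ (tri (k - l)) *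
      (‖∑ i ∈ bal π S x a x1, f i g‖ ^ 2) ^ (tri k - tri (k - l))) :=
    Finset.sum_nonneg fun g _ => mul_nonneg (h.wpos g) (by positivity)
  have q1 := pow_le_pow_left₀ n1 b1 (k - l)
  refine (mul_le_mul q1 b2 n2 (pow_nonneg (mul_nonneg hC1 p2) _)).trans ?_
  rw [mul_pow]
  calc _ = (C1 ^ (k - l) * C2) * ((SA ^ tri (l - 1) * SB ^ (tri k - tri (l - 1))) ^ (k - l) *
        (SB ^ tri (k - l) * SA ^ (tri k - tri (k - l)))) := by ring
    _ ≤ _ := mul_le_mul_of_nonneg_right hCC (mul_nonneg (pow_nonneg p2 _) p3)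

lemma norm_sum_pow {ι : Type} (T : Finset ι) (f : ι → ℂ) {s : ℕ} (hs : 1 ≤ s) :
    (‖∑ i ∈ T, f i‖ ^ 2) ^ s ≤ (T.card : ℝ) ^ (2 * s) * ∑ i ∈ T, (‖f i‖ ^ 2) ^ s := by
  rcases T.eq_empty_or_nonempty with rfl | hT
  · simp [show s ≠ 0 by omega]
  have hc : (1 : ℝ) ≤ T.card := by exact_mod_cast hT.card_pos
  have h1 := pow_le_pow_left₀ (sq_nonneg _) (norm_sum_sq T f) s
  refine h1.trans ?_
  rw [mul_pow]
  obtain ⟨s, rfl⟩ := Nat.exists_eq_add_of_le' hs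
  have h3 : (∑ i ∈ T, ‖f i‖ ^ 2) ^ (s + 1) ≤ (T.card : ℝ) ^ s * ∑ i ∈ T, (‖f i‖ ^ 2) ^ (s + 1) :=
    pow_sum_le_card_mul_sum_pow (fun i _ => sq_nonneg _) s
  calc _ ≤ (T.card : ℝ) ^ (s + 1) * ((T.card : ℝ) ^ s * ∑ i ∈ T, (‖f i‖ ^ 2) ^ (s + 1)) := by gcongr
    _ = (T.card : ℝ) ^ (2 * s + 1) * ∑ i ∈ T, (‖f i‖ ^ 2) ^ (s + 1) := by ring
    _ ≤ _ := by
      refine mul_le_mul_of_nonneg_right (pow_le_pow_right₀ hc (by omega))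
        (Finset.sum_nonneg fun i _ => by positivity)

lemma BB_small (hA : Amb π p ρ K) {l a b : ℕ} (hl : tri l < tri k) (hb : 1 ≤ b) {C : ℝ}
    (hC : 0 ≤ C) (hB : BB π e k l a b n C) :
    BB π e k l a 1 n ((p : ℝ) ^ (2 * b * tri k) * C) := by
  intro D d W w S x f h x1 x2 hx
  obtain ⟨T, j, hj, hcard, hsum⟩ := fibres (S := S) (x := x) hA hb x2
  have s1 := h.SI_nonneg (bal π S x a x1) (tri k)
  have s2 := h.SI_nonneg (bal π S x 1 x2) (tri k)
  set SA := ∑ i ∈ bal π S x a x1, nrm w (tri k) (f i)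
  set s := tri k - tri l with hs
  have hs1 : 1 ≤ s := by omega
  have hp : 1 ≤ p := by
    have := hA.lt 1 0
    by_contra hcon
    simp only [not_le, Nat.lt_one_iff] at hcon
    rw [hcon] at this; simp at this
  have hp' : (1 : ℝ) ≤ p := by exact_mod_cast hp
  have e1 : ∀ g, (‖∑ i ∈ bal π S x 1 x2, f i g‖ ^ 2) ^ s ≤ (p : ℝ) ^ (2 * b * tri k) *
      ∑ r ∈ T, (‖∑ i ∈ bal π S x b (x (j r)), f i g‖ ^ 2) ^ s := by
    intro g
    rw [hsum (fun i => f i g)]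
    refine (norm_sum_pow T _ hs1).trans ?_
    refine mul_le_mul_of_nonneg_right ?_ (Finset.sum_nonneg fun i _ => by positivity)
    calc (T.card : ℝ) ^ (2 * s) ≤ ((p : ℝ) ^ b) ^ (2 * s) := by
          gcongr; exact_mod_cast hcard
      _ = (p : ℝ) ^ (2 * b * s) := by rw [← pow_mul]; congr 1; ring
      _ ≤ _ := pow_le_pow_right₀ hp' (Nat.mul_le_mul_left _ (by omega))
  have e2 : ∀ r ∈ T, ∑ g, w g * ((‖∑ i ∈ bal π S x a x1, f i g‖ ^ 2) ^ (tri l) *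
      (‖∑ i ∈ bal π S x b (x (j r)), f i g‖ ^ 2) ^ s) ≤
      C * (SA ^ (tri l) * (∑ i ∈ bal π S x b (x (j r)), nrm w (tri k) (f i)) ^ s) := by
    intro r hr
    apply hB D d W w S x f h x1 (x (j r))
    rw [← neg_sub]
    refine (unit_shift hA (le_refl 1) (x1 := x2) ?_ (Finset.mem_filter.1 (hj r hr).1).2).neg
    rw [← neg_sub]; exact hx.neg
  calc _ ≤ ∑ g, (p : ℝ) ^ (2 * b * tri k) * ∑ r ∈ T, w g *
        ((‖∑ i ∈ bal π S x a x1, f i g‖ ^ 2) ^ (tri l) *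
        (‖∑ i ∈ bal π S x b (x (j r)), f i g‖ ^ 2) ^ s) := by
        refine Finset.sum_le_sum fun g _ => ?_
        rw [← Finset.mul_sum, ← Finset.mul_sum]
        have h1 := mul_le_mul_of_nonneg_left (e1 g) (mul_nonneg (h.wpos g)
          (by positivity : 0 ≤ (‖∑ i ∈ bal π S x a x1, f i g‖ ^ 2) ^ (tri l)))
        refine (le_of_eq ?_).trans (h1.trans (le_of_eq ?_)) <;> ring
    _ = (p : ℝ) ^ (2 * b * tri k) * ∑ r ∈ T, ∑ g, w g *
        ((‖∑ i ∈ bal π S x a x1, f i g‖ ^ 2) ^ (tri l) *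
        (‖∑ i ∈ bal π S x b (x (j r)), f i g‖ ^ 2) ^ s) := by
        rw [← Finset.mul_sum, Finset.sum_comm]
    _ ≤ (p : ℝ) ^ (2 * b * tri k) * ∑ r ∈ T, C * (SA ^ (tri l) *
        (∑ i ∈ bal π S x b (x (j r)), nrm w (tri k) (f i)) ^ s) := by
        refine mul_le_mul_of_nonneg_left (Finset.sum_le_sum e2) (by positivity)
    _ = (p : ℝ) ^ (2 * b * tri k) * C * (SA ^ (tri l) * ∑ r ∈ T,
        (∑ i ∈ bal π S x b (x (j r)), nrm w (tri k) (f i)) ^ s) := by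
        rw [← Finset.mul_sum, ← Finset.mul_sum]; ring
    _ ≤ _ := by
        refine mul_le_mul_of_nonneg_left (mul_le_mul_of_nonneg_left ?_ (pow_nonneg s1 _))
          (by positivity)
        rw [hsum (fun i => nrm w (tri k) (f i))]
        have : ∀ (T : Finset ℕ) (u : ℕ → ℝ), (∀ r, 0 ≤ u r) → ∑ r ∈ T, u r ^ s ≤
            (∑ r ∈ T, u r) ^ s := by
          intro T u hu
          have h1 : ∀ r ∈ T, u r ^ s ≤ u r * (∑ r ∈ T, u r) ^ (s - 1) := by
            intro r hr
            rw [← Nat.sub_add_cancel hs1, pow_succ', Nat.sub_add_cancel hs1]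
            refine mul_le_mul_of_nonneg_left (pow_le_pow_left₀ (hu r) ?_ _) (hu r)
            exact Finset.single_le_sum (fun i _ => hu i) hr
          refine (Finset.sum_le_sum h1).trans (le_of_eq ?_)
          rw [← Finset.sum_mul, ← pow_succ', Nat.sub_add_cancel hs1]
        exact this T _ fun r => h.SI_nonneg _ _

lemma Dec_step (hA : Amb π p ρ K) (hk : 1 ≤ k) (hn : 1 ≤ n) {l : ℕ} (hl : l ≤ k) {C c Cd : ℝ}
    (hC : 0 ≤ C) (hc : 0 ≤ c) (hCc : C ≤ c ^ tri k) (hB : BB π e k l 1 1 n C)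
    (hD : Dec π e k (n - 1) Cd) : Dec π e k n (Cd + (p : ℝ) ^ 2 * c) := by
  intro D d W w S x f h
  have hS : S = bal π S x 0 0 := by simp [bal]
  obtain ⟨T, j, hj, hcard, hsum⟩ := fibres (S := S) (x := x) hA (Nat.zero_le 1) 0
  rw [← hS] at hj
  simp only [← hS] at hsum
  have tk := tri_pos hk
  have s0 := h.SI_nonneg S (tri k)
  have hle : ∀ T' ⊆ S, ∑ i ∈ T', nrm w (tri k) (f i) ≤ ∑ i ∈ S, nrm w (tri k) (f i) :=
    fun T' hT => Finset.sum_le_sum_of_subset_of_nonneg hT fun i _ _ => nrm_nonneg h.wpos _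
  set St := ∑ i ∈ S, nrm w (tri k) (f i) with hSt
  let F : ℕ → G → ℂ := fun r g => ∑ i ∈ bal π S x 1 (x (j r)), f i g
  let SR : ℕ → ℝ := fun r => ∑ i ∈ bal π S x 1 (x (j r)), nrm w (tri k) (f i)
  have hSR0 : ∀ r, 0 ≤ SR r := fun r => h.SI_nonneg _ _
  have hSRle : ∀ r, SR r ≤ St := fun r => hle _ (Finset.filter_subset _ _)
  have hpt : ∀ g, ‖∑ i ∈ S, f i g‖ ^ 2 ≤ ∑ q ∈ T ×ˢ T, ‖F q.1 g‖ * ‖F q.2 g‖ := by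
    intro g
    rw [hsum (fun i => f i g), Finset.sum_product]
    simp only
    rw [← Finset.sum_mul_sum, ← sq]
    exact pow_le_pow_left₀ (norm_nonneg _) (norm_sum_le _ _) 2
  have hdiag : ∀ r, Ls w (tri k) (fun g => ‖F r g‖ * ‖F r g‖) ≤ Cd * SR r := by
    intro r
    have := h.ball hA hn hD (x (j r))
    have e : (fun g => ‖F r g‖ * ‖F r g‖) = fun g => ‖F r g‖ ^ 2 := by funext g; rw [sq]
    rw [e]; exact this
  have hoff : ∀ r ∈ T, ∀ r' ∈ T, r ≠ r' → Ls w (tri k) (fun g => ‖F r g‖ * ‖F r' g‖) ≤ c * St := by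
    intro r hr r' hr' hne
    have hu : IsUnit (x (j r) - x (j r')) := by
      apply hA.unit
      intro hd
      rw [← pow_one π, ← hA.rho, (hj r hr).2, (hj r' hr').2] at hd
      exact hne hd
    have hu' : IsUnit (x (j r') - x (j r)) := by rw [← neg_sub]; exact hu.neg
    have b1 := hB D d W w S x f h _ _ hu
    have b2 := hB D d W w S x f h _ _ hu'
    have tl := tri_mono hl
    have hbd : ∀ r r', SR r ^ tri l * SR r' ^ (tri k - tri l) ≤ St ^ tri k := by
      intro r r'
      calc _ ≤ St ^ tri l * St ^ (tri k - tri l) :=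
            mul_le_mul (pow_le_pow_left₀ (hSR0 _) (hSRle _) _)
              (pow_le_pow_left₀ (hSR0 _) (hSRle _) _) (pow_nonneg (hSR0 _) _) (pow_nonneg s0 _)
        _ = _ := by rw [← pow_add, Nat.add_sub_cancel' tl]
    have b1' := b1.trans (mul_le_mul_of_nonneg_left (hbd r r') hC)
    have b2' := b2.trans (mul_le_mul_of_nonneg_left (hbd r' r) hC)
    apply Ls_le tk h.wpos (fun g => by positivity) (mul_nonneg hc s0)
    have hH := holder_int (a := 1) (b := 1) (Finset.univ : Finset G) (by omega)
      (u := fun g => w g * (‖F r g‖ * ‖F r' g‖) ^ tri k)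
      (A := fun g => w g * ((‖F r g‖ ^ 2) ^ (tri l) * (‖F r' g‖ ^ 2) ^ (tri k - tri l)))
      (B := fun g => w g * ((‖F r' g‖ ^ 2) ^ (tri l) * (‖F r g‖ ^ 2) ^ (tri k - tri l)))
      (fun g => mul_nonneg (h.wpos g) (by positivity))
      (fun g => mul_nonneg (h.wpos g) (by positivity))
      (fun g => mul_nonneg (h.wpos g) (by positivity)) (fun g => by
        apply le_of_eq
        have : ∀ u v : ℝ, (u * v) ^ tri k = u ^ tri l * u ^ (tri k - tri l) *
            (v ^ tri l * v ^ (tri k - tri l)) := by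
          intro u v
          rw [← pow_add, ← pow_add, Nat.add_sub_cancel' tl, mul_pow]
        rw [this]; ring)
    have hM : 0 ≤ C * St ^ tri k := mul_nonneg hC (pow_nonneg s0 _)
    have h3 : ∑ g, w g * (‖F r g‖ * ‖F r' g‖) ^ tri k ≤ C * St ^ tri k := by
      apply le_of_pow_le_pow_left₀ (n := 2) (by omega) hM
      refine hH.trans ?_
      rw [pow_one, pow_one, sq]
      exact mul_le_mul b1' b2' (Finset.sum_nonneg fun g _ => mul_nonneg (h.wpos g) (by positivity)) hM
    rw [mul_pow]
    exact h3.trans (mul_le_mul_of_nonneg_right hCc (pow_nonneg s0 _))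
  have h1 := Ls_mono tk h.wpos (fun g => sq_nonneg _) hpt
  have h2 := Ls_sum (T ×ˢ T) tk h.wpos (u := fun q g => ‖F q.1 g‖ * ‖F q.2 g‖)
    (fun q g => by positivity)
  refine (h1.trans h2).trans ?_
  calc _ ≤ ∑ q ∈ T ×ˢ T, ((if q.1 = q.2 then Cd * SR q.1 else 0) + c * St) := by
        refine Finset.sum_le_sum fun q hq => ?_
        obtain ⟨h3, h4⟩ := Finset.mem_product.1 hq
        by_cases hqq : q.1 = q.2
        · rw [if_pos hqq, ← hqq]
          have := hdiag q.1
          have h5 := mul_nonneg hc s0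
          linarith
        · rw [if_neg hqq, zero_add]
          exact hoff _ h3 _ h4 hqq
    _ = Cd * ∑ r ∈ T, SR r + (T.card : ℝ) ^ 2 * (c * St) := by
        rw [Finset.sum_add_distrib, Finset.sum_const, Finset.card_product, Finset.sum_product]
        simp only [Finset.sum_ite_eq]
        have e5 : (∑ r ∈ T, if r ∈ T then Cd * SR r else 0) = Cd * ∑ r ∈ T, SR r := by
          rw [Finset.mul_sum]
          exact Finset.sum_congr rfl fun r hr => if_pos hr
        rw [e5, nsmul_eq_mul, Nat.cast_mul, ← sq]
    _ ≤ _ := by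
        rw [← hsum (fun i => nrm w (tri k) (f i)), ← hSt, add_mul, mul_assoc]
        have hc1 : (T.card : ℝ) ≤ p := by rw [pow_one] at hcard; exact_mod_cast hcard
        have h3 := mul_nonneg hc s0
        exact add_le_add le_rfl (mul_le_mul_of_nonneg_right
          (pow_le_pow_left₀ (Nat.cast_nonneg _) hc1 2) h3)

end dec
end VM

open MeasureTheory Finset
open scoped Classical

set_option linter.all false
namespace VM
section asym
variable {R : Type} [CommRing R] [IsDomain R]

/-- uniform decoupling -/
def DecU (π : R) (k N : ℕ) (C : ℝ) : Prop :=
  ∀ (Γ : Type) [AddCommGroup Γ] [Module R Γ] (G : Type) [Fintype G] (e : Γ → G → ℂ),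
    CharSys e → Dec π e k N C

/-- uniform bilinear decoupling -/
def BBU (π : R) (k l a b n : ℕ) (C : ℝ) : Prop :=
  ∀ (Γ : Type) [AddCommGroup Γ] [Module R Γ] (G : Type) [Fintype G] (e : Γ → G → ℂ),
    CharSys e → BB π e k l a b n C

/-- exponent statement -/
def EE (π : R) (P : ℝ) (k : ℕ) (η : ℝ) : Prop :=
  ∀ ε > 0, ∃ C : ℝ, 1 ≤ C ∧ ∀ n : ℕ, DecU π k n (C * P ^ ((η + ε) * n))

/-- the iteration coefficients -/
noncomputable def AA (k : ℕ) : ℕ → ℕ → ℝ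
  | 0, l => if l = 0 then 1 else 0
  | t + 1, l => if l = 0 then 1 else
      (((k - l : ℕ) : ℝ) / ((k - l : ℕ) + 1)) * AA k t (l - 1) + AA k t (k - l) / l

lemma AA_zero (k t : ℕ) : AA k t 0 = 1 := by cases t <;> simp [AA]

lemma AA_nonneg (k t : ℕ) : ∀ l, 0 ≤ AA k t l := by
  induction t with
  | zero => intro l; simp only [AA]; split_ifs <;> norm_num
  | succ t ih =>
    intro l; simp only [AA]
    split_ifs
    · norm_num
    · have := ih (l - 1); have := ih (k - l); positivity

lemma AA_sum (k : ℕ) (hk : 2 ≤ k) (t : ℕ) : (t : ℝ) / 2 ≤ ∑ l ∈ Ico 1 k, AA k t l := by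
  induction t with
  | zero => simp; exact Finset.sum_nonneg fun l _ => AA_nonneg k 0 l
  | succ t ih =>
    have h1 : ∑ l ∈ Ico 1 k, AA k (t + 1) l =
        ∑ l ∈ Ico 1 k, (((k - l : ℕ) : ℝ) / ((k - l : ℕ) + 1)) * AA k t (l - 1) +
        ∑ l ∈ Ico 1 k, AA k t (k - l) / l := by
      rw [← Finset.sum_add_distrib]
      refine Finset.sum_congr rfl fun l hl => ?_
      simp at hl
      simp only [AA]
      rw [if_neg (by omega)]
    have h2 : ∑ l ∈ Ico 1 k, AA k t (k - l) / l = ∑ i ∈ Ico 1 k, AA k t i / ((k - i : ℕ) : ℝ) := by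
      refine Finset.sum_nbij' (fun l => k - l) (fun l => k - l) ?_ ?_ ?_ ?_ ?_
      · intro l hl; simp at *; omega
      · intro l hl; simp at *; omega
      · intro l hl; simp at *; omega
      · intro l hl; simp at *; omega
      · intro l hl
        simp at hl
        rw [show k - (k - l) = l by omega]
    have h3 : ∑ l ∈ Ico 1 k, (((k - l : ℕ) : ℝ) / ((k - l : ℕ) + 1)) * AA k t (l - 1) =
        ∑ i ∈ range (k - 1), (((k - 1 - i : ℕ) : ℝ) / ((k - 1 - i : ℕ) + 1)) * AA k t i := by
      rw [Finset.sum_Ico_eq_sum_range]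
      refine Finset.sum_congr rfl fun i _ => ?_
      rw [show k - (1 + i) = k - 1 - i by omega, show 1 + i - 1 = i by omega]
    obtain ⟨q, rfl⟩ := Nat.exists_eq_add_of_le' hk
    have h4 : ∑ i ∈ range (q + 2 - 1),
        (((q + 2 - 1 - i : ℕ) : ℝ) / ((q + 2 - 1 - i : ℕ) + 1)) * AA (q + 2) t i =
        ∑ i ∈ Ico 1 (q + 1), (((q + 1 - i : ℕ) : ℝ) / ((q + 1 - i : ℕ) + 1)) * AA (q + 2) t i +
          ((q : ℝ) + 1) / (q + 2) := by
      rw [show q + 2 - 1 = q + 1 by omega, Finset.sum_range_eq_add_Ico _ (by omega), add_comm,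
        AA_zero]
      congr 1
      push_cast
      rw [show (q : ℝ) + 1 + 1 = q + 2 by ring]; simp
    have h5 : ∑ i ∈ Ico 1 (q + 2), AA (q + 2) t i / ((q + 2 - i : ℕ) : ℝ) =
        ∑ i ∈ Ico 1 (q + 1), AA (q + 2) t i / ((q + 2 - i : ℕ) : ℝ) + AA (q + 2) t (q + 1) := by
      rw [Finset.sum_Ico_succ_top (by omega)]
      rw [show q + 2 - (q + 1) = 1 by omega]; simp
    have h6 : ∑ i ∈ Ico 1 (q + 1), (((q + 1 - i : ℕ) : ℝ) / ((q + 1 - i : ℕ) + 1)) * AA (q + 2) t i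
        + ∑ i ∈ Ico 1 (q + 1), AA (q + 2) t i / ((q + 2 - i : ℕ) : ℝ) =
        ∑ i ∈ Ico 1 (q + 1), AA (q + 2) t i := by
      rw [← Finset.sum_add_distrib]
      refine Finset.sum_congr rfl fun i hi => ?_
      simp at hi
      rw [show q + 2 - i = (q + 1 - i) + 1 by omega]
      push_cast
      have : ((q + 1 - i : ℕ) : ℝ) + 1 ≠ 0 := by positivity
      field_simp
    have h7 : ∑ i ∈ Ico 1 (q + 2), AA (q + 2) t i = ∑ i ∈ Ico 1 (q + 1), AA (q + 2) t i +
        AA (q + 2) t (q + 1) := Finset.sum_Ico_succ_top (by omega) _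
    have h8 : (1 : ℝ) / 2 ≤ ((q : ℝ) + 1) / (q + 2) := by
      rw [div_le_div_iff₀ (by norm_num) (by positivity)]
      have : (0 : ℝ) ≤ q := Nat.cast_nonneg q
      linarith
    rw [h1, h2, h3, h4, h5]
    push_cast
    linarith

lemma AA_large (k : ℕ) (hk : 2 ≤ k) (t : ℕ) : ∃ l, 1 ≤ l ∧ l < k ∧ (t : ℝ) / (2 * k) ≤ AA k t l := by
  by_contra hcon
  push Not at hcon
  have h1 := AA_sum k hk t
  have h2 : ∑ l ∈ Ico 1 k, AA k t l < ∑ l ∈ Ico 1 k, (t : ℝ) / (2 * k) := by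
    apply Finset.sum_lt_sum_of_nonempty
    · exact ⟨1, by simp; omega⟩
    · intro l hl; simp at hl; exact hcon l hl.1 hl.2
  simp only [Finset.sum_const, Nat.card_Ico, nsmul_eq_mul] at h2
  have h3 : ((k - 1 : ℕ) : ℝ) * ((t : ℝ) / (2 * k)) ≤ (t : ℝ) / 2 := by
    have hk0 : (0 : ℝ) < k := by exact_mod_cast (by omega : 0 < k)
    have h4 : ((k - 1 : ℕ) : ℝ) ≤ k := by exact_mod_cast Nat.sub_le k 1
    calc _ ≤ (k : ℝ) * ((t : ℝ) / (2 * k)) := by gcongr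
      _ = _ := by field_simp
  linarith

lemma cp_pow {P : ℝ} (hP : 0 < P) (C x : ℝ) (m : ℕ) : (C * P ^ x) ^ m = C ^ m * P ^ (x * m) := by
  rw [mul_pow, ← Real.rpow_natCast (P ^ x), ← Real.rpow_mul hP.le]

variable {π : R} {p : ℕ} {ρ : ℕ → R → ℕ} {K : ℕ} {k : ℕ}

/-- the iterated claim -/
def PT (π : R) (P : ℝ) (k : ℕ) (η : ℝ) (κ t : ℕ) : Prop :=
  ∀ l, 1 ≤ l → l < k → ∀ ε > (0 : ℝ), ∃ C : ℝ, 1 ≤ C ∧ ∀ n b a : ℕ, (k.factorial) ^ t ∣ b → 1 ≤ b →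
    κ * b ≤ n → 1 ≤ a → a * l ≤ b * (k - l + 1) →
    BBU π k l a b n (C * P ^ ((tri k : ℝ) * (η * (n - AA k t l * b) + ε * n)))

lemma PT_zero (hA : Amb π p ρ K) (hP : (1 : ℝ) < p) (hk : 2 ≤ k) {η : ℝ} (hη : 0 ≤ η)
    (hE : EE π p k η) : PT π p k η k 0 := by
  intro l h1 hl ε hε
  obtain ⟨C, hC, hD⟩ := hE ε hε
  refine ⟨C ^ tri k, one_le_pow₀ hC, ?_⟩
  intro n b a _ hb hκ ha hab Γ _ _ G _ e he
  have hP0 : (0 : ℝ) < p := by linarith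
  have hbn : b ≤ n := le_trans (Nat.le_mul_of_pos_left b (by omega)) hκ
  have han : a ≤ n := by
    calc a ≤ a * l := Nat.le_mul_of_pos_right a (by omega)
      _ ≤ b * (k - l + 1) := hab
      _ ≤ b * k := Nat.mul_le_mul_left b (by omega)
      _ ≤ n := by rw [mul_comm]; exact hκ
  set M := C * (p : ℝ) ^ ((η + ε) * n) with hM
  have hM0 : 0 ≤ M := by positivity
  have hDa : ∀ c ≤ n, Dec π e k (n - c) M := by
    intro c hc
    refine (hD (n - c) Γ G e he).mono ?_
    have : ((n - c : ℕ) : ℝ) ≤ n := by exact_mod_cast Nat.sub_le n c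
    rw [hM]
    refine mul_le_mul_of_nonneg_left (Real.rpow_le_rpow_of_exponent_le hP.le ?_) (by positivity)
    exact mul_le_mul_of_nonneg_left this (by positivity)
  refine (BB_triv hA (by omega) hl.le han hbn hM0 hM0 (hDa a han) (hDa b hbn)).mono ?_
  rw [← pow_add, Nat.add_sub_cancel' (tri_mono hl.le), hM, cp_pow hP0]
  apply le_of_eq
  congr 2
  simp only [AA, if_neg (by omega : ¬ l = 0)]
  ring

lemma PT_succ (hA : Amb π p ρ K) (hP : (1 : ℝ) < p) (hk : 2 ≤ k) (hkK : k ≤ K) {η : ℝ} (hη : 0 ≤ η)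
    (hE : EE π p k η) (hlow : ∀ l, 1 ≤ l → l < k → EE π p l 0) {κ t : ℕ} (hκ1 : 1 ≤ κ)
    (hPT : PT π p k η κ t) : PT π p k η (k * κ) (t + 1) := by
  intro l h1 hl ε hε
  have hP0 : (0 : ℝ) < p := by linarith
  set T := tri k with hT
  -- bound for `l-1`
  have hB1 : ∃ C1 : ℝ, 1 ≤ C1 ∧ ∀ n b a : ℕ, (k.factorial) ^ t ∣ b → 1 ≤ b →
    κ * b ≤ n → 1 ≤ a → a * l ≤ b * (k - l + 1) →
    BBU π k (l - 1) a b n (C1 * (p : ℝ) ^ ((T : ℝ) * (η * (n - AA k t (l - 1) * b) + ε / 2 * n))) := by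
    by_cases hl1 : l = 1
    · subst hl1
      obtain ⟨C, hC, hD⟩ := hE (ε / 2) (by positivity)
      refine ⟨C ^ T, one_le_pow₀ hC, ?_⟩
      intro n b a _ hb hκ ha hab Γ _ _ G _ e he
      have hbn : b ≤ n := le_trans (Nat.le_mul_of_pos_left b (by omega)) hκ
      have := BB_zero (a := a) hA (by omega : 1 ≤ k) hbn (hD (n - b) Γ G e he)
      refine this.mono ?_
      rw [cp_pow hP0]
      refine mul_le_mul_of_nonneg_left (Real.rpow_le_rpow_of_exponent_le hP.le ?_) (by positivity)
      rw [AA_zero, Nat.cast_sub hbn, mul_comm _ (T : ℝ)]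
      refine mul_le_mul_of_nonneg_left ?_ (Nat.cast_nonneg _)
      have : 0 ≤ ε / 2 * b := by positivity
      nlinarith
    · obtain ⟨C, hC, h⟩ := hPT (l - 1) (by omega) (by omega) (ε / 2) (by positivity)
      refine ⟨C, hC, fun n b a d1 d2 d3 d4 d5 => h n b a d1 d2 d3 d4 ?_⟩
      calc a * (l - 1) ≤ a * l := Nat.mul_le_mul_left _ (by omega)
        _ ≤ b * (k - l + 1) := d5
        _ ≤ _ := Nat.mul_le_mul_left _ (by omega)
  obtain ⟨C1, hC1, hB1⟩ := hB1
  obtain ⟨C2, hC2, hB2⟩ := hPT (k - l) (by omega) (by omega) (ε / 2) (by positivity)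
  obtain ⟨Cl, hCl, hDl⟩ := hlow l h1 hl (ε / 2) (by positivity)
  refine ⟨Cl ^ tri l * (C1 * C2), ?_, ?_⟩
  · exact one_le_mul_of_one_le_of_one_le (one_le_pow₀ hCl)
      (one_le_mul_of_one_le_of_one_le hC1 hC2)
  intro n b a hdvd hb hκ ha hab Γ _ _ G _ e he
  have hlf : l ∣ k.factorial := Nat.dvd_factorial (by omega) hl.le
  obtain ⟨q, hq⟩ := hlf
  obtain ⟨c, hc⟩ := hdvd
  set a0 := (k - l + 1) * (q * (k.factorial ^ t * c)) with ha0
  have ha0l : a0 * l = b * (k - l + 1) := by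
    rw [hc, pow_succ, ha0]
    calc _ = (k - l + 1) * ((l * q) * (k.factorial ^ t * c)) := by ring
      _ = _ := by rw [← hq]; ring
  have hd1 : k.factorial ^ t ∣ b := by rw [hc, pow_succ, mul_assoc]; exact dvd_mul_right _ _
  have hd2 : k.factorial ^ t ∣ a0 := by
    rw [ha0]; exact Dvd.dvd.mul_left (Dvd.dvd.mul_left (dvd_mul_right _ _) _) _
  have haa0 : a ≤ a0 := by
    apply Nat.le_of_mul_le_mul_right _ (by omega : 0 < l)
    rw [ha0l]; exact hab
  have hκb : κ * b ≤ n := by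
    refine le_trans ?_ hκ
    rw [mul_assoc]
    exact Nat.le_mul_of_pos_left _ (by omega)
  have ha0k : a0 ≤ k * b := by
    calc a0 ≤ a0 * l := Nat.le_mul_of_pos_right _ (by omega)
      _ = b * (k - l + 1) := ha0l
      _ ≤ b * k := Nat.mul_le_mul_left b (by omega)
      _ = k * b := mul_comm _ _
  have hκa0 : κ * a0 ≤ n := by
    calc κ * a0 ≤ κ * (k * b) := Nat.mul_le_mul_left _ ha0k
      _ = k * κ * b := by ring
      _ ≤ n := hκ
  have hbn : b ≤ n := le_trans (Nat.le_mul_of_pos_left b (by omega)) hκb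
  have ha0n : a0 ≤ n := le_trans (Nat.le_mul_of_pos_left a0 (by omega)) hκa0
  have r1 := hB1 n b a0 hd1 hb hκb (by omega) ha0l.le Γ G e he
  have r2 := hB2 n a0 b hd2 (by omega) hκa0 hb (by
    have e1 : k - (k - l) + 1 = l + 1 := by omega
    rw [e1]
    calc b * (k - l) ≤ b * (k - l + 1) := Nat.mul_le_mul_left _ (by omega)
      _ = a0 * l := ha0l.symm
      _ ≤ _ := Nat.mul_le_mul_left _ (by omega)) Γ G e he
  set E1 := (T : ℝ) * (η * (n - AA k t (l - 1) * b) + ε / 2 * n) with hE1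
  set E2 := (T : ℝ) * (η * (n - AA k t (k - l) * a0) + ε / 2 * n) with hE2
  set E3 := (T : ℝ) * (η * (n - AA k (t + 1) l * b) + ε / 2 * n) with hE3
  have hEE : E1 * (k - l : ℕ) + E2 = E3 * ((k - l + 1 : ℕ) : ℝ) := by
    have hl0 : (l : ℝ) ≠ 0 := by exact_mod_cast (by omega : l ≠ 0)
    have e2 : (a0 : ℝ) = b * ((k - l : ℕ) + 1) / l := by
      rw [eq_div_iff hl0]; exact_mod_cast ha0l
    have e3 : AA k (t + 1) l = (((k - l : ℕ) : ℝ) / ((k - l : ℕ) + 1)) * AA k t (l - 1) +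
        AA k t (k - l) / l := by
      simp only [AA, if_neg (by omega : ¬ l = 0)]
    rw [hE1, hE2, hE3, e2, e3]
    push_cast
    have : ((k - l : ℕ) : ℝ) + 1 ≠ 0 := by positivity
    field_simp
    ring
  have r3 : BB π e k l a0 b n (C1 * C2 * (p : ℝ) ^ E3) := by
    refine BB_holder h1 hl.le (by positivity) (by positivity) ?_ r1 r2
    rw [cp_pow hP0, cp_pow hP0, ← hEE, Real.rpow_add hP0]
    have : C1 ^ (k - l) * C2 ≤ (C1 * C2) ^ (k - l + 1) := by
      rw [mul_pow]
      refine mul_le_mul (pow_le_pow_right₀ hC1 (by omega)) ?_ (by positivity) (by positivity)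
      exact le_self_pow₀ hC2 (by omega)
    calc _ = C1 ^ (k - l) * C2 * ((p : ℝ) ^ (E1 * (k - l : ℕ)) * (p : ℝ) ^ E2) := by ring
      _ ≤ _ := mul_le_mul_of_nonneg_right this (by positivity)
  have hdl : Dec π e l (a0 - a) (Cl * (p : ℝ) ^ (ε / 2 * n)) := by
    refine (hDl (a0 - a) Γ G e he).mono ?_
    refine mul_le_mul_of_nonneg_left (Real.rpow_le_rpow_of_exponent_le hP.le ?_) (by positivity)
    rw [zero_add]
    refine mul_le_mul_of_nonneg_left ?_ (by positivity)
    exact_mod_cast (by omega : a0 - a ≤ n)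
  have r4 := BB_lower he hA hkK h1 hl.le ha haa0 ha0n hbn ha0l.le (by positivity) (by positivity) hdl r3
  refine r4.mono ?_
  rw [cp_pow hP0]
  calc Cl ^ tri l * (p : ℝ) ^ (ε / 2 * n * tri l) * (C1 * C2 * (p : ℝ) ^ E3) =
      Cl ^ tri l * (C1 * C2) * (p : ℝ) ^ (ε / 2 * n * tri l + E3) := by
        rw [Real.rpow_add hP0]; ring
    _ ≤ _ := by
        refine mul_le_mul_of_nonneg_left (Real.rpow_le_rpow_of_exponent_le hP.le ?_) (by positivity)
        have h5 : (tri l : ℝ) ≤ T := by exact_mod_cast tri_mono hl.le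
        have h6 : ε / 2 * n * tri l ≤ ε / 2 * n * T := mul_le_mul_of_nonneg_left h5 (by positivity)
        rw [hE3]
        linarith

end asym
end VM

open MeasureTheory Finset
open scoped Classical

set_option linter.all false
namespace VM
section asym2
variable {R : Type} [CommRing R] [IsDomain R]
variable {π : R} {p : ℕ} {ρ : ℕ → R → ℕ} {K : ℕ} {k : ℕ}

lemma PT_all (hA : Amb π p ρ K) (hP : (1 : ℝ) < p) (hk : 2 ≤ k) (hkK : k ≤ K) {η : ℝ} (hη : 0 ≤ η)
    (hE : EE π p k η) (hlow : ∀ l, 1 ≤ l → l < k → EE π p l 0) (t : ℕ) :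
    PT π p k η (k ^ (t + 1)) t := by
  induction t with
  | zero => simpa using PT_zero hA hP hk hη hE
  | succ t ih =>
    have := PT_succ hA hP hk hkK hη hE hlow (Nat.one_le_pow _ _ (by omega)) ih
    rwa [pow_succ, mul_comm]

lemma EE_improve (hA : Amb π p ρ K) (hP : (1 : ℝ) < p) (hk : 2 ≤ k) (hkK : k ≤ K) {η : ℝ}
    (hη : 0 < η) (hE : EE π p k η) (hlow : ∀ l, 1 ≤ l → l < k → EE π p l 0) :
    ∃ β, 0 < β ∧ β ≤ η ∧ EE π p k (η - β) := by
  have hP0 : (0 : ℝ) < p := by linarith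
  have hk0 : (0 : ℝ) < k := by exact_mod_cast (by omega : 0 < k)
  obtain ⟨t, ht⟩ := exists_nat_ge (3 * (2 * k) / η)
  obtain ⟨l, hl1, hlk, hlA⟩ := AA_large k hk (t + 1)
  have hA3 : 3 ≤ η * AA k (t + 1) l := by
    have : 3 * (2 * k) ≤ t * η := by rwa [div_le_iff₀ hη] at ht
    have h2 : 3 ≤ η * (((t + 1 : ℕ) : ℝ) / (2 * k)) := by
      rw [mul_div_assoc', le_div_iff₀ (by positivity)]
      push_cast
      nlinarith
    exact h2.trans (mul_le_mul_of_nonneg_left hlA hη.le)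
  have hPT := PT_all hA hP hk hkK hη.le hE hlow (t + 1)
  set κ := k ^ (t + 1 + 1) with hκ
  have hκ1 : 1 ≤ κ := Nat.one_le_pow _ _ (by omega)
  have hκ0 : (0 : ℝ) < κ := by exact_mod_cast hκ1
  set Λ := k.factorial ^ (t + 1) with hΛ
  have hΛk : k ≤ Λ := (Nat.self_le_factorial k).trans (Nat.le_self_pow (by omega) _)
  refine ⟨min (1 / κ) η, lt_min (by positivity) hη, min_le_right _ _, ?_⟩
  set β := min (1 / (κ : ℝ)) η with hβ
  have hβ1 : β ≤ 1 / κ := min_le_left _ _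
  have hβ2 : β ≤ η := min_le_right _ _
  intro ε hε
  obtain ⟨C, hC, hB⟩ := hPT l hl1 hlk ε hε
  set θ := η - β + ε with hθ
  have hθ0 : 0 < θ := by linarith
  set T := tri k with hT
  have hT1 : 1 ≤ T := tri_pos (by omega)
  have htl : tri l < T := by
    have h1 := two_tri l
    have h2 := two_tri k
    rw [← hT] at h2
    have : l * (l + 1) < k * (k + 1) := by nlinarith
    omega
  set q := (p : ℝ) ^ (-θ) with hq
  have hq1 : q < 1 := Real.rpow_lt_one_of_one_lt_of_neg hP (by linarith)
  set c0 := C * (p : ℝ) ^ (Λ : ℝ) with hc0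
  have hc00 : 0 ≤ c0 := by positivity
  set Cs := max ((p : ℝ) ^ 2 * c0 / (1 - q)) ((p : ℝ) ^ (κ * Λ)) with hCs
  have hCs1 : 1 ≤ Cs := le_max_of_le_right (one_le_pow₀ hP.le)
  refine ⟨Cs, hCs1, ?_⟩
  intro n
  induction n with
  | zero =>
    intro Γ _ _ G _ e he
    refine (Dec_triv hA (by omega)).mono ?_
    simpa using hCs1
  | succ m ih =>
    intro Γ _ _ G _ e he
    set n := m + 1 with hn
    by_cases hnn : n < κ * Λ
    · refine (Dec_triv hA (by omega)).mono ?_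
      calc (p : ℝ) ^ n ≤ (p : ℝ) ^ (κ * Λ) := pow_le_pow_right₀ hP.le hnn.le
        _ ≤ Cs := le_max_right _ _
        _ ≤ Cs * (p : ℝ) ^ (θ * n) := le_mul_of_one_le_right (by linarith)
            (Real.one_le_rpow hP.le (by positivity))
    · push Not at hnn
      have hκΛ : 0 < κ * Λ := Nat.mul_pos hκ1 (by omega)
      set Q := n / (κ * Λ) with hQ
      have hQ1 : 1 ≤ Q := (Nat.one_le_div_iff hκΛ).2 hnn
      have hb1 : Λ ≤ Λ * Q := Nat.le_mul_of_pos_right _ hQ1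
      have hbn : κ * (Λ * Q) ≤ n := by rw [← mul_assoc]; exact Nat.mul_div_le n (κ * Λ)
      have hbn2 : (n : ℝ) / κ ≤ (Λ * Q : ℕ) + Λ := by
        rw [div_le_iff₀ hκ0]
        have h1 : n < κ * Λ * (Q + 1) := by
          rw [mul_comm]; exact Nat.lt_mul_of_div_lt (Nat.lt_succ_self _) hκΛ
        have : (n : ℝ) ≤ (κ * Λ * (Q + 1) : ℕ) := by exact_mod_cast h1.le
        push_cast at this ⊢
        linarith
      have hBB := hB n (Λ * Q) 1 (dvd_mul_right _ _) (by omega) hbn le_rfl (by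
        calc 1 * l ≤ Λ * Q * 1 := by omega
          _ ≤ _ := Nat.mul_le_mul_left _ (by omega)) Γ G e he
      have hB2 := BB_small hA htl (by omega) (by positivity) hBB
      set b := Λ * Q with hb
      have hkey : (p : ℝ) ^ (2 * b * T) * (C * (p : ℝ) ^
          ((T : ℝ) * (η * (n - AA k (t + 1) l * b) + ε * n))) ≤ (c0 * (p : ℝ) ^ (θ * n)) ^ T := by
        have e1 : c0 * (p : ℝ) ^ (θ * n) = C * (p : ℝ) ^ (Λ + θ * n) := by
          rw [Real.rpow_add hP0, hc0, mul_assoc]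
        rw [e1, cp_pow hP0, ← Real.rpow_natCast (p : ℝ) (2 * b * T), mul_left_comm,
          ← Real.rpow_add hP0]
        refine mul_le_mul (le_self_pow₀ hC (by omega))
          (Real.rpow_le_rpow_of_exponent_le hP.le ?_) (by positivity) (by positivity)
        push_cast
        have hb0 : (0 : ℝ) ≤ (Λ * Q : ℕ) := Nat.cast_nonneg _
        have h1 : 2 * (b : ℝ) + (η * (n - AA k (t + 1) l * b) + ε * n) ≤ Λ + θ * n := by
          have h3 : 3 * (b : ℝ) ≤ η * AA k (t + 1) l * b := mul_le_mul_of_nonneg_right hA3 hb0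
          have h4 : β * n ≤ (n : ℝ) / κ := by
            rw [div_eq_mul_one_div, mul_comm]
            exact mul_le_mul_of_nonneg_left hβ1 (Nat.cast_nonneg _)
          rw [hθ]
          linarith
        have hT0 : (0 : ℝ) ≤ T := Nat.cast_nonneg _
        nlinarith [mul_le_mul_of_nonneg_left h1 hT0]
      have hD := Dec_step hA (by omega) (by omega) hlk.le (by positivity)
        (by positivity) hkey hB2 (by simpa [hn] using ih Γ G e he)
      refine hD.mono ?_
      have e2 : (p : ℝ) ^ (θ * (m : ℝ)) = q * (p : ℝ) ^ (θ * n) := by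
        rw [hq, ← Real.rpow_add hP0, hn]; push_cast; congr 1; ring
      have h5 : (p : ℝ) ^ 2 * c0 ≤ Cs * (1 - q) := by
        rw [← div_le_iff₀ (by linarith)]; exact le_max_left _ _
      have h6 : 0 ≤ (p : ℝ) ^ (θ * n) := by positivity
      change Cs * (p : ℝ) ^ (θ * (m : ℝ)) + (p : ℝ) ^ 2 * (c0 * (p : ℝ) ^ (θ * n)) ≤ _
      rw [e2]
      nlinarith [mul_le_mul_of_nonneg_right h5 h6]

theorem EE_zero (hA : Amb π p ρ K) (hP : (1 : ℝ) < p) :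
    ∀ k, 1 ≤ k → k ≤ K → EE π p k 0 := by
  intro k
  induction k using Nat.strong_induction_on with
  | _ k ih =>
  intro hk hkK
  have hP0 : (0 : ℝ) < p := by linarith
  by_cases hk1 : k = 1
  · subst hk1
    intro ε hε
    refine ⟨1, le_rfl, fun n Γ _ _ G _ e he => (Dec_one he hA n).mono ?_⟩
    rw [one_mul]
    exact Real.one_le_rpow hP.le (by positivity)
  · have hlow : ∀ l, 1 ≤ l → l < k → EE π p l 0 := fun l h1 h2 => ih l h2 h1 (by omega)
    have hE1 : EE π p k 1 := by
      intro ε hε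
      refine ⟨1, le_rfl, fun n Γ _ _ G _ e he => (Dec_triv hA hk).mono ?_⟩
      rw [one_mul, ← Real.rpow_natCast]
      refine Real.rpow_le_rpow_of_exponent_le hP.le ?_
      have : (0 : ℝ) ≤ n := Nat.cast_nonneg _
      nlinarith
    set A := {η : ℝ | 0 ≤ η ∧ EE π p k η} with hAdef
    have hne : A.Nonempty := ⟨1, by norm_num, hE1⟩
    have hbd : BddBelow A := ⟨0, fun x hx => hx.1⟩
    set η0 := sInf A with hη0
    have h0 : 0 ≤ η0 := le_csInf hne fun x hx => hx.1
    have hE0 : EE π p k η0 := by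
      intro ε hε
      obtain ⟨x, hx, hxl⟩ := exists_lt_of_csInf_lt hne (show sInf A < η0 + ε / 2 by linarith)
      obtain ⟨C, hC, hD⟩ := hx.2 (ε / 2) (by linarith)
      refine ⟨C, hC, fun n Γ _ _ G _ e he => (hD n Γ G e he).mono ?_⟩
      refine mul_le_mul_of_nonneg_left (Real.rpow_le_rpow_of_exponent_le hP.le ?_) (by linarith)
      exact mul_le_mul_of_nonneg_right (by linarith) (Nat.cast_nonneg _)
    rcases h0.eq_or_lt with h | h
    · rw [← h] at hE0; exact hE0
    · exfalso
      obtain ⟨β, hβ, hβ2, hE'⟩ := EE_improve hA hP (by omega) hkK h hE0 hlow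
      have := csInf_le hbd (show η0 - β ∈ A from ⟨by linarith, hE'⟩)
      linarith
end asym2
end VM

open MeasureTheory Finset
open scoped Classical

set_option linter.all false
namespace VM
section padic
variable (p : ℕ) [hp : Fact p.Prime] (M j k : ℕ)

/-- frequency group -/
def Gm : Type := Fin j → ZMod (p ^ M)

noncomputable instance : AddCommGroup (Gm p M j) := inferInstanceAs (AddCommGroup (Fin j → ZMod (p ^ M)))

noncomputable instance : Module ℤ_[p] (Gm p M j) :=
  Module.compHom (Fin j → ZMod (p ^ M)) (PadicInt.toZModPow (p := p) M)

/-- characters -/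
noncomputable def ee (ξ : Gm p M j) (g : Fin j → ZMod (p ^ M)) : ℂ :=
  ZMod.stdAddChar (∑ i, ξ i * g i)

lemma ee_char : CharSys (ee p M j) where
  zero := fun g => by
    unfold ee
    rw [show (∑ i, (0 : Gm p M j) i * g i) = 0 from Finset.sum_eq_zero fun i _ => zero_mul _]
    exact AddChar.map_zero_eq_one _
  add := fun a b g => by
    unfold ee
    rw [← AddChar.map_add_eq_mul, ← Finset.sum_add_distrib]
    congr 1
    exact Finset.sum_congr rfl fun i _ => add_mul _ _ _
  conj := fun a g => by
    unfold ee
    rw [show (∑ i, (-a) i * g i) = -(∑ i, a i * g i) by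
      rw [← Finset.sum_neg_distrib]; exact Finset.sum_congr rfl fun i _ => neg_mul _ _]
    rw [← AddChar.map_neg_eq_conj]
  orth := fun a ha => by
    let φ : (Fin j → ZMod (p ^ M)) →+ ZMod (p ^ M) :=
      { toFun := fun g => ∑ i, a i * g i
        map_zero' := by simp
        map_add' := fun x y => by simp [mul_add, Finset.sum_add_distrib] }
    let ψ : AddChar (Fin j → ZMod (p ^ M)) ℂ := (ZMod.stdAddChar).compAddMonoidHom φ
    change ∑ g, ψ g = 0
    rw [AddChar.sum_eq_zero_iff_ne_zero]
    intro h
    apply ha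
    funext i
    have h1 : ψ (Pi.single i 1) = 1 := by rw [h]; rfl
    have h2 : φ (Pi.single i 1) = a i := by
      change ∑ i', a i' * (Pi.single i 1 : Fin j → ZMod (p ^ M)) i' = a i
      rw [Finset.sum_eq_single i]
      · simp
      · intro b _ hb; simp [Pi.single_apply, hb]
      · simp
    have h3 : ZMod.stdAddChar (a i) = (1 : ℂ) := by rw [← h2]; exact h1
    rw [← AddChar.map_zero_eq_one (ZMod.stdAddChar (N := p ^ M))] at h3
    exact ZMod.injective_stdAddChar h3

/-- exponents -/
def mu (i : Fin j) : ℕ := if (i : ℕ) + 1 < j then i + 1 else k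

/-- the curve -/
noncomputable def DD (i : ℕ) (x : ℤ_[p]) : Gm p M j :=
  fun a => PadicInt.toZModPow M (((mu j k a).choose i : ℤ_[p]) * x ^ (mu j k a - i))

lemma sm_apply (r : ℤ_[p]) (ξ : Gm p M j) (a : Fin j) : (r • ξ) a = PadicInt.toZModPow M r * ξ a := rfl

lemma gsum_apply {ι : Type*} (s : Finset ι) (f : ι → Gm p M j) (a : Fin j) :
    (∑ i ∈ s, f i) a = ∑ i ∈ s, f i a := by
  exact Finset.sum_apply (M := fun _ : Fin j => ZMod (p ^ M)) a s f

lemma taylor_num {R : Type*} [CommRing R] (m d i : ℕ) (hm : m ≤ d) (x y : R) :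
    ((m.choose i : ℕ) : R) * (x + y) ^ (m - i) =
    ∑ l ∈ range (d + 1), ((l.choose i : ℕ) : R) * y ^ (l - i) * ((m.choose l : ℕ) * x ^ (m - l)) := by
  by_cases hi : i ≤ m
  · have h1 : ∑ l ∈ range (d + 1), ((l.choose i : ℕ) : R) * y ^ (l - i) * ((m.choose l : ℕ) * x ^ (m - l))
        = ∑ l ∈ Ico i (m + 1), ((l.choose i : ℕ) : R) * y ^ (l - i) * ((m.choose l : ℕ) * x ^ (m - l)) := by
      symm
      apply Finset.sum_subset
      · intro l hl; simp at *; omega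
      · intro l hl hl2
        simp at hl hl2
        by_cases h : l < i
        · simp [Nat.choose_eq_zero_of_lt h]
        · simp [Nat.choose_eq_zero_of_lt (show m < l by omega)]
    rw [h1, Finset.sum_Ico_eq_sum_range, add_comm x y, add_pow, Finset.mul_sum,
      show m + 1 - i = m - i + 1 by omega]
    refine Finset.sum_congr rfl fun l hl => ?_
    simp at hl
    have h2 : m.choose (i + l) * (i + l).choose i = m.choose i * (m - i).choose l := by
      have := Nat.choose_mul (n := m) (k := i + l) (s := i) (by omega)
      rwa [show i + l - i = l by omega] at this
    have h3 : ((m.choose (i + l) : ℕ) : R) * ((i + l).choose i : ℕ) = (m.choose i : ℕ) * ((m - i).choose l : ℕ) := by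
      exact_mod_cast congrArg (Nat.cast : ℕ → R) h2
    rw [show i + l - i = l by omega, show m - (i + l) = m - i - l by omega]
    linear_combination (-(y ^ l * x ^ (m - i - l))) * h3
  · push Not at hi
    rw [Nat.choose_eq_zero_of_lt hi]
    simp only [Nat.cast_zero, zero_mul]
    symm
    apply Finset.sum_eq_zero
    intro l _
    by_cases h : l < i
    · simp [Nat.choose_eq_zero_of_lt h]
    · simp [Nat.choose_eq_zero_of_lt (show m < l by omega)]

variable {p M j k}

lemma mu_le (hjk : j ≤ k) (a : Fin j) : mu j k a ≤ k := by
  unfold mu; split_ifs <;> omega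

lemma DD_taylor (hjk : j ≤ k) (i : ℕ) (x y : ℤ_[p]) : DD p M j k i (x + y) =
    ∑ l ∈ range (k + 1), ((Nat.choose l i : ℤ_[p]) * y ^ (l - i)) • DD p M j k l x := by
  funext a
  rw [gsum_apply]
  simp only [sm_apply, DD, ← map_mul, ← map_sum]
  congr 1
  exact taylor_num _ _ _ (mu_le hjk a) x y

lemma unit_of_lt {m : ℕ} (h1 : 1 ≤ m) (h2 : m < p) : IsUnit (m : ℤ_[p]) := by
  rw [PadicInt.isUnit_iff, PadicInt.norm_natCast_eq_one_iff]
  exact (Nat.Prime.coprime_iff_not_dvd hp.out).2 fun h => absurd (Nat.le_of_dvd h1 h) (by omega)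

lemma unit_choose (hkp : k < p) {i : ℕ} (hi : i ≤ k) : IsUnit ((k.choose i : ℕ) : ℤ_[p]) := by
  rw [PadicInt.isUnit_iff, PadicInt.norm_natCast_eq_one_iff]
  refine (Nat.Prime.coprime_iff_not_dvd hp.out).2 fun h => ?_
  have h1 : p ∣ k.factorial := by
    rw [← Nat.choose_mul_factorial_mul_factorial hi, mul_assoc]
    exact h.mul_right _
  rw [hp.out.dvd_factorial] at h1
  omega

lemma DD_high (hj : 1 ≤ j) (hjk : j ≤ k) (hkp : k < p) (u : ℤ_[p]) (hu : IsUnit u) {i : ℕ} (hi : j ≤ i)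
    : ∃ r : ℤ_[p], DD p M j k i u = r • DD p M j k j u := by
  obtain ⟨v, hv⟩ := ((unit_choose hkp hjk).mul (hu.pow (k - j)))
  refine ⟨((k.choose i : ℤ_[p]) * u ^ (k - i)) * ((v⁻¹ : (ℤ_[p])ˣ) : ℤ_[p]), ?_⟩
  funext a
  rw [sm_apply]
  simp only [DD, ← map_mul]
  congr 1
  unfold mu
  split_ifs with h
  · rw [Nat.choose_eq_zero_of_lt (show (a : ℕ) + 1 < i by omega),
      Nat.choose_eq_zero_of_lt (show (a : ℕ) + 1 < j by omega)]
    simp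
  · rw [← hv, mul_assoc, Units.inv_mul, mul_one]

lemma toZ_zero (m : ℕ) (x : ℤ_[p]) : PadicInt.toZModPow m x = 0 ↔ (p : ℤ_[p]) ^ m ∣ x := by
  rw [← RingHom.mem_ker, PadicInt.ker_toZModPow, Ideal.mem_span_singleton]

lemma sys_indep (hj : 1 ≤ j) (hjk : j ≤ k) (hkp : k < p) (u : ℤ_[p]) (hu : IsUnit u) (c : ℕ → ℤ_[p])
    (h : ∑ i ∈ Icc 1 j, c i • DD p M j k i u = 0) : ∀ i ∈ Icc 1 j, (p : ℤ_[p]) ^ M ∣ c i := by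
  intro i
  induction i using Nat.strong_induction_on with
  | _ i ih =>
  intro hi
  simp at hi
  have h1 := congrFun h ⟨i - 1, by omega⟩
  rw [gsum_apply] at h1
  change _ = (0 : ZMod (p ^ M)) at h1
  simp only [sm_apply, DD, ← map_mul, ← map_sum] at h1
  rw [toZ_zero] at h1
  rw [← Finset.add_sum_erase _ _ (show i ∈ Icc 1 j by simp; omega)] at h1
  have h2 : (p : ℤ_[p]) ^ M ∣ ∑ l ∈ (Icc 1 j).erase i, c l * (((mu j k ⟨i - 1, by omega⟩).choose l : ℤ_[p]) *
      u ^ (mu j k ⟨i - 1, by omega⟩ - l)) := by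
    apply Finset.dvd_sum
    intro l hl
    simp at hl
    by_cases hli : l < i
    · exact (ih l hli (by simp; omega)).mul_right _
    · have : mu j k ⟨i - 1, by omega⟩ < l := by
        unfold mu
        simp only
        rw [if_pos (by omega)]; omega
      simp [Nat.choose_eq_zero_of_lt this]
  have h3 := (dvd_add_left h2).1 h1
  have h4 : IsUnit (((mu j k ⟨i - 1, by omega⟩).choose i : ℤ_[p]) *
      u ^ (mu j k ⟨i - 1, by omega⟩ - i)) := by
    refine IsUnit.mul ?_ (hu.pow _)
    unfold mu
    simp only
    split_ifs with h
    · rw [show i - 1 + 1 = i by omega]; simp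
    · exact unit_choose hkp (by omega)
  exact (h4.dvd_mul_right).1 h3

lemma unit_add {x0 : ℤ_[p]} (hx0 : IsUnit x0) (y : ℤ_[p]) : IsUnit (x0 + (p : ℤ_[p]) ^ 1 * y) := by
  by_contra h
  have h1 : x0 + (p : ℤ_[p]) ^ 1 * y ∈ nonunits ℤ_[p] := h
  have h2 : (p : ℤ_[p]) ^ 1 * y ∈ nonunits ℤ_[p] := by
    rw [pow_one]
    intro h3
    exact PadicInt.prime_p.not_unit (isUnit_of_mul_isUnit_left h3)
  have h4 : (x0 + (p : ℤ_[p]) ^ 1 * y) - (p : ℤ_[p]) ^ 1 * y ∈ nonunits ℤ_[p] := by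
    have e1 := (IsLocalRing.mem_maximalIdeal _).2 h1
    have e2 := (IsLocalRing.mem_maximalIdeal _).2 h2
    exact (IsLocalRing.mem_maximalIdeal _).1 (Ideal.sub_mem _ e1 e2)
  rw [add_sub_cancel_right] at h4
  exact h4 hx0

lemma curve_sys (hj : 1 ≤ j) (hjk : j ≤ k) (hkp : k < p) {x0 : ℤ_[p]} (hx0 : IsUnit x0) {N : ℕ}
    (hM : M = (N + 1) * j) :
    Sys (p : ℤ_[p]) (rst (p : ℤ_[p]) (DD p M j k) 1 x0) k ⊥ j N where
  kd := hjk
  taylor := rst_taylor (DD_taylor hjk) 1 x0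
  high := by
    intro y i h1 h2
    obtain ⟨r, hr⟩ := DD_high (M := M) hj hjk hkp _ (unit_add hx0 y) h1.le
    refine ⟨fun l => if l = j then (p : ℤ_[p]) ^ (i - j - 1) * r else 0, ?_⟩
    rw [Finset.sum_eq_single j]
    · rw [Submodule.mem_bot]
      unfold rst
      beta_reduce
      rw [if_pos rfl, hr, smul_smul, smul_smul, sub_eq_zero]
      congr 1
      obtain ⟨t, rfl⟩ := Nat.exists_eq_add_of_lt h1
      rw [show j + t + 1 - j - 1 = t by omega]
      ring
    · intro b _ hb; simp [hb]
    · simp; omega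
  indep := by
    intro y c hc i hi
    rw [Submodule.mem_bot] at hc
    unfold rst at hc
    simp only [smul_smul] at hc
    have h1 := sys_indep hj hjk hkp _ (unit_add hx0 y) _ hc i hi
    simp at hi
    rw [one_mul, hM] at h1
    have h2 : (p : ℤ_[p]) ^ (N * i) * (p : ℤ_[p]) ^ i ∣ c i * (p : ℤ_[p]) ^ i := by
      refine dvd_trans ?_ h1
      rw [← pow_add]
      apply pow_dvd_pow
      nlinarith
    exact (mul_dvd_mul_iff_right (pow_ne_zero _ (PadicInt.prime_p.ne_zero))).1 h2

/-- residues -/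
noncomputable def rr (m : ℕ) (x : ℤ_[p]) : ℕ := (PadicInt.toZModPow m x).val

lemma padic_amb (hkp : k < p) : Amb (p : ℤ_[p]) p rr k where
  unit := fun x hx => by
    by_contra h
    apply hx
    have := (IsLocalRing.mem_maximalIdeal _).2 (show x ∈ nonunits ℤ_[p] from h)
    rwa [PadicInt.maximalIdeal_eq_span_p, Ideal.mem_span_singleton] at this
  nunit := PadicInt.prime_p.not_unit
  ne := PadicInt.prime_p.ne_zero
  ch := fun i h1 h2 => unit_of_lt h1 (by omega)
  rho := fun m x y => by
    unfold rr
    rw [(ZMod.val_injective _).eq_iff, ← sub_eq_zero, ← map_sub, toZ_zero]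
  lt := fun m x => ZMod.val_lt _
end padic
end VM

open MeasureTheory Finset
open scoped Classical

set_option linter.all false
namespace VM
section counts

/-- number of coincidences -/
noncomputable def cnt {ι β : Type} (U : Finset ι) (φ : ι → β) : ℕ :=
  #{uv ∈ U ×ˢ U | φ uv.1 = φ uv.2}

lemma cnt_eq {ι β : Type} (U : Finset ι) (φ : ι → β) :
    (cnt U φ : ℝ) = ∑ u ∈ U, ∑ v ∈ U, if φ u = φ v then (1 : ℝ) else 0 := by
  unfold cnt
  rw [Finset.card_filter, Finset.sum_product]
  push_cast
  rfl

lemma cnt_eq2 {ι β : Type} [DecidableEq β] (U : Finset ι) (φ : ι → β) :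
    (cnt U φ : ℝ) = ∑ b ∈ U.image φ, (#{u ∈ U | φ u = b} : ℝ) ^ 2 := by
  rw [cnt_eq]
  have h : ∀ b, (#{u ∈ U | φ u = b} : ℝ) = ∑ u ∈ U, if φ u = b then (1 : ℝ) else 0 := by
    intro b; rw [Finset.card_filter]; push_cast; rfl
  simp only [h, sq, Finset.sum_mul_sum]
  conv_rhs => rw [Finset.sum_comm]
  refine Finset.sum_congr rfl fun u hu => ?_
  conv_rhs => rw [Finset.sum_comm]
  refine Finset.sum_congr rfl fun v hv => ?_
  rw [Finset.sum_eq_single (φ v)]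
  · by_cases h : φ u = φ v <;> simp [h]
  · intro b _ hb; simp [Ne.symm hb]
  · intro h; exact absurd (Finset.mem_image_of_mem φ hv) h

lemma cnt_cs {ι α β : Type} [DecidableEq α] [DecidableEq β] (U : Finset ι) (φ : ι → α) (ψ : ι → β) :
    (cnt U ψ : ℝ) ≤ #(U.image φ) * (cnt U (fun u => (φ u, ψ u)) : ℝ) := by
  rw [cnt_eq2 U ψ]
  have h1 : ∀ b ∈ U.image ψ, (#{u ∈ U | ψ u = b} : ℝ) ^ 2 ≤
      #(U.image φ) * ∑ a ∈ U.image φ, (#{u ∈ U | φ u = a ∧ ψ u = b} : ℝ) ^ 2 := by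
    intro b _
    have : (#{u ∈ U | ψ u = b} : ℝ) = ∑ a ∈ U.image φ, (#{u ∈ U | φ u = a ∧ ψ u = b} : ℝ) := by
      have h2 := Finset.card_eq_sum_card_fiberwise (f := φ) (s := {u ∈ U | ψ u = b}) (t := U.image φ)
        (fun u hu => by
          have hu' : u ∈ U.filter (fun u => ψ u = b) := hu
          exact Finset.mem_coe.2 (Finset.mem_image_of_mem φ (Finset.mem_filter.1 hu').1))
      rw [h2]
      push_cast
      refine Finset.sum_congr rfl fun a _ => ?_
      rw [Finset.filter_filter]
      congr 2
      ext u; simp [and_comm]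
    rw [this]
    exact sq_sum_le_card_mul_sum_sq
  refine (Finset.sum_le_sum h1).trans ?_
  rw [← Finset.mul_sum, Finset.sum_comm]
  refine mul_le_mul_of_nonneg_left (le_of_eq ?_) (Nat.cast_nonneg _)
  rw [cnt_eq2, ← Finset.sum_product']
  symm
  have hsub : U.image (fun u => (φ u, ψ u)) ⊆ U.image φ ×ˢ U.image ψ := by
    intro x hx
    obtain ⟨u, hu, rfl⟩ := Finset.mem_image.1 hx
    exact Finset.mem_product.2 ⟨Finset.mem_image_of_mem _ hu, Finset.mem_image_of_mem _ hu⟩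
  rw [← Finset.sum_subset hsub]
  · refine Finset.sum_congr rfl fun x _ => ?_
    congr 3
    ext u
    simp [Prod.ext_iff]
  · intro x _ hx
    have : U.filter (fun u => φ u = x.1 ∧ ψ u = x.2) = ∅ := by
      rw [Finset.filter_eq_empty_iff]
      rintro u hu ⟨h1, h2⟩
      exact hx (Finset.mem_image.2 ⟨u, hu, Prod.ext h1 h2⟩)
    rw [this]; simp

lemma cnt_le {ι α β : Type} {U V : Finset ι} (hUV : U ⊆ V) (φ : ι → α) (ψ : ι → β)
    (h : ∀ u ∈ U, ∀ v ∈ U, φ u = φ v → ψ u = ψ v) : cnt U φ ≤ cnt V ψ := by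
  unfold cnt
  apply Finset.card_le_card
  intro x hx
  simp only [Finset.mem_filter, Finset.mem_product] at *
  exact ⟨⟨hUV hx.1.1, hUV hx.1.2⟩, h _ hx.1.1 _ hx.1.2 hx.2⟩

lemma cnt_char {Γ : Type} [AddCommGroup Γ] {G : Type} [Fintype G] {e : Γ → G → ℂ} (he : CharSys e)
    {ι : Type} (U : Finset ι) (ξ : ι → Γ) :
    ∑ g, ‖∑ u ∈ U, e (ξ u) g‖ ^ 2 = (Fintype.card G : ℝ) * cnt U ξ := by
  have : ((∑ g, ‖∑ u ∈ U, e (ξ u) g‖ ^ 2 : ℝ) : ℂ) = (((Fintype.card G : ℝ) * cnt U ξ : ℝ) : ℂ) := by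
    rw [cnt_eq]
    push_cast
    have h1 : ∀ g, ((‖∑ u ∈ U, e (ξ u) g‖ : ℂ)) ^ 2 = ∑ u ∈ U, ∑ v ∈ U, e (ξ u - ξ v) g := by
      intro g
      rw [← Complex.mul_conj', map_sum, Finset.sum_mul_sum]
      refine Finset.sum_congr rfl fun u _ => Finset.sum_congr rfl fun v _ => ?_
      rw [he.conj, ← he.add, sub_eq_add_neg]
    simp only [h1]
    rw [Finset.sum_comm, Finset.mul_sum]
    refine Finset.sum_congr rfl fun u _ => ?_
    rw [Finset.sum_comm, Finset.mul_sum]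
    refine Finset.sum_congr rfl fun v _ => ?_
    by_cases h : ξ u = ξ v
    · simp [h, he.zero]
    · simp [h, he.orth _ (sub_ne_zero.2 h)]
  exact_mod_cast this

/-- tuples -/
def tup (s : ℕ) (A : Finset ℕ) : Finset (Fin s → ℕ) := Fintype.piFinset fun _ => A

lemma mem_tup {s : ℕ} {A : Finset ℕ} {u : Fin s → ℕ} : u ∈ tup s A ↔ ∀ i, u i ∈ A := by
  simp [tup]

lemma tup_pow {s : ℕ} (A : Finset ℕ) (f : ℕ → ℂ) :
    (∑ x ∈ A, f x) ^ s = ∑ u ∈ tup s A, ∏ i, f (u i) := by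
  have := Finset.prod_univ_sum (fun _ : Fin s => A) (fun _ x => f x)
  simpa [tup] using this

/-- number of solutions -/
noncomputable def NN (k s : ℕ) (A : Finset ℕ) : ℕ := cnt (tup s A) (fun u => ∑ i, (u i) ^ k)

lemma NN_mono (k s : ℕ) {A B : Finset ℕ} (h : A ⊆ B) : NN k s A ≤ NN k s B := by
  refine cnt_le ?_ _ _ fun _ _ _ _ => id
  intro u hu
  rw [mem_tup] at *
  exact fun i => h (hu i)

lemma char_sum_prod {Γ : Type} [AddCommGroup Γ] {G : Type} [Fintype G] {e : Γ → G → ℂ} (he : CharSys e)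
    {ι : Type} (s : Finset ι) (ξ : ι → Γ) (g : G) : e (∑ i ∈ s, ξ i) g = ∏ i ∈ s, e (ξ i) g := by
  induction s using Finset.induction_on with
  | empty => simp [he.zero]
  | insert a s ha ih => rw [Finset.sum_insert ha, Finset.prod_insert ha, he.add, ih]

lemma moment_char {Γ : Type} [AddCommGroup Γ] {G : Type} [Fintype G] {e : Γ → G → ℂ} (he : CharSys e)
    (A : Finset ℕ) (ξ : ℕ → Γ) (s : ℕ) :
    ∑ g, (‖∑ x ∈ A, e (ξ x) g‖ ^ 2) ^ s =
      (Fintype.card G : ℝ) * cnt (tup s A) (fun u => ∑ i, ξ (u i)) := by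
  rw [← cnt_char he]
  refine Finset.sum_congr rfl fun g _ => ?_
  rw [← pow_mul, mul_comm 2 s, pow_mul, ← norm_pow, tup_pow]
  simp only [char_sum_prod he]
end counts

section vmvt
variable {p : ℕ} [hp : Fact p.Prime] {j k : ℕ}

lemma ee_norm (M : ℕ) (ξ : Gm p M j) (g) : ‖ee p M j ξ g‖ = 1 := AddChar.norm_apply _ _

lemma class_bound (hj : 1 ≤ j) (hjk : j ≤ k) (hkp : k < p) {N M : ℕ} (hM : M = (N + 1) * j) {Cd : ℝ}
    (hCd : 0 ≤ Cd) (hD : DecU (p : ℤ_[p]) j N Cd) {Q : ℕ} (hQ : Q < p ^ (N + 1)) (A : Finset ℕ)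
    (hA : A ⊆ Icc 1 Q) (c : ℕ) (hc : ∀ x ∈ A, x % p = c) (hc0 : ¬ p ∣ c) :
    ∑ g, (‖∑ x ∈ A, ee p M j (DD p M j k 0 (x : ℤ_[p])) g‖ ^ 2) ^ tri j ≤
      (Cd * Q) ^ tri j * Fintype.card (Fin j → ZMod (p ^ M)) := by
  have hT : 1 ≤ tri j := tri_pos hj
  have hcu : IsUnit (c : ℤ_[p]) := by
    rw [PadicInt.isUnit_iff, PadicInt.norm_natCast_eq_one_iff]
    exact (Nat.Prime.coprime_iff_not_dvd hp.out).2 hc0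
  have hw : ∀ g : Fin j → ZMod (p ^ M), (0 : ℝ) ≤ (fun _ => (1 : ℝ)) g := fun _ => zero_le_one
  have hx : ∀ x ∈ A, (c : ℤ_[p]) + (p : ℤ_[p]) ^ 1 * ((x / p : ℕ) : ℤ_[p]) = x := by
    intro x hx
    rw [← hc x hx, pow_one]
    exact_mod_cast Nat.mod_add_div x p
  have hD0 : ∀ x ∈ A, rst (p : ℤ_[p]) (DD p M j k) 1 (c : ℤ_[p]) 0 ((x / p : ℕ) : ℤ_[p])
      = DD p M j k 0 (x : ℤ_[p]) := by
    intro x hxA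
    unfold rst
    rw [hx x hxA]; simp
  have hFam : Fam (p : ℤ_[p]) (ee p M j) j N (rst (p : ℤ_[p]) (DD p M j k) 1 (c : ℤ_[p])) k ⊥
      (fun _ => (1 : ℝ)) A (fun x => ((x / p : ℕ) : ℤ_[p])) (fun x => ee p M j (DD p M j k 0 (x : ℤ_[p]))) :=
    { sys := curve_sys hj hjk hkp hcu hM
      wpos := hw
      wsp := by
        have : (fun g : Fin j → ZMod (p ^ M) => (((1 : ℝ)) : ℂ)) = ee p M j 0 := by
          funext g; rw [(ee_char p M j).zero]; simp
        rw [this]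
        exact mem_Sp (by simp)
      sep := by
        intro x hxA y hyA hxy hdvd
        apply hxy
        have hlt : ∀ z ∈ A, z / p < p ^ N := by
          intro z hz
          have := hA hz
          simp at this
          apply Nat.div_lt_of_lt_mul
          rw [← pow_succ']; omega
        have h1 : x / p ≡ y / p [MOD p ^ N] := by
          have h2 := (toZ_zero N _).2 hdvd
          rw [map_sub, sub_eq_zero, map_natCast, map_natCast] at h2
          exact (ZMod.natCast_eq_natCast_iff _ _ _).1 h2
        have h2 : x / p = y / p := Nat.ModEq.eq_of_lt_of_lt h1 (hlt x hxA) (hlt y hyA)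
        rw [← Nat.mod_add_div x p, ← Nat.mod_add_div y p, hc x hxA, hc y hyA, h2]
      fsp := by
        intro x hxA
        apply mem_Sp
        rw [hD0 x hxA, sub_self]
        exact Submodule.zero_mem _ }
  have h1 := hD _ _ _ (ee_char p M j) _ _ _ _ _ _ _ hFam
  set L := Ls (fun _ : Fin j → ZMod (p ^ M) => (1 : ℝ)) (tri j) (fun _ => 1) with hL
  have hLp : L ^ tri j = Fintype.card (Fin j → ZMod (p ^ M)) := by
    rw [hL, Ls_pow hT hw (fun _ => zero_le_one)]; simp
  have h2 : ∀ x : ℕ, nrm (fun _ => (1 : ℝ)) (tri j) (ee p M j (DD p M j k 0 (x : ℤ_[p]))) = L := by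
    intro x
    unfold nrm
    simp only [ee_norm]
    simp [hL]
  simp only [h2, Finset.sum_const, nsmul_eq_mul] at h1
  have h3 : (A.card : ℝ) ≤ Q := by
    have := Finset.card_le_card hA
    simp at this
    exact_mod_cast this
  have hL0 : 0 ≤ L := by rw [← h2 0]; exact nrm_nonneg hw _
  have h4 := nrm_pow hT hw (fun g => ∑ x ∈ A, ee p M j (DD p M j k 0 (x : ℤ_[p])) g)
  simp only [one_mul] at h4
  rw [← h4, ← hLp, ← mul_pow]
  refine pow_le_pow_left₀ (nrm_nonneg hw _) (h1.trans ?_) _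
  rw [mul_assoc]
  exact mul_le_mul_of_nonneg_left (mul_le_mul_of_nonneg_right h3 hL0) hCd

lemma full_bound (hj : 1 ≤ j) (hjk : j ≤ k) (hkp : k < p) {N M : ℕ} (hM : M = (N + 1) * j) {Cd : ℝ}
    (hCd : 0 ≤ Cd) (hD : DecU (p : ℤ_[p]) j N Cd) {Q : ℕ} (hQ : Q < p ^ (N + 1)) (A : Finset ℕ)
    (hA : A ⊆ Icc 1 Q) (hAp : ∀ x ∈ A, ¬ p ∣ x) :
    (cnt (tup (tri j) A) (fun u => ∑ i, DD p M j k 0 ((u i : ℕ) : ℤ_[p])) : ℝ) ≤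
      (p : ℝ) ^ (2 * tri j + 1) * (Cd * Q) ^ tri j := by
  have hT : 1 ≤ tri j := tri_pos hj
  have hm := moment_char (ee_char p M j) A (fun x : ℕ => DD p M j k 0 (x : ℤ_[p])) (tri j)
  set V : ℝ := ((Fintype.card (Fin j → ZMod (p ^ M)) : ℕ) : ℝ) with hV
  have hV0 : 0 < V := by rw [hV]; exact_mod_cast Fintype.card_pos
  have h1 : ∀ g, ∑ x ∈ A, ee p M j (DD p M j k 0 (x : ℤ_[p])) g =
      ∑ c ∈ range p, ∑ x ∈ A.filter (fun x => x % p = c), ee p M j (DD p M j k 0 (x : ℤ_[p])) g := by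
    intro g
    symm
    exact Finset.sum_fiberwise_of_maps_to (fun x _ => by simp; exact Nat.mod_lt _ hp.out.pos) _
  have h2 : ∀ c ∈ range p, ∑ g, (‖∑ x ∈ A.filter (fun x => x % p = c),
      ee p M j (DD p M j k 0 (x : ℤ_[p])) g‖ ^ 2) ^ tri j ≤ (Cd * Q) ^ tri j * V := by
    intro c hc
    simp at hc
    by_cases hc0 : c = 0
    · have : A.filter (fun x => x % p = c) = ∅ := by
        rw [Finset.filter_eq_empty_iff]
        intro x hx h
        exact hAp x hx (Nat.dvd_of_mod_eq_zero (h.trans hc0))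
      rw [this]
      simp [show tri j ≠ 0 by omega]
      positivity
    · exact class_bound hj hjk hkp hM hCd hD hQ _ ((Finset.filter_subset _ _).trans hA) c
        (fun x hx => (Finset.mem_filter.1 hx).2) (fun h => absurd (Nat.le_of_dvd (by omega) h) (by omega))
  have h3 : ∑ g, (‖∑ x ∈ A, ee p M j (DD p M j k 0 (x : ℤ_[p])) g‖ ^ 2) ^ tri j ≤
      (p : ℝ) ^ (2 * tri j) * ((p : ℝ) * ((Cd * Q) ^ tri j * V)) := by
    calc _ ≤ ∑ g, (p : ℝ) ^ (2 * tri j) * ∑ c ∈ range p, (‖∑ x ∈ A.filter (fun x => x % p = c),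
        ee p M j (DD p M j k 0 (x : ℤ_[p])) g‖ ^ 2) ^ tri j := by
          refine Finset.sum_le_sum fun g _ => ?_
          rw [h1 g]
          have := norm_sum_pow (range p) (fun c => ∑ x ∈ A.filter (fun x => x % p = c),
            ee p M j (DD p M j k 0 (x : ℤ_[p])) g) hT
          rwa [Finset.card_range] at this
      _ = (p : ℝ) ^ (2 * tri j) * ∑ c ∈ range p, ∑ g, (‖∑ x ∈ A.filter (fun x => x % p = c),
        ee p M j (DD p M j k 0 (x : ℤ_[p])) g‖ ^ 2) ^ tri j := by
          rw [← Finset.mul_sum, Finset.sum_comm]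
      _ ≤ _ := by
          refine mul_le_mul_of_nonneg_left ?_ (by positivity)
          refine (Finset.sum_le_sum h2).trans ?_
          simp
  rw [hm] at h3
  have h4 : V * (cnt (tup (tri j) A) (fun u => ∑ i, DD p M j k 0 ((u i : ℕ) : ℤ_[p])) : ℝ) ≤
      V * ((p : ℝ) ^ (2 * tri j + 1) * (Cd * Q) ^ tri j) := by
    refine h3.trans (le_of_eq ?_)
    rw [pow_succ]; ring
  exact le_of_mul_le_mul_left h4 hV0

lemma DD_zero_nat (M : ℕ) (x : ℕ) (a : Fin j) :
    DD p M j k 0 (x : ℤ_[p]) a = ((x ^ mu j k a : ℕ) : ZMod (p ^ M)) := by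
  unfold DD
  simp

theorem vmvt (hj : 1 ≤ j) (hjk : j ≤ k) (hkp : k < p) {ε : ℝ} (hε : 0 < ε) :
    ∃ C : ℝ, 1 ≤ C ∧ ∀ Q : ℕ, 1 ≤ Q → ∀ A ⊆ Icc 1 Q, (∀ x ∈ A, ¬ p ∣ x) →
      (NN k (tri j) A : ℝ) ≤ C * (Q : ℝ) ^ ((j : ℝ) ^ 2 + ε) := by
  have hT : 1 ≤ tri j := tri_pos hj
  have hT0 : (0 : ℝ) < tri j := by exact_mod_cast hT
  have hp1 : (1 : ℝ) < p := by exact_mod_cast hp.out.one_lt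
  obtain ⟨C, hC, hD⟩ := EE_zero (padic_amb (p := p) hkp) hp1 j hj hjk (ε / tri j) (by positivity)
  refine ⟨((tri j : ℝ) + 1) ^ (j - 1) * ((p : ℝ) ^ (2 * tri j + 1) * C ^ tri j), ?_, ?_⟩
  · have h1 : (1 : ℝ) ≤ ((tri j : ℝ) + 1) ^ (j - 1) := one_le_pow₀ (by linarith)
    have h2 : (1 : ℝ) ≤ (p : ℝ) ^ (2 * tri j + 1) := one_le_pow₀ hp1.le
    have h3 : (1 : ℝ) ≤ C ^ tri j := one_le_pow₀ hC
    exact one_le_mul_of_one_le_of_one_le h1 (one_le_mul_of_one_le_of_one_le h2 h3)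
  intro Q hQ A hA hAp
  have hQ1 : (1 : ℝ) ≤ Q := by exact_mod_cast hQ
  have hQ0 : (0 : ℝ) < Q := by linarith
  set N := Nat.log p Q with hN
  have hN1 : p ^ N ≤ Q := Nat.pow_log_le_self p (by omega)
  have hN2 : Q < p ^ (N + 1) := Nat.lt_pow_succ_log_self hp.out.one_lt Q
  have hCd : C * (p : ℝ) ^ ((0 + ε / tri j) * N) ≤ C * (Q : ℝ) ^ (ε / tri j) := by
    refine mul_le_mul_of_nonneg_left ?_ (by linarith)
    rw [zero_add, mul_comm, Real.rpow_mul (by linarith), Real.rpow_natCast]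
    exact Real.rpow_le_rpow (by positivity) (by exact_mod_cast hN1) (by positivity)
  have h1 := full_bound hj hjk hkp (M := (N + 1) * j) rfl (by positivity)
    (hD N) hN2 A hA hAp
  set M := (N + 1) * j with hM
  set φ : (Fin (tri j) → ℕ) → (Fin (j - 1) → ℕ) := fun u m => ∑ i, (u i) ^ ((m : ℕ) + 1) with hφ
  have h2 := cnt_cs (tup (tri j) A) φ (fun u => ∑ i, (u i) ^ k)
  have h3 : cnt (tup (tri j) A) (fun u => (φ u, ∑ i, (u i) ^ k)) ≤
      cnt (tup (tri j) A) (fun u => ∑ i, DD p M j k 0 ((u i : ℕ) : ℤ_[p])) := by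
    refine cnt_le (subset_refl _) _ _ fun u _ v _ huv => ?_
    simp only [Prod.mk.injEq] at huv
    obtain ⟨hu1, hu2⟩ := huv
    funext a
    rw [gsum_apply, gsum_apply]
    simp only [DD_zero_nat]
    rw [← Nat.cast_sum, ← Nat.cast_sum]
    congr 1
    unfold mu
    split_ifs with h
    · exact congrFun hu1 ⟨a, by omega⟩
    · exact hu2
  have h4 : (#((tup (tri j) A).image φ) : ℝ) ≤ ((tri j : ℝ) + 1) ^ (j - 1) * (Q : ℝ) ^ (tri (j - 1)) := by
    have h5 : (tup (tri j) A).image φ ⊆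
        Fintype.piFinset fun m : Fin (j - 1) => range (tri j * Q ^ ((m : ℕ) + 1) + 1) := by
      intro y hy
      obtain ⟨u, hu, rfl⟩ := Finset.mem_image.1 hy
      rw [mem_tup] at hu
      rw [Fintype.mem_piFinset]
      intro m
      rw [Finset.mem_range, Nat.lt_succ_iff]
      calc ∑ i, (u i) ^ ((m : ℕ) + 1) ≤ ∑ i : Fin (tri j), Q ^ ((m : ℕ) + 1) := by
            refine Finset.sum_le_sum fun i _ => Nat.pow_le_pow_left ?_ _
            have := hA (hu i)
            simp at this; omega
        _ = _ := by simp
    have h6 := Finset.card_le_card h5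
    rw [Fintype.card_piFinset] at h6
    simp only [Finset.card_range] at h6
    have h7 : ∏ m : Fin (j - 1), (tri j * Q ^ ((m : ℕ) + 1) + 1) ≤
        ∏ m : Fin (j - 1), ((tri j + 1) * Q ^ ((m : ℕ) + 1)) := by
      refine Finset.prod_le_prod' fun m _ => ?_
      have : 1 ≤ Q ^ ((m : ℕ) + 1) := Nat.one_le_pow _ _ hQ
      rw [add_mul]; omega
    have h8 : ∏ m : Fin (j - 1), ((tri j + 1) * Q ^ ((m : ℕ) + 1)) =
        (tri j + 1) ^ (j - 1) * Q ^ tri (j - 1) := by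
      rw [Finset.prod_mul_distrib, Finset.prod_pow_eq_pow_sum]
      congr 1
      · simp
      · congr 1
        rw [Fin.sum_univ_eq_sum_range (fun m => m + 1)]
        have h9 := Finset.sum_range_id_mul_two (j - 1 + 1)
        rw [Finset.sum_range_succ'] at h9
        have h10 := two_tri (j - 1)
        simp at h9 h10
        rw [mul_comm (j - 1 + 1)] at h9
        omega
    calc (#((tup (tri j) A).image φ) : ℝ) ≤ ((((tri j + 1) ^ (j - 1) * Q ^ tri (j - 1) : ℕ)) : ℝ) := by
          exact_mod_cast h6.trans (h7.trans h8.le)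
      _ = _ := by push_cast; ring
  have h5 : (cnt (tup (tri j) A) (fun u => (φ u, ∑ i, (u i) ^ k)) : ℝ) ≤
      (p : ℝ) ^ (2 * tri j + 1) * (C * (Q : ℝ) ^ (ε / tri j) * Q) ^ tri j := by
    refine (Nat.cast_le.2 h3).trans (h1.trans ?_)
    refine mul_le_mul_of_nonneg_left (pow_le_pow_left₀ (by positivity) ?_ _) (by positivity)
    exact mul_le_mul_of_nonneg_right hCd hQ0.le
  unfold NN
  refine h2.trans ((mul_le_mul h4 h5 (Nat.cast_nonneg _) (by positivity)).trans (le_of_eq ?_))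
  have e1 : (C * (Q : ℝ) ^ (ε / tri j) * Q) ^ tri j = C ^ tri j * (Q : ℝ) ^ (ε + tri j) := by
    rw [mul_pow, mul_pow, ← Real.rpow_natCast ((Q : ℝ) ^ (ε / tri j)), ← Real.rpow_mul hQ0.le,
      div_mul_cancel₀ _ hT0.ne', Real.rpow_add hQ0, Real.rpow_natCast, mul_assoc]
  have e2 : (Q : ℝ) ^ ((j : ℝ) ^ 2 + ε) = (Q : ℝ) ^ tri (j - 1) * (Q : ℝ) ^ (ε + tri j) := by
    rw [← Real.rpow_natCast (Q : ℝ) (tri (j - 1)), ← Real.rpow_add hQ0]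
    congr 1
    have t1 := two_tri j
    have t2 := two_tri (j - 1)
    obtain ⟨i, rfl⟩ := Nat.exists_eq_add_of_le' hj
    simp only [Nat.add_sub_cancel] at *
    have t1' : (2 : ℝ) * tri (i + 1) = ((i : ℝ) + 1) * (i + 1 + 1) := by exact_mod_cast t1
    have t2' : (2 : ℝ) * tri i = (i : ℝ) * (i + 1) := by exact_mod_cast t2
    push_cast
    linarith
  rw [e1, e2]
  ring
end vmvt
end VM

open MeasureTheory Finset
open scoped Classical

set_option linter.all false
namespace VM
section divisor

lemma add_one_le_K {ε : ℝ} (hε : 0 < ε) : ∃ K : ℝ, 1 ≤ K ∧ ∀ v : ℕ, (v : ℝ) + 1 ≤ K * (2 : ℝ) ^ (ε * v) := by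
  have hl : 0 < Real.log 2 := Real.log_pos (by norm_num)
  refine ⟨max 1 (1 / (ε * Real.log 2)), le_max_left _ _, fun v => ?_⟩
  have h1 : 1 + ε * v * Real.log 2 ≤ (2 : ℝ) ^ (ε * v) := by
    rw [Real.rpow_def_of_pos (by norm_num)]
    have := Real.add_one_le_exp (Real.log 2 * (ε * v))
    linarith
  have h2 : (1 : ℝ) ≤ max 1 (1 / (ε * Real.log 2)) := le_max_left _ _
  have h3 : 1 / (ε * Real.log 2) ≤ max 1 (1 / (ε * Real.log 2)) := le_max_right _ _
  set K := max 1 (1 / (ε * Real.log 2))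
  have h4 : 1 ≤ K * (ε * Real.log 2) := by
    rwa [div_le_iff₀ (by positivity)] at h3
  have hv : (0 : ℝ) ≤ v := Nat.cast_nonneg v
  have h5 : K * (1 + ε * v * Real.log 2) ≤ K * (2 : ℝ) ^ (ε * v) :=
    mul_le_mul_of_nonneg_left h1 (by linarith)
  nlinarith [mul_le_mul_of_nonneg_left h4 hv]

theorem divisor_bound {ε : ℝ} (hε : 0 < ε) :
    ∃ C : ℝ, 1 ≤ C ∧ ∀ n : ℕ, n ≠ 0 → (#n.divisors : ℝ) ≤ C * (n : ℝ) ^ ε := by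
  obtain ⟨K, hK, hKv⟩ := add_one_le_K hε
  obtain ⟨B, hB⟩ := exists_nat_ge ((2 : ℝ) ^ (1 / ε))
  refine ⟨K ^ B, one_le_pow₀ hK, fun n hn => ?_⟩
  rw [Nat.card_divisors hn]
  push_cast
  have h1 : (n : ℝ) ^ ε = ∏ p ∈ n.primeFactors, ((p : ℝ) ^ (ε * n.factorization p)) := by
    conv_lhs => rw [← Nat.factorization_prod_pow_eq_self hn]
    rw [Finsupp.prod, Nat.support_factorization]
    push_cast
    rw [← Real.finsetProd_rpow _ _ (fun i _ => by positivity)]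
    refine Finset.prod_congr rfl fun p _ => ?_
    rw [mul_comm, Real.rpow_mul (by positivity), Real.rpow_natCast]
  have h2 : ∏ p ∈ n.primeFactors, (if p < B then K else 1) ≤ K ^ B := by
    rw [Finset.prod_ite, Finset.prod_const, Finset.prod_const_one, mul_one]
    refine pow_le_pow_right₀ hK ?_
    calc _ ≤ #(range B) := Finset.card_le_card (fun p hp => by simp at *; exact hp.2)
      _ = B := Finset.card_range B
  rw [h1]
  refine le_trans ?_ (mul_le_mul_of_nonneg_right h2 (Finset.prod_nonneg fun p _ => by positivity))
  rw [← Finset.prod_mul_distrib]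
  refine Finset.prod_le_prod (fun p _ => by positivity) fun p hp => ?_
  have hp2 : 2 ≤ p := (Nat.prime_of_mem_primeFactors hp).two_le
  set v := n.factorization p
  have hpos : (2 : ℝ) ^ (ε * v) ≤ (p : ℝ) ^ (ε * v) :=
    Real.rpow_le_rpow (by norm_num) (by exact_mod_cast hp2) (by positivity)
  split_ifs with h
  · exact (hKv v).trans (mul_le_mul_of_nonneg_left hpos (by linarith))
  · push Not at h
    rw [one_mul]
    have h3 : (2 : ℝ) ^ (v : ℝ) ≤ (p : ℝ) ^ (ε * v) := by
      have h4 : (2 : ℝ) ^ (1 / ε) ≤ p := hB.trans (by exact_mod_cast h)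
      calc (2 : ℝ) ^ (v : ℝ) = ((2 : ℝ) ^ (1 / ε)) ^ (ε * v) := by
            rw [← Real.rpow_mul (by norm_num)]; congr 1; field_simp
        _ ≤ _ := Real.rpow_le_rpow (by positivity) h4 (by positivity)
    refine le_trans ?_ h3
    rw [Real.rpow_natCast]
    exact_mod_cast Nat.lt_two_pow_self
end divisor

section weyl

/-- difference -/
def dl (h : ℤ) (f : ℤ → ℤ) : ℤ → ℤ := fun x => f (x + h) - f x

/-- restricted set -/
noncomputable def rs (h : ℤ) (I : Finset ℤ) : Finset ℤ := I.filter fun x => x + h ∈ I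

/-- the multiset of values of iterated differences -/
noncomputable def WW (Q : ℕ) : ℕ → (ℤ → ℤ) → Finset ℤ → Multiset ℤ
  | 0, f, I => I.val.map f
  | j + 1, f, I => (Ioo (-(Q : ℤ)) Q).val.bind fun h => WW Q j (dl h f) (rs h I)

lemma WW_sum (Q j : ℕ) (f : ℤ → ℤ) (I : Finset ℤ) (F : ℤ → ℝ) :
    ((WW Q (j + 1) f I).map F).sum = ∑ h ∈ Ioo (-(Q : ℤ)) Q, ((WW Q j (dl h f) (rs h I)).map F).sum := by
  simp only [WW, Multiset.map_bind, Multiset.sum_bind]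
  rfl

lemma WW_count (Q j : ℕ) (f : ℤ → ℤ) (I : Finset ℤ) (v : ℤ) :
    (WW Q (j + 1) f I).count v = ∑ h ∈ Ioo (-(Q : ℤ)) Q, (WW Q j (dl h f) (rs h I)).count v := by
  simp only [WW, Multiset.count_bind]
  rfl

lemma WW_mem (Q j : ℕ) (f : ℤ → ℤ) (I : Finset ℤ) (v : ℤ) :
    v ∈ WW Q (j + 1) f I ↔ ∃ h ∈ Ioo (-(Q : ℤ)) Q, v ∈ WW Q j (dl h f) (rs h I) := by
  simp only [WW, Multiset.mem_bind]
  rfl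

lemma rs_sub (h : ℤ) (I : Finset ℤ) : rs h I ⊆ I := Finset.filter_subset _ _

lemma card_Ioo_le (Q : ℕ) : #(Ioo (-(Q : ℤ)) Q) ≤ 2 * Q := by
  rw [Int.card_Ioo]; omega

lemma weyl_one (Q : ℕ) {χ : ℤ → ℂ} (hadd : ∀ a b, χ (a + b) = χ a * χ b)
    (hconj : ∀ a, (starRingEnd ℂ) (χ a) = χ (-a)) (f : ℤ → ℤ) {I : Finset ℤ}
    (hI : I ⊆ Icc 1 (Q : ℤ)) :
    ‖∑ x ∈ I, χ (f x)‖ ^ 2 = ((WW Q 1 f I).map fun v => (χ v).re).sum := by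
  rw [WW_sum]
  have h1 : ((‖∑ x ∈ I, χ (f x)‖ ^ 2 : ℝ) : ℂ) = ∑ x ∈ I, ∑ y ∈ I, χ (f y - f x) := by
    push_cast
    rw [← Complex.conj_mul', map_sum, Finset.sum_mul_sum]
    refine Finset.sum_congr rfl fun u _ => Finset.sum_congr rfl fun v _ => ?_
    rw [hconj, ← hadd]; congr 1; ring
  have h2 : ∑ x ∈ I, ∑ y ∈ I, χ (f y - f x) =
      ∑ x ∈ I, ∑ h ∈ Ioo (-(Q : ℤ)) Q, if x + h ∈ I then χ (f (x + h) - f x) else 0 := by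
    refine Finset.sum_congr rfl fun x hx => ?_
    rw [← Finset.sum_filter]
    have hx' := hI hx
    simp at hx'
    refine Finset.sum_nbij' (fun y => y - x) (fun h => x + h) ?_ ?_ ?_ ?_ ?_
    · intro y hy
      have hy' := hI hy
      simp at hy' ⊢
      exact ⟨by omega, hy⟩
    · intro h hh; simp at hh; exact hh.2
    · intro y _; ring
    · intro h _; ring
    · intro y _; rw [add_sub_cancel]
  rw [← Complex.ofReal_re (‖∑ x ∈ I, χ (f x)‖ ^ 2), h1, h2, Finset.sum_comm, Complex.re_sum]
  refine Finset.sum_congr rfl fun h _ => ?_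
  rw [← Finset.sum_filter, Complex.re_sum]
  simp only [WW, Multiset.map_map]
  rfl

lemma weyl_ineq (Q : ℕ) {χ : ℤ → ℂ} (hadd : ∀ a b, χ (a + b) = χ a * χ b)
    (hconj : ∀ a, (starRingEnd ℂ) (χ a) = χ (-a)) (j : ℕ) : ∀ (f : ℤ → ℤ) {I : Finset ℤ}
    (hI : I ⊆ Icc 1 (Q : ℤ)),
    ‖∑ x ∈ I, χ (f x)‖ ^ (2 ^ (j + 1)) ≤ (2 * Q : ℝ) ^ (2 ^ (j + 1) - (j + 1) - 1) *
      ((WW Q (j + 1) f I).map fun v => (χ v).re).sum := by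
  induction j with
  | zero =>
    intro f I hI
    simp only [zero_add, pow_one]
    rw [weyl_one Q hadd hconj f hI]; simp
  | succ j ih =>
    intro f I hI
    have h0 : ‖∑ x ∈ I, χ (f x)‖ ^ 2 ≤ ∑ h ∈ Ioo (-(Q : ℤ)) Q, ‖∑ x ∈ rs h I, χ (dl h f x)‖ := by
      rw [weyl_one Q hadd hconj f hI, WW_sum]
      refine Finset.sum_le_sum fun h _ => ?_
      refine le_trans (le_of_eq ?_) (Complex.re_le_norm _)
      rw [Complex.re_sum]
      simp only [WW, Multiset.map_map]
      rfl
    have h1 : ‖∑ x ∈ I, χ (f x)‖ ^ (2 ^ (j + 1 + 1)) ≤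
        (2 * Q : ℝ) ^ (2 ^ (j + 1) - 1) * ∑ h ∈ Ioo (-(Q : ℤ)) Q, ‖∑ x ∈ rs h I, χ (dl h f x)‖ ^ (2 ^ (j + 1)) := by
      have e1 : 2 ^ (j + 1 + 1) = 2 * 2 ^ (j + 1) := by rw [pow_succ]; ring
      rw [e1, pow_mul]
      refine (pow_le_pow_left₀ (by positivity) h0 _).trans ?_
      obtain ⟨m, hm⟩ : ∃ m, 2 ^ (j + 1) = m + 1 := ⟨2 ^ (j + 1) - 1, by
        have : 1 ≤ 2 ^ (j + 1) := Nat.one_le_two_pow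
        omega⟩
      rw [hm, Nat.add_sub_cancel]
      refine (pow_sum_le_card_mul_sum_pow (fun h _ => norm_nonneg _) m).trans ?_
      refine mul_le_mul_of_nonneg_right (pow_le_pow_left₀ (Nat.cast_nonneg _) ?_ _)
        (Finset.sum_nonneg fun h _ => pow_nonneg (norm_nonneg _) _)
      exact_mod_cast card_Ioo_le Q
    refine h1.trans ?_
    rw [WW_sum]
    calc _ ≤ (2 * Q : ℝ) ^ (2 ^ (j + 1) - 1) * ∑ h ∈ Ioo (-(Q : ℤ)) Q,
        (2 * Q : ℝ) ^ (2 ^ (j + 1) - (j + 1) - 1) * ((WW Q (j + 1) (dl h f) (rs h I)).map fun v => (χ v).re).sum := by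
          refine mul_le_mul_of_nonneg_left ?_ (by positivity)
          exact Finset.sum_le_sum fun h _ => ih _ ((rs_sub h I).trans hI)
      _ = _ := by
          rw [← Finset.mul_sum, ← mul_assoc, ← pow_add]
          congr 2
          have e1 : 2 ^ (j + 1 + 1) = 2 * 2 ^ (j + 1) := by rw [pow_succ]; ring
          have : j + 1 < 2 ^ (j + 1) := Nat.lt_two_pow_self
          omega
end weyl
end VM

open MeasureTheory Finset
open scoped Classical

set_option linter.all false
namespace VM
section weylcount
open Polynomial

lemma dl_poly (h : ℤ) (P : ℤ[X]) : dl h (fun x => P.eval x) = fun x => (taylor h P - P).eval x := by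
  funext x
  simp [dl, taylor_eval]

lemma natDegree_dl {P : ℤ[X]} {k : ℕ} (hP : P.natDegree = k + 1) {h : ℤ} (hh : h ≠ 0) :
    (taylor h P - P).natDegree = k := by
  have hlead : P.coeff (k + 1) ≠ 0 := by
    rw [← hP]; exact leadingCoeff_ne_zero.2 (by rintro rfl; simp at hP)
  have hc : ∀ n, k + 1 < n → P.coeff n = 0 := fun n hn => coeff_eq_zero_of_natDegree_lt (by omega)
  apply natDegree_eq_of_le_of_coeff_ne_zero
  · rw [natDegree_le_iff_coeff_eq_zero]
    intro n hn
    rw [coeff_sub]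
    by_cases hn1 : n = k + 1
    · subst hn1
      have h1 := coeff_taylor_natDegree (r := h) (f := P)
      rw [hP] at h1
      rw [h1, leadingCoeff, hP, sub_self]
    · rw [hc n (by omega), coeff_eq_zero_of_natDegree_lt (by rw [natDegree_taylor]; omega), sub_zero]
  · rw [coeff_sub, taylor_coeff]
    have h1 : (hasseDeriv k P).natDegree ≤ 1 := by
      have := natDegree_hasseDeriv_le P k
      omega
    rw [eq_X_add_C_of_natDegree_le_one h1]
    simp only [hasseDeriv_coeff, eval_add, eval_mul, eval_C, eval_X]
    rw [show 1 + k = k + 1 by ring, zero_add, Nat.choose_self, Nat.choose_succ_self_right]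
    push_cast
    rw [one_mul, add_sub_cancel_right]
    have : ((k : ℤ) + 1) ≠ 0 := by omega
    exact mul_ne_zero (mul_ne_zero this hlead) hh

lemma WW_dvd (Q j : ℕ) (d : ℤ) : ∀ (f : ℤ → ℤ) (I : Finset ℤ), (∀ x, d ∣ f x) → ∀ v ∈ WW Q j f I, d ∣ v := by
  induction j with
  | zero =>
    intro f I hf v hv
    simp only [WW, Multiset.mem_map] at hv
    obtain ⟨x, _, rfl⟩ := hv
    exact hf x
  | succ j ih =>
    intro f I hf v hv
    rw [WW_mem] at hv
    obtain ⟨h, _, hv⟩ := hv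
    exact ih _ _ (fun x => dvd_sub (hf _) (hf _)) v hv

lemma WW_bdd (Q j : ℕ) : ∀ (f : ℤ → ℤ) (I : Finset ℤ) (B : ℤ), (∀ x ∈ I, |f x| ≤ B) →
    ∀ v ∈ WW Q j f I, |v| ≤ 2 ^ j * B := by
  induction j with
  | zero =>
    intro f I B hf v hv
    simp only [WW, Multiset.mem_map] at hv
    obtain ⟨x, hx, rfl⟩ := hv
    simpa using hf x hx
  | succ j ih =>
    intro f I B hf v hv
    rw [WW_mem] at hv
    obtain ⟨h, _, hv⟩ := hv
    have := ih (dl h f) (rs h I) (2 * B) (fun x hx => by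
      have hx' := Finset.mem_filter.1 hx
      have h1 := hf x hx'.1
      have h2 := hf _ hx'.2
      unfold dl
      have := abs_sub (f (x + h)) (f x)
      linarith) v hv
    rw [pow_succ]; linarith

lemma WW_card (Q j : ℕ) : ∀ (f : ℤ → ℤ) {I : Finset ℤ}, I ⊆ Icc 1 (Q : ℤ) →
    (WW Q j f I).card ≤ (2 * Q) ^ j * Q := by
  induction j with
  | zero =>
    intro f I hI
    simp only [WW, Multiset.card_map, pow_zero, one_mul]
    have := Finset.card_le_card hI
    simpa using this
  | succ j ih =>
    intro f I hI
    simp only [WW, Multiset.card_bind]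
    change ∑ h ∈ Ioo (-(Q : ℤ)) Q, (WW Q j (dl h f) (rs h I)).card ≤ _
    calc _ ≤ ∑ h ∈ Ioo (-(Q : ℤ)) Q, (2 * Q) ^ j * Q :=
          Finset.sum_le_sum fun h _ => ih _ ((rs_sub h I).trans hI)
      _ = #(Ioo (-(Q : ℤ)) Q) * ((2 * Q) ^ j * Q) := by simp
      _ ≤ 2 * Q * ((2 * Q) ^ j * Q) := Nat.mul_le_mul_right _ (card_Ioo_le Q)
      _ = _ := by ring

lemma roots_count {P : ℤ[X]} (hP : 1 ≤ P.natDegree) (v : ℤ) (I : Finset ℤ) :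
    #{x ∈ I | P.eval x = v} ≤ P.natDegree := by
  have hne : P - C v ≠ 0 := by
    intro h
    have : P = C v := sub_eq_zero.1 h
    rw [this] at hP; simp at hP
  have h1 : I.filter (fun x => P.eval x = v) ⊆ (P - C v).roots.toFinset := by
    intro x hx
    have hx' := (Finset.mem_filter.1 hx).2
    rw [Multiset.mem_toFinset, mem_roots hne]
    simp [hx']
  calc _ ≤ #(P - C v).roots.toFinset := Finset.card_le_card h1
    _ ≤ (P - C v).roots.card := Multiset.toFinset_card_le _
    _ ≤ (P - C v).natDegree := card_roots' _
    _ = _ := natDegree_sub_C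

lemma count_base (Q : ℕ) (P : ℤ[X]) (v : ℤ) (I : Finset ℤ) :
    (WW Q 0 (fun x => P.eval x) I).count v = #{x ∈ I | P.eval x = v} := by
  simp only [WW, Multiset.count_map]
  rw [Finset.card_def, Finset.filter_val]
  congr 2
  funext x
  exact propext eq_comm

lemma count_ne (Q j : ℕ) : ∀ (k : ℕ) (P : ℤ[X]) (I : Finset ℤ) (v : ℤ), P.natDegree = k → j + 1 ≤ k → v ≠ 0 →
    (WW Q j (fun x => P.eval x) I).count v ≤ k * (2 * #v.natAbs.divisors) ^ j := by
  induction j with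
  | zero =>
    intro k P I v hP hk hv
    rw [count_base, pow_zero, mul_one, ← hP]
    exact roots_count (by omega) v I
  | succ j ih =>
    intro k P I v hP hk hv
    obtain ⟨k, rfl⟩ := Nat.exists_eq_add_of_le' (show 1 ≤ k by omega)
    rw [WW_count]
    set Dv : Finset ℤ := (v.natAbs.divisors.image (fun d : ℕ => (d : ℤ))) ∪
      (v.natAbs.divisors.image (fun d : ℕ => -(d : ℤ))) with hDv
    have hcard : #Dv ≤ 2 * #v.natAbs.divisors := by
      refine (Finset.card_union_le _ _).trans ?_
      have h1 := Finset.card_image_le (s := v.natAbs.divisors) (f := fun d : ℕ => (d : ℤ))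
      have h2 := Finset.card_image_le (s := v.natAbs.divisors) (f := fun d : ℕ => -(d : ℤ))
      omega
    have hzero : ∀ h : ℤ, h ∉ Dv → (WW Q j (dl h fun x => P.eval x) (rs h I)).count v = 0 := by
      intro h hh
      rw [Multiset.count_eq_zero]
      intro hmem
      have hd : h ∣ v := WW_dvd Q j h _ _ (fun x => by
        unfold dl
        have := Polynomial.sub_dvd_eval_sub (x + h) x P
        rwa [add_sub_cancel_left] at this) v hmem
      apply hh
      have h1 : h.natAbs ∈ v.natAbs.divisors := by
        rw [Nat.mem_divisors]
        exact ⟨Int.natAbs_dvd_natAbs.2 hd, by simpa using hv⟩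
      rw [hDv, Finset.mem_union, Finset.mem_image, Finset.mem_image]
      rcases Int.natAbs_eq h with h2 | h2
      · left; exact ⟨_, h1, h2.symm⟩
      · right; exact ⟨_, h1, h2.symm⟩
    have hne : ∀ h : ℤ, (WW Q j (dl h fun x => P.eval x) (rs h I)).count v ≤
        if h ∈ Dv then (k + 1) * (2 * #v.natAbs.divisors) ^ j else 0 := by
      intro h
      split_ifs with hh
      · have h0 : h ≠ 0 := by
          rintro rfl
          rw [hDv, Finset.mem_union, Finset.mem_image, Finset.mem_image] at hh
          rcases hh with ⟨d, hd, hd0⟩ | ⟨d, hd, hd0⟩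
          · have := Nat.pos_of_mem_divisors hd; omega
          · have := Nat.pos_of_mem_divisors hd; omega
        rw [dl_poly]
        refine (ih k _ (rs h I) v (natDegree_dl hP h0) (by omega) hv).trans ?_
        exact Nat.mul_le_mul_right _ (by omega)
      · exact (hzero h hh).le
    calc _ ≤ ∑ h ∈ Ioo (-(Q : ℤ)) Q, if h ∈ Dv then (k + 1) * (2 * #v.natAbs.divisors) ^ j else 0 :=
          Finset.sum_le_sum fun h _ => hne h
      _ = #((Ioo (-(Q : ℤ)) Q).filter (· ∈ Dv)) * ((k + 1) * (2 * #v.natAbs.divisors) ^ j) := by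
          rw [← Finset.sum_filter]; simp
      _ ≤ (2 * #v.natAbs.divisors) * ((k + 1) * (2 * #v.natAbs.divisors) ^ j) := by
          refine Nat.mul_le_mul_right _ ((Finset.card_le_card ?_).trans hcard)
          intro x hx; exact (Finset.mem_filter.1 hx).2
      _ = _ := by ring

lemma count_zero (Q : ℕ) (hQ : 1 ≤ Q) (j : ℕ) : ∀ (k : ℕ) (P : ℤ[X]) {I : Finset ℤ}, I ⊆ Icc 1 (Q : ℤ) →
    P.natDegree = k → j + 1 ≤ k →
    (WW Q j (fun x => P.eval x) I).count 0 ≤ (k + j) * 2 ^ j * Q ^ j := by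
  induction j with
  | zero =>
    intro k P I hI hP hk
    rw [count_base]
    simpa [hP] using roots_count (P := P) (by omega) 0 I
  | succ j ih =>
    intro k P I hI hP hk
    obtain ⟨k, rfl⟩ := Nat.exists_eq_add_of_le' (show 1 ≤ k by omega)
    rw [WW_count]
    have hb : ∀ h : ℤ, (WW Q j (dl h fun x => P.eval x) (rs h I)).count 0 ≤
        (k + j) * 2 ^ j * Q ^ j + if h = 0 then (2 * Q) ^ j * Q else 0 := by
      intro h
      split_ifs with hh
      · refine le_trans (Multiset.count_le_card _ _) ?_
        exact (WW_card Q j _ ((rs_sub h I).trans hI)).trans (Nat.le_add_left _ _)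
      · rw [dl_poly]
        exact ih k _ ((rs_sub h I).trans hI) (natDegree_dl hP hh) (by omega)
    calc _ ≤ ∑ h ∈ Ioo (-(Q : ℤ)) Q, ((k + j) * 2 ^ j * Q ^ j + if h = 0 then (2 * Q) ^ j * Q else 0) :=
          Finset.sum_le_sum fun h _ => hb h
      _ ≤ 2 * Q * ((k + j) * 2 ^ j * Q ^ j) + (2 * Q) ^ j * Q := by
          rw [Finset.sum_add_distrib, Finset.sum_const, smul_eq_mul]
          refine Nat.add_le_add (Nat.mul_le_mul_right _ (card_Ioo_le Q)) ?_
          rw [Finset.sum_ite_eq']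
          split_ifs <;> simp
      _ ≤ _ := by
          have : (2 * Q) ^ j * Q ≤ 2 * (2 ^ j * Q ^ j * Q) * 1 := by rw [mul_pow]; omega
          have e : (k + 1 + (j + 1)) * 2 ^ (j + 1) * Q ^ (j + 1) =
            2 * Q * ((k + j) * 2 ^ j * Q ^ j) + 2 * (2 * (2 ^ j * Q ^ j * Q)) := by ring
          rw [e]; omega

/-- summary of coefficient bounds for `x^k` -/
lemma WW_bounds {k j : ℕ} (hjk : j + 1 ≤ k) {ε : ℝ} (hε : 0 < ε) :
    ∃ C : ℝ, 1 ≤ C ∧ ∀ Q : ℕ, 1 ≤ Q →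
      (((WW Q j (fun x => x ^ k) (Icc 1 (Q : ℤ))).count 0 : ℕ) : ℝ) ≤ C * (Q : ℝ) ^ j ∧
      ∀ v : ℤ, v ≠ 0 → (((WW Q j (fun x => x ^ k) (Icc 1 (Q : ℤ))).count v : ℕ) : ℝ) ≤ C * (Q : ℝ) ^ ε := by
  obtain ⟨C, hC, hd⟩ := divisor_bound (show 0 < ε / (k * (j + 1)) by
    have : (0 : ℝ) < k := by exact_mod_cast (by omega : 0 < k)
    positivity)
  set δ := ε / (k * (j + 1)) with hδ
  have hk0 : (0 : ℝ) < k := by exact_mod_cast (by omega : 0 < k)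
  have hδ0 : 0 < δ := by positivity
  set C1 : ℝ := k * (2 * (C * ((2 : ℝ) ^ j) ^ δ)) ^ j with hC1
  refine ⟨max ((k + j) * 2 ^ j) (max 1 C1), le_max_of_le_right (le_max_left _ _), ?_⟩
  intro Q hQ
  have hQ1 : (1 : ℝ) ≤ Q := by exact_mod_cast hQ
  have hX : (fun x : ℤ => x ^ k) = fun x => (X ^ k : ℤ[X]).eval x := by funext x; simp
  constructor
  · rw [hX]
    have h := count_zero Q hQ j k (X ^ k) (subset_refl _) (natDegree_X_pow k) hjk
    have h' : (((WW Q j (fun x => (X ^ k : ℤ[X]).eval x) (Icc 1 (Q : ℤ))).count 0 : ℕ) : ℝ) ≤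
        ((k + j) * 2 ^ j) * (Q : ℝ) ^ j := by exact_mod_cast h
    refine h'.trans (mul_le_mul_of_nonneg_right (le_max_left _ _) (by positivity))
  · intro v hv
    by_cases hmem : v ∈ WW Q j (fun x => x ^ k) (Icc 1 (Q : ℤ))
    · have hb := WW_bdd Q j (fun x => x ^ k) (Icc 1 (Q : ℤ)) ((Q : ℤ) ^ k) (fun x hx => by
        simp at hx
        rw [abs_pow, abs_of_nonneg (by omega)]
        exact pow_le_pow_left₀ (by omega) hx.2 k) v hmem
      have hb2 : (v.natAbs : ℝ) ≤ (2 : ℝ) ^ j * (Q : ℝ) ^ k := by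
        have : ((v.natAbs : ℤ)) ≤ 2 ^ j * (Q : ℤ) ^ k := by rw [Int.natCast_natAbs]; exact hb
        exact_mod_cast this
      rw [hX]
      have h := count_ne Q j k (X ^ k) (Icc 1 (Q : ℤ)) v (natDegree_X_pow k) hjk hv
      have h' : (((WW Q j (fun x => (X ^ k : ℤ[X]).eval x) (Icc 1 (Q : ℤ))).count v : ℕ) : ℝ) ≤
        k * (2 * (#v.natAbs.divisors : ℝ)) ^ j := by exact_mod_cast h
      have h2 : (#v.natAbs.divisors : ℝ) ≤ C * (((2 : ℝ) ^ j) ^ δ * ((Q : ℝ) ^ k) ^ δ) := by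
        refine (hd v.natAbs (by simpa using hv)).trans ?_
        rw [← Real.mul_rpow (by positivity) (by positivity)]
        exact mul_le_mul_of_nonneg_left (Real.rpow_le_rpow (by positivity) hb2 hδ0.le) (by linarith)
      have h3 : (((Q : ℝ) ^ k) ^ δ) ^ j ≤ (Q : ℝ) ^ ε := by
        rw [← Real.rpow_natCast (Q : ℝ) k, ← Real.rpow_mul (by linarith), ← Real.rpow_natCast,
          ← Real.rpow_mul (by linarith)]
        refine Real.rpow_le_rpow_of_exponent_le hQ1 ?_
        rw [hδ]
        have : (k : ℝ) * (ε / (k * (j + 1))) * j = ε * (j / (j + 1)) := by field_simp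
        rw [this]
        have h4 : (j : ℝ) / (j + 1) ≤ 1 := by rw [div_le_one (by positivity)]; linarith
        nlinarith
      have h4 : (k : ℝ) * (2 * (#v.natAbs.divisors : ℝ)) ^ j ≤ C1 * (Q : ℝ) ^ ε := by
        calc _ ≤ (k : ℝ) * (2 * (C * (((2 : ℝ) ^ j) ^ δ * ((Q : ℝ) ^ k) ^ δ))) ^ j := by gcongr
          _ = C1 * (((Q : ℝ) ^ k) ^ δ) ^ j := by
            rw [hC1, mul_assoc, ← mul_pow]; congr 2; ring
          _ ≤ _ := mul_le_mul_of_nonneg_left h3 (by positivity)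
      refine h'.trans (h4.trans (mul_le_mul_of_nonneg_right ?_ (by positivity)))
      exact le_max_of_le_right (le_max_right _ _)
    · rw [Multiset.count_eq_zero.2 hmem]
      have : (0 : ℝ) ≤ max (((k : ℝ) + j) * 2 ^ j) (max 1 C1) :=
        le_max_of_le_right (le_max_of_le_left zero_le_one)
      simp only [Nat.cast_zero]
      exact mul_nonneg this (by positivity)
end weylcount
end VM

open MeasureTheory Finset
open scoped Classical

set_option linter.all false
namespace VM
section gauss
open ProbabilityTheory

/-- gaussian weight -/
noncomputable def Ph (t : ℝ) : ℝ := Real.exp (-(2 * Real.pi ^ 2 * t ^ 2))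

lemma Ph_nonneg (t : ℝ) : 0 ≤ Ph t := (Real.exp_pos _).le
lemma Ph_zero : Ph 0 = 1 := by simp [Ph]
lemma Ph_neg (t : ℝ) : Ph (-t) = Ph t := by simp [Ph]

lemma e_add (x y : ℝ) : e (x + y) = e x * e y := by
  unfold e; rw [← Complex.exp_add]; congr 1; push_cast; ring
lemma e_zero : e 0 = 1 := by simp [e]
lemma e_norm (x : ℝ) : ‖e x‖ = 1 := by
  unfold e
  rw [show (2 * Real.pi * Complex.I * x : ℂ) = ((2 * Real.pi * x : ℝ) : ℂ) * Complex.I by push_cast; ring]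
  exact Complex.norm_exp_ofReal_mul_I _
lemma e_conj (x : ℝ) : starRingEnd ℂ (e x) = e (-x) := by
  unfold e
  rw [← Complex.exp_conj]
  congr 1
  simp only [map_mul, Complex.conj_I, Complex.conj_ofReal, map_ofNat]
  push_cast; ring
lemma e_cont : Continuous e := by unfold e; fun_prop
lemma e_sum {ι : Type} (s : Finset ι) (f : ι → ℝ) : e (∑ i ∈ s, f i) = ∏ i ∈ s, e (f i) := by
  induction s using Finset.induction_on with
  | empty => simp [e_zero]
  | insert a s ha ih => rw [Finset.sum_insert ha, Finset.prod_insert ha, e_add, ih]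

lemma bint {f : ℝ → ℝ} (hf : Continuous f) {C : ℝ} (h : ∀ x, ‖f x‖ ≤ C) (y : ℝ) :
    Integrable f (gaussianReal y 1) :=
  Integrable.of_bound hf.aestronglyMeasurable C (Filter.Eventually.of_forall h)

lemma int_e (θ y : ℝ) : ∫ α, (e (θ * α)).re ∂(gaussianReal y 1) = (e (θ * y)).re * Ph θ := by
  have h := charFun_gaussianReal (μ := y) (v := 1) (2 * Real.pi * θ)
  rw [charFun_apply_real] at h
  have hi : Integrable (fun α => e (θ * α)) (gaussianReal y 1) :=
    Integrable.of_bound (e_cont.comp (continuous_const.mul continuous_id)).aestronglyMeasurable 1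
      (Filter.Eventually.of_forall fun x => (e_norm _).le)
  have h2 : ∫ α, (e (θ * α)).re ∂(gaussianReal y 1) = (∫ α, e (θ * α) ∂(gaussianReal y 1)).re :=
    integral_re (𝕜 := ℂ) hi
  have h3 : ∫ α, e (θ * α) ∂(gaussianReal y 1) = e (θ * y) * (Ph θ : ℂ) := by
    have : ∀ α : ℝ, e (θ * α) = Complex.exp ((2 * Real.pi * θ : ℝ) * α * Complex.I) := by
      intro α; unfold e; congr 1; push_cast; ring
    simp only [this]
    rw [h]
    unfold Ph
    push_cast
    rw [← Complex.exp_add]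
    congr 1
    ring
  rw [h2, h3, Complex.re_mul_ofReal]

lemma sq_expand {ι : Type} (U : Finset ι) (w θ : ι → ℝ) (α : ℝ) :
    ‖∑ u ∈ U, (w u : ℂ) * e (θ u * α)‖ ^ 2 =
      ∑ u ∈ U, ∑ v ∈ U, w u * w v * (e ((θ u - θ v) * α)).re := by
  have h : ((‖∑ u ∈ U, (w u : ℂ) * e (θ u * α)‖ ^ 2 : ℝ) : ℂ) =
      ∑ u ∈ U, ∑ v ∈ U, (w u * w v : ℝ) * e ((θ u - θ v) * α) := by
    push_cast
    rw [← Complex.mul_conj', map_sum, Finset.sum_mul_sum]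
    refine Finset.sum_congr rfl fun u _ => Finset.sum_congr rfl fun v _ => ?_
    rw [map_mul, e_conj, Complex.conj_ofReal, show (θ u - θ v) * α = θ u * α + -(θ v * α) by ring, e_add]
    ring
  have h2 := congrArg Complex.re h
  rw [Complex.ofReal_re] at h2
  rw [h2]
  simp only [Complex.re_sum, Complex.re_ofReal_mul]

lemma re_int (θ y : ℝ) : Integrable (fun α => (e (θ * α)).re) (gaussianReal y 1) :=
  bint (Complex.continuous_re.comp (e_cont.comp (continuous_const.mul continuous_id))) (C := 1)
    (fun x => (Complex.abs_re_le_norm _).trans (e_norm _).le) y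

lemma int_sq {ι : Type} (U : Finset ι) (w θ : ι → ℝ) (y : ℝ) :
    ∫ α, ‖∑ u ∈ U, (w u : ℂ) * e (θ u * α)‖ ^ 2 ∂(gaussianReal y 1) =
      ∑ u ∈ U, ∑ v ∈ U, w u * w v * ((e ((θ u - θ v) * y)).re * Ph (θ u - θ v)) := by
  simp only [sq_expand]
  rw [integral_finset_sum _ fun u _ => integrable_finset_sum _ fun v _ => (re_int _ _).const_mul _]
  refine Finset.sum_congr rfl fun u _ => ?_
  rw [integral_finset_sum _ fun v _ => (re_int _ _).const_mul _]
  refine Finset.sum_congr rfl fun v _ => ?_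
  rw [integral_const_mul, int_e]

lemma int_sq_le {ι : Type} (U : Finset ι) (w θ : ι → ℝ) (hw : ∀ u ∈ U, 0 ≤ w u) (y : ℝ) :
    ∫ α, ‖∑ u ∈ U, (w u : ℂ) * e (θ u * α)‖ ^ 2 ∂(gaussianReal y 1) ≤
      ∑ u ∈ U, ∑ v ∈ U, w u * w v * Ph (θ u - θ v) := by
  rw [int_sq]
  refine Finset.sum_le_sum fun u hu => Finset.sum_le_sum fun v hv => ?_
  refine mul_le_mul_of_nonneg_left ?_ (mul_nonneg (hw u hu) (hw v hv))
  refine mul_le_of_le_one_left (Ph_nonneg _) ?_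
  exact (Complex.re_le_norm _).trans (e_norm _).le

lemma int_sq0 {ι : Type} (U : Finset ι) (θ : ι → ℝ) :
    ∫ α, ‖∑ u ∈ U, e (θ u * α)‖ ^ 2 ∂(gaussianReal 0 1) =
      ∑ u ∈ U, ∑ v ∈ U, Ph (θ u - θ v) := by
  have := int_sq U (fun _ => 1) θ 0
  simpa [e_zero] using this

lemma Ph_sum {l : ℝ} (hl : l ≠ 0) : ∃ C : ℝ, 1 ≤ C ∧ ∀ (y : ℝ) (V : Finset ℤ),
    ∑ v ∈ V, Ph (l * v + y) ≤ C := by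
  have hs : Summable (fun n : ℤ => 1 / (n : ℝ) ^ 2) := Real.summable_one_div_int_pow.2 (by norm_num)
  set S := ∑' n : ℤ, 1 / (n : ℝ) ^ 2
  have hS : 0 ≤ S := tsum_nonneg fun n => by positivity
  refine ⟨1 + 4 / l ^ 2 * S, le_add_of_nonneg_right (by positivity), fun y V => ?_⟩
  set v0 := round (-y / l)
  have hb : ∀ v : ℤ, Ph (l * v + y) ≤ (if v = v0 then 1 else 0) + 4 / l ^ 2 * (1 / ((v - v0 : ℤ) : ℝ) ^ 2) := by
    intro v
    split_ifs with h
    · have : Ph (l * v + y) ≤ 1 := by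
        unfold Ph; rw [Real.exp_le_one_iff]; simp; positivity
      exact this.trans (le_add_of_nonneg_right (by positivity))
    · rw [zero_add]
      have h1 := abs_sub_round (-y / l)
      change |(-y / l) - (v0 : ℝ)| ≤ 1 / 2 at h1
      set d : ℝ := ((v - v0 : ℤ) : ℝ) with hd
      have hd1 : 1 ≤ |d| := by
        rw [hd, ← Int.cast_abs]; exact_mod_cast Int.one_le_abs (sub_ne_zero.2 h)
      have h2 : l * v + y = l * (d - ((-y / l) - v0)) := by rw [hd]; push_cast; field_simp; ring
      have h3 : |d| / 2 ≤ |d - ((-y / l) - v0)| := by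
        have := abs_sub_abs_le_abs_sub d ((-y / l) - v0); linarith
      have h4 : l ^ 2 * (d ^ 2 / 4) ≤ (l * v + y) ^ 2 := by
        rw [h2, mul_pow]
        refine mul_le_mul_of_nonneg_left ?_ (sq_nonneg l)
        rw [← sq_abs (d - _), ← sq_abs d]
        have := pow_le_pow_left₀ (by positivity) h3 2
        linarith [this]
      have hd2 : 0 < d ^ 2 := by have := abs_pos.1 (by linarith : 0 < |d|); positivity
      have hz : 0 < l ^ 2 * (d ^ 2 / 4) := by positivity
      have h5 : Ph (l * v + y) ≤ (l ^ 2 * (d ^ 2 / 4))⁻¹ := by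
        unfold Ph
        rw [Real.exp_neg]
        refine inv_anti₀ hz ?_
        have hp : 1 ≤ 2 * Real.pi ^ 2 := by nlinarith [Real.pi_gt_three]
        have := Real.add_one_le_exp (2 * Real.pi ^ 2 * (l * v + y) ^ 2)
        nlinarith [sq_nonneg (l * v + y)]
      refine h5.trans (le_of_eq ?_)
      field_simp
  refine (Finset.sum_le_sum fun v _ => hb v).trans ?_
  rw [Finset.sum_add_distrib, ← Finset.mul_sum]
  refine add_le_add ?_ (mul_le_mul_of_nonneg_left ?_ (by positivity))
  · rw [Finset.sum_ite_eq']; split_ifs <;> norm_num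
  · have h := Summable.sum_le_tsum (V.map (Equiv.subRight v0).toEmbedding) (fun n _ => by positivity) hs
    rw [Finset.sum_map] at h
    exact h

lemma Ph_cnt {μ : ℝ} (hμ : μ ≠ 0) : ∃ C : ℝ, 1 ≤ C ∧ ∀ {ι : Type} (U : Finset ι) (ψ : ι → ℤ),
    ∑ u ∈ U, ∑ v ∈ U, Ph (μ * (ψ u - ψ v)) ≤ C * cnt U ψ := by
  obtain ⟨C, hC, h⟩ := Ph_sum hμ
  refine ⟨C, hC, fun {ι} U ψ => ?_⟩
  set R := U.image ψ
  let r : ℤ → ℝ := fun b => #{u ∈ U | ψ u = b}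
  have h0 : ∀ F : ℤ → ℝ, ∑ u ∈ U, F (ψ u) = ∑ b ∈ R, r b * F b := by
    intro F
    rw [Finset.sum_comp]
    refine Finset.sum_congr rfl fun b _ => ?_
    rw [nsmul_eq_mul]
  have h1 : ∀ b : ℤ, ∑ v ∈ U, Ph (μ * (b - ψ v)) = ∑ b' ∈ R, r b' * Ph (μ * (b - b')) :=
    fun b => h0 fun b' => Ph (μ * (b - b'))
  simp only [h1]
  rw [h0 fun b => ∑ b' ∈ R, r b' * Ph (μ * (b - b')), cnt_eq2]
  have hC' : ∀ b : ℤ, ∑ b' ∈ R, Ph (μ * (b - b')) ≤ C := by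
    intro b
    have := h (-(μ * b)) R
    refine le_trans (le_of_eq (Finset.sum_congr rfl fun b' _ => ?_)) this
    rw [← Ph_neg]; congr 1; ring
  have h2 : ∑ b ∈ R, r b * ∑ b' ∈ R, r b' * Ph (μ * (b - b')) ≤
      ∑ b ∈ R, ∑ b' ∈ R, (r b ^ 2 / 2 * Ph (μ * (b - b')) + r b' ^ 2 / 2 * Ph (μ * (b - b'))) := by
    refine Finset.sum_le_sum fun b _ => ?_
    rw [Finset.mul_sum]
    refine Finset.sum_le_sum fun b' _ => ?_
    nlinarith [mul_nonneg (sq_nonneg (r b - r b')) (Ph_nonneg (μ * (b - b')))]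
  refine h2.trans ?_
  simp only [Finset.sum_add_distrib]
  have h3 : ∑ b ∈ R, ∑ b' ∈ R, r b' ^ 2 / 2 * Ph (μ * (b - b')) =
      ∑ b ∈ R, ∑ b' ∈ R, r b ^ 2 / 2 * Ph (μ * (b - b')) := by
    rw [Finset.sum_comm]
    refine Finset.sum_congr rfl fun b _ => Finset.sum_congr rfl fun b' _ => ?_
    rw [← Ph_neg]; congr 2; ring
  rw [h3, ← two_mul, Finset.mul_sum, Finset.mul_sum]
  refine Finset.sum_le_sum fun b _ => ?_
  rw [← Finset.mul_sum]
  have := mul_le_mul_of_nonneg_left (hC' b) (sq_nonneg (r b))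
  change 2 * (r b ^ 2 / 2 * _) ≤ C * r b ^ 2
  linarith

lemma mixed_int {ι : Type} (P j a : ℕ) (l : ℝ) (U : Finset ι) (θ : ι → ℝ) :
    ∫ α, ‖∑ n ∈ Icc 1 (P : ℤ), e (l * (n ^ a : ℤ) * α)‖ ^ 2 ^ (j + 1) * ‖∑ u ∈ U, e (θ u * α)‖ ^ 2
        ∂(gaussianReal 0 1) ≤ (2 * P : ℝ) ^ (2 ^ (j + 1) - (j + 1) - 1) *
      ((WW P (j + 1) (fun x => x ^ a) (Icc 1 (P : ℤ))).map
        fun v : ℤ => ∑ u ∈ U, ∑ w ∈ U, Ph (l * v + (θ u - θ w))).sum := by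
  set W := WW P (j + 1) (fun x => x ^ a) (Icc 1 (P : ℤ))
  set c := (2 * P : ℝ) ^ (2 ^ (j + 1) - (j + 1) - 1)
  have hpt : ∀ α : ℝ, ‖∑ n ∈ Icc 1 (P : ℤ), e (l * (n ^ a : ℤ) * α)‖ ^ 2 ^ (j + 1) *
      ‖∑ u ∈ U, e (θ u * α)‖ ^ 2 ≤ c * ∑ v ∈ W.toFinset, (W.count v : ℝ) *
        ∑ u ∈ U, ∑ w ∈ U, (e ((l * v + (θ u - θ w)) * α)).re := by
    intro α
    have h := weyl_ineq P (χ := fun v : ℤ => e (l * v * α)) (fun a b => by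
        rw [← e_add]; congr 1; push_cast; ring) (fun a => by rw [e_conj]; congr 1; push_cast; ring)
        j (fun x => x ^ a) (I := Icc 1 (P : ℤ)) subset_rfl
    refine (mul_le_mul_of_nonneg_right h (sq_nonneg _)).trans (le_of_eq ?_)
    rw [mul_assoc, Finset.sum_multiset_map_count, Finset.sum_mul]
    congr 1
    refine Finset.sum_congr rfl fun v _ => ?_
    rw [nsmul_eq_mul, mul_assoc]
    congr 1
    have h5 : ((‖∑ u ∈ U, e (θ u * α)‖ ^ 2 : ℝ) : ℂ) = ∑ u ∈ U, ∑ w ∈ U, e ((θ u - θ w) * α) := by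
      push_cast
      rw [← Complex.mul_conj', map_sum, Finset.sum_mul_sum]
      refine Finset.sum_congr rfl fun u _ => Finset.sum_congr rfl fun v _ => ?_
      rw [e_conj, ← e_add]; congr 1; ring
    rw [← Complex.re_mul_ofReal, h5, Finset.mul_sum, Complex.re_sum]
    refine Finset.sum_congr rfl fun u _ => ?_
    rw [Finset.mul_sum, Complex.re_sum]
    refine Finset.sum_congr rfl fun w _ => ?_
    rw [← e_add]; congr 2; ring
  have hmono : ∫ α, ‖∑ n ∈ Icc 1 (P : ℤ), e (l * (n ^ a : ℤ) * α)‖ ^ 2 ^ (j + 1) *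
      ‖∑ u ∈ U, e (θ u * α)‖ ^ 2 ∂(gaussianReal 0 1) ≤ ∫ α, c * ∑ v ∈ W.toFinset, (W.count v : ℝ) *
        ∑ u ∈ U, ∑ w ∈ U, (e ((l * v + (θ u - θ w)) * α)).re ∂(gaussianReal 0 1) := by
    refine integral_mono_of_nonneg (Filter.Eventually.of_forall fun α => by positivity) ?_
      (Filter.Eventually.of_forall hpt)
    exact (integrable_finset_sum _ fun v _ => (integrable_finset_sum _ fun u _ =>
      integrable_finset_sum _ fun w _ => re_int _ _).const_mul _).const_mul _
  refine hmono.trans (le_of_eq ?_)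
  rw [integral_const_mul, Finset.sum_multiset_map_count, integral_finset_sum _ fun v _ =>
    (integrable_finset_sum _ fun u _ => integrable_finset_sum _ fun w _ => re_int _ _).const_mul _]
  congr 1
  refine Finset.sum_congr rfl fun v _ => ?_
  rw [integral_const_mul, nsmul_eq_mul, integral_finset_sum _ fun u _ =>
    integrable_finset_sum _ fun w _ => re_int _ _]
  congr 1
  refine Finset.sum_congr rfl fun u _ => ?_
  rw [integral_finset_sum _ fun w _ => re_int _ _]
  refine Finset.sum_congr rfl fun w _ => ?_
  rw [int_e, mul_zero, e_zero]; simp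

/-- the main mixed estimate -/
lemma mixed_bound {a j : ℕ} (hja : j + 2 ≤ a) {l μ ε : ℝ} (hl : l ≠ 0) (hμ : μ ≠ 0) (hε : 0 < ε) :
    ∃ C : ℝ, 1 ≤ C ∧ ∀ (P : ℕ), 1 ≤ P → ∀ {ι : Type} (U : Finset ι) (ψ : ι → ℤ),
    ∫ α, ‖∑ n ∈ Icc 1 (P : ℤ), e (l * (n ^ a : ℤ) * α)‖ ^ 2 ^ (j + 1) * ‖∑ u ∈ U, e (μ * ψ u * α)‖ ^ 2
        ∂(gaussianReal 0 1) ≤ C * (P : ℝ) ^ (2 ^ (j + 1) - (j + 1) - 1) *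
        ((P : ℝ) ^ (j + 1) * cnt U ψ + (P : ℝ) ^ ε * (#U : ℝ) ^ 2) := by
  obtain ⟨C1, hC1, h1⟩ := WW_bounds (k := a) (j := j + 1) (by omega) hε
  obtain ⟨C2, hC2, h2⟩ := Ph_sum hl
  obtain ⟨C3, hC3, h3⟩ := Ph_cnt hμ
  set E := 2 ^ (j + 1) - (j + 1) - 1
  have hE : (1 : ℝ) ≤ 2 ^ E := one_le_pow₀ (by norm_num)
  refine ⟨2 ^ E * (C1 * (C2 * C3)), one_le_mul_of_one_le_of_one_le hE
    (one_le_mul_of_one_le_of_one_le hC1 (one_le_mul_of_one_le_of_one_le hC2 hC3)), fun P hP ι U ψ => ?_⟩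
  refine (mixed_int P j a l U (fun u => μ * ψ u)).trans ?_
  obtain ⟨h10, h11⟩ := h1 P hP
  set W := WW P (j + 1) (fun x => x ^ a) (Icc 1 (P : ℤ))
  set T : ℤ → ℝ := fun v => ∑ u ∈ U, ∑ w ∈ U, Ph (l * v + (μ * ψ u - μ * ψ w)) with hT
  have hT0 : ∀ v, 0 ≤ T v := fun v => Finset.sum_nonneg fun u _ => Finset.sum_nonneg fun w _ => Ph_nonneg _
  have hTz : T 0 ≤ C3 * cnt U ψ := by
    refine le_trans (le_of_eq ?_) (h3 U ψ)
    refine Finset.sum_congr rfl fun u _ => Finset.sum_congr rfl fun w _ => ?_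
    congr 1; push_cast; ring
  have hTs : ∑ v ∈ W.toFinset, T v ≤ C2 * (#U : ℝ) ^ 2 := by
    rw [hT]
    rw [Finset.sum_comm]
    have : ∀ u ∈ U, ∑ v ∈ W.toFinset, ∑ w ∈ U, Ph (l * v + (μ * ψ u - μ * ψ w)) ≤ #U * C2 := by
      intro u _
      rw [Finset.sum_comm]
      refine (Finset.sum_le_sum fun w _ => h2 (μ * ψ u - μ * ψ w) W.toFinset).trans ?_
      rw [Finset.sum_const, nsmul_eq_mul]
    refine (Finset.sum_le_sum this).trans (le_of_eq ?_)
    rw [Finset.sum_const, nsmul_eq_mul]; ring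
  have hP1 : (1 : ℝ) ≤ P := by exact_mod_cast hP
  have hPe : (0 : ℝ) ≤ (P : ℝ) ^ ε := Real.rpow_nonneg (by linarith) _
  have hsum : (W.map T).sum ≤ C1 * P ^ (j + 1) * T 0 + C1 * P ^ ε * ∑ v ∈ W.toFinset, T v := by
    rw [Finset.sum_multiset_map_count]
    have : ∀ v ∈ W.toFinset, W.count v • T v ≤
        (if v = 0 then C1 * (P : ℝ) ^ (j + 1) * T 0 else 0) + C1 * P ^ ε * T v := by
      intro v _
      rw [nsmul_eq_mul]
      split_ifs with h
      · subst h
        have := mul_le_mul_of_nonneg_right h10 (hT0 0)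
        have h5 : 0 ≤ C1 * P ^ ε * T 0 := mul_nonneg (mul_nonneg (by linarith) hPe) (hT0 _)
        linarith
      · rw [zero_add]; exact mul_le_mul_of_nonneg_right (h11 v h) (hT0 v)
    refine (Finset.sum_le_sum this).trans ?_
    rw [Finset.sum_add_distrib]
    refine add_le_add ?_ (Finset.mul_sum _ _ _).ge
    rw [Finset.sum_ite_eq']
    split_ifs
    · exact le_rfl
    · exact mul_nonneg (mul_nonneg (by linarith) (by positivity)) (hT0 0)
  have hx : (0 : ℝ) ≤ P ^ (j + 1) * cnt U ψ := by positivity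
  have hy : (0 : ℝ) ≤ P ^ ε * (#U : ℝ) ^ 2 := by positivity
  calc _ ≤ (2 * P : ℝ) ^ E * (C1 * P ^ (j + 1) * (C3 * cnt U ψ) + C1 * P ^ ε * (C2 * (#U : ℝ) ^ 2)) := by
        refine mul_le_mul_of_nonneg_left (hsum.trans (add_le_add ?_ ?_)) (by positivity)
        · exact mul_le_mul_of_nonneg_left hTz (by positivity)
        · exact mul_le_mul_of_nonneg_left hTs (by positivity)
    _ = 2 ^ E * P ^ E * (C1 * (C3 * (P ^ (j + 1) * cnt U ψ) + C2 * (P ^ ε * (#U : ℝ) ^ 2))) := by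
        rw [mul_pow]; ring
    _ ≤ 2 ^ E * P ^ E * (C1 * ((C2 * C3) * (P ^ (j + 1) * cnt U ψ) + (C2 * C3) * (P ^ ε * (#U : ℝ) ^ 2))) := by
        refine mul_le_mul_of_nonneg_left (mul_le_mul_of_nonneg_left (add_le_add ?_ ?_) (by linarith)) (by positivity)
        · exact mul_le_mul_of_nonneg_right (by nlinarith) hx
        · exact mul_le_mul_of_nonneg_right (by nlinarith) hy
    _ = _ := by ring
end gauss
end VM

open MeasureTheory Finset
open scoped Classical

set_option linter.all false
namespace VM
section hua
open ProbabilityTheory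

/-- the power sum as an integer -/
def psz (k s : ℕ) (u : Fin s → ℕ) : ℤ := ((∑ i, (u i) ^ k : ℕ) : ℤ)

lemma cnt_psz (k s : ℕ) (A : Finset ℕ) : cnt (tup s A) (psz k s) = NN k s A :=
  le_antisymm (cnt_le subset_rfl _ _ fun u _ v _ h => by unfold psz at h; exact_mod_cast h)
    (cnt_le subset_rfl _ _ fun u _ v _ h => by unfold psz; exact_mod_cast h)

lemma tup_e (k s : ℕ) (A : Finset ℕ) (l α : ℝ) :
    ∑ u ∈ tup s A, e (l * psz k s u * α) = (∑ x ∈ A, e (l * ((x : ℤ) ^ k : ℤ) * α)) ^ s := by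
  rw [tup_pow]
  refine Finset.sum_congr rfl fun u _ => ?_
  rw [← e_sum]
  congr 1
  unfold psz
  push_cast
  rw [Finset.mul_sum, Finset.sum_mul]

lemma sum_int_nat (P : ℕ) (f : ℤ → ℂ) : ∑ n ∈ Icc 1 (P : ℤ), f n = ∑ n ∈ Icc 1 P, f n := by
  symm
  refine Finset.sum_bij (fun n _ => (n : ℤ)) ?_ (fun a _ b _ h => by exact_mod_cast h) ?_ (fun _ _ => rfl)
  · intro n hn; simp at *; omega
  · intro n hn
    simp at hn
    exact ⟨n.toNat, by simp; omega, by omega⟩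

lemma card_tup (s : ℕ) (A : Finset ℕ) : #(tup s A) = #A ^ s := by
  unfold tup; rw [Fintype.card_piFinset_const]

lemma NN_le_int (k s : ℕ) (A : Finset ℕ) :
    (NN k s A : ℝ) ≤ ∫ α, ‖∑ u ∈ tup s A, e (1 * psz k s u * α)‖ ^ 2 ∂(gaussianReal 0 1) := by
  rw [int_sq0 _ fun u => 1 * (psz k s u : ℝ), ← cnt_psz, cnt_eq]
  refine Finset.sum_le_sum fun u _ => Finset.sum_le_sum fun v _ => ?_
  split_ifs with h
  · rw [h, sub_self, Ph_zero]
  · exact Ph_nonneg _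

lemma hua {k : ℕ} (hk : 1 ≤ k) (j : ℕ) : j + 1 ≤ k → ∀ {ε : ℝ}, 0 < ε → ∃ C : ℝ, 1 ≤ C ∧ ∀ Q : ℕ, 1 ≤ Q →
    (NN k (2 ^ j) (Icc 1 Q) : ℝ) ≤ C * (Q : ℝ) ^ ((2 : ℝ) ^ (j + 1) - (j + 1) + ε) := by
  induction j with
  | zero =>
    intro _ ε hε
    refine ⟨1, le_rfl, fun Q hQ => ?_⟩
    have hQ1 : (1 : ℝ) ≤ Q := by exact_mod_cast hQ
    have h1 : NN k 1 (Icc 1 Q) ≤ Q := by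
      have : NN k 1 (Icc 1 Q) ≤ #((tup 1 (Icc 1 Q)).image fun u => (u, u)) := by
        unfold NN cnt
        apply Finset.card_le_card
        intro x hx
        simp only [Finset.mem_filter] at hx
        obtain ⟨h1, h2⟩ := hx
        refine Finset.mem_image.2 ⟨x.1, (Finset.mem_product.1 h1).1, ?_⟩
        refine Prod.ext rfl ?_
        funext i
        rw [Fin.sum_univ_one, Fin.sum_univ_one] at h2
        have := Nat.pow_left_injective (by omega : k ≠ 0) h2
        rw [Subsingleton.elim i 0]; exact this
      refine this.trans (Finset.card_image_le.trans ?_)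
      rw [card_tup]; simp
    rw [one_mul]
    calc (NN k (2 ^ 0) (Icc 1 Q) : ℝ) ≤ (Q : ℝ) ^ (1 : ℝ) := by rw [Real.rpow_one]; exact_mod_cast h1
      _ ≤ _ := Real.rpow_le_rpow_of_exponent_le hQ1 (by norm_num; linarith)
  | succ j ih =>
    intro hjk ε hε
    obtain ⟨C1, hC1, h1⟩ := ih (by omega) hε
    obtain ⟨C2, hC2, h2⟩ := mixed_bound (a := k) (j := j) (by omega) (l := 1) (μ := 1) one_ne_zero one_ne_zero hε
    refine ⟨C2 * (C1 + 1), by nlinarith, fun Q hQ => ?_⟩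
    have hQ1 : (1 : ℝ) ≤ Q := by exact_mod_cast hQ
    have hQ0 : (0 : ℝ) < Q := by linarith
    have h3 := h2 Q hQ (tup (2 ^ j) (Icc 1 Q)) (psz k (2 ^ j))
    have h4 : ∀ α : ℝ, ‖∑ n ∈ Icc 1 (Q : ℤ), e (1 * (n ^ k : ℤ) * α)‖ ^ 2 ^ (j + 1) *
        ‖∑ u ∈ tup (2 ^ j) (Icc 1 Q), e (1 * psz k (2 ^ j) u * α)‖ ^ 2 =
        ‖∑ u ∈ tup (2 ^ (j + 1)) (Icc 1 Q), e (1 * psz k (2 ^ (j + 1)) u * α)‖ ^ 2 := by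
      intro α
      rw [tup_e, tup_e, sum_int_nat Q (fun n => e (1 * (n ^ k : ℤ) * α)), norm_pow, norm_pow, ← pow_mul,
        ← pow_mul, ← pow_add]
      congr 1; ring
    simp only [h4] at h3
    refine (NN_le_int _ _ _).trans (h3.trans ?_)
    rw [cnt_psz, card_tup]
    have hE : j + 1 + 1 ≤ 2 ^ (j + 1) := Nat.lt_two_pow_self
    have h5 : (Q : ℝ) ^ (2 ^ (j + 1) - (j + 1) - 1) = (Q : ℝ) ^ ((2 : ℝ) ^ (j + 1) - (j + 1) - 1) := by
      rw [← Real.rpow_natCast]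
      congr 1
      rw [Nat.cast_sub (by omega), Nat.cast_sub (by omega)]; push_cast; ring
    have h6 : ((#(Icc 1 Q) ^ 2 ^ j : ℕ) : ℝ) ^ 2 = (Q : ℝ) ^ ((2 : ℝ) ^ (j + 1)) := by
      rw [Nat.card_Icc, Nat.add_sub_cancel]
      push_cast
      rw [← pow_mul, ← pow_succ, ← Real.rpow_natCast]; push_cast; rfl
    rw [h6, h5, ← Real.rpow_natCast (Q : ℝ) (j + 1), ← Real.rpow_add hQ0]
    have h7 := mul_le_mul_of_nonneg_left (h1 Q hQ) (by positivity : (0 : ℝ) ≤ (Q : ℝ) ^ ((j + 1 : ℕ) : ℝ))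
    have h8 : (Q : ℝ) ^ ((j + 1 : ℕ) : ℝ) * (C1 * (Q : ℝ) ^ ((2 : ℝ) ^ (j + 1) - (j + 1) + ε)) =
        C1 * (Q : ℝ) ^ (ε + 2 ^ (j + 1)) := by
      rw [mul_left_comm, ← Real.rpow_add hQ0]; congr 2; push_cast; ring
    rw [h8] at h7
    calc _ ≤ C2 * (Q : ℝ) ^ ((2 : ℝ) ^ (j + 1) - (j + 1) - 1) * (C1 * (Q : ℝ) ^ (ε + 2 ^ (j + 1)) +
            (Q : ℝ) ^ (ε + 2 ^ (j + 1))) :=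
          mul_le_mul_of_nonneg_left (add_le_add h7 le_rfl) (by positivity)
      _ = C2 * (C1 + 1) * ((Q : ℝ) ^ ((2 : ℝ) ^ (j + 1) - (j + 1) - 1) * (Q : ℝ) ^ (ε + 2 ^ (j + 1))) := by ring
      _ = _ := by
        rw [← Real.rpow_add hQ0]; congr 2; push_cast; ring

/-- frequencies -/
noncomputable def xi (k M x : ℕ) : Gm 2 M 1 := fun _ => ((x ^ k : ℕ) : ZMod (2 ^ M))

/-- squared exponential sum -/
noncomputable def Fg (k M : ℕ) (A : Finset ℕ) (g : Fin 1 → ZMod (2 ^ M)) : ℝ :=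
  ‖∑ x ∈ A, ee 2 M 1 (xi k M x) g‖ ^ 2

lemma NN_moment {k s M : ℕ} {A : Finset ℕ} (hM : ∀ u ∈ tup s A, ∑ i, (u i) ^ k < 2 ^ M) :
    ∑ g, Fg k M A g ^ s =
      (Fintype.card (Fin 1 → ZMod (2 ^ M)) : ℝ) * NN k s A := by
  unfold Fg
  rw [moment_char (ee_char 2 M 1)]
  congr 2
  have hs : ∀ u : Fin s → ℕ, (∑ i, xi k M (u i)) 0 =
      ((∑ i, (u i) ^ k : ℕ) : ZMod (2 ^ M)) := by
    intro u; rw [gsum_apply, Nat.cast_sum]; rfl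
  refine le_antisymm (cnt_le subset_rfl _ _ fun u hu v hv h => ?_) (cnt_le subset_rfl _ _ fun u _ v _ h => ?_)
  · have h1 := congrFun h 0
    rw [hs, hs, ZMod.natCast_eq_natCast_iff'] at h1
    rwa [Nat.mod_eq_of_lt (hM u hu), Nat.mod_eq_of_lt (hM v hv)] at h1
  · funext i
    rw [Subsingleton.elim i 0, hs, hs, h]

lemma interp {k a s b : ℕ} (has : a ≤ s) (hsb : s ≤ b) (hab : a < b) {xa xb z Ca Cb : ℝ}
    (hz : ((b : ℝ) - s) * xa + (s - a) * xb ≤ (b - a) * z) (hCa : 1 ≤ Ca) (hCb : 1 ≤ Cb)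
    {Q : ℕ} (hQ : 1 ≤ Q) {A : Finset ℕ} (hA : A ⊆ Icc 1 Q) (h1 : (NN k a A : ℝ) ≤ Ca * (Q : ℝ) ^ xa)
    (h2 : (NN k b A : ℝ) ≤ Cb * (Q : ℝ) ^ xb) : (NN k s A : ℝ) ≤ (Ca * Cb) * (Q : ℝ) ^ z := by
  have hQ1 : (1 : ℝ) ≤ Q := by exact_mod_cast hQ
  have hQ0 : (0 : ℝ) < Q := by linarith
  set M := b * Q ^ k
  have hM : ∀ t ≤ b, ∀ u ∈ tup t A, ∑ i, (u i) ^ k < 2 ^ M := by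
    intro t ht u hu
    refine lt_of_le_of_lt ?_ Nat.lt_two_pow_self
    calc ∑ i, (u i) ^ k ≤ ∑ i : Fin t, Q ^ k := by
          refine Finset.sum_le_sum fun i _ => Nat.pow_le_pow_left ?_ _
          exact (Finset.mem_Icc.1 (hA (mem_tup.1 hu i))).2
      _ = t * Q ^ k := by simp
      _ ≤ _ := Nat.mul_le_mul_right _ ht
  set N := (Fintype.card (Fin 1 → ZMod (2 ^ M)) : ℝ)
  have hN : 0 < N := by exact Nat.cast_pos.2 Fintype.card_pos
  let F : (Fin 1 → ZMod (2 ^ M)) → ℝ := Fg k M A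
  have hF : ∀ g, 0 ≤ F g := fun g => sq_nonneg _
  have hn : b - s + (s - a) = b - a := by omega
  have hH := holder_int (univ : Finset (Fin 1 → ZMod (2 ^ M))) (a := b - s) (b := s - a) (by omega)
    (u := fun g => F g ^ s) (A := fun g => F g ^ a) (B := fun g => F g ^ b)
    (fun g => pow_nonneg (hF g) _) (fun g => pow_nonneg (hF g) _) (fun g => pow_nonneg (hF g) _) (fun g => by
      rw [← pow_mul, ← pow_mul, ← pow_mul, ← pow_add, hn]
      refine le_of_eq (congrArg _ ?_)
      zify [has, hsb, hab.le]; ring)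
  have e1 : ∑ g, F g ^ s = N * NN k s A := NN_moment (hM s hsb)
  have e2 : ∑ g, F g ^ a = N * NN k a A := NN_moment (hM a hab.le)
  have e3 : ∑ g, F g ^ b = N * NN k b A := NN_moment (hM b le_rfl)
  simp only [e1, e2, e3, mul_pow] at hH
  have hH2 : (NN k s A : ℝ) ^ (b - a) ≤ (NN k a A : ℝ) ^ (b - s) * (NN k b A : ℝ) ^ (s - a) := by
    have hN2 : 0 < N ^ (b - s + (s - a)) := pow_pos hN _
    refine le_of_mul_le_mul_left ?_ hN2
    rw [← hn]
    refine hH.trans (le_of_eq ?_)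
    rw [pow_add]; ring
  have hCC : 1 ≤ Ca * Cb := one_le_mul_of_one_le_of_one_le hCa hCb
  refine (pow_le_pow_iff_left₀ (Nat.cast_nonneg _) (by positivity) (by omega : b - a ≠ 0)).1 ?_
  refine hH2.trans ?_
  calc _ ≤ (Ca * (Q : ℝ) ^ xa) ^ (b - s) * (Cb * (Q : ℝ) ^ xb) ^ (s - a) := by gcongr
    _ = Ca ^ (b - s) * Cb ^ (s - a) * (Q : ℝ) ^ (((b : ℝ) - s) * xa + (s - a) * xb) := by
      rw [mul_pow, mul_pow, ← Real.rpow_natCast ((Q : ℝ) ^ xa), ← Real.rpow_natCast ((Q : ℝ) ^ xb),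
        ← Real.rpow_mul hQ0.le, ← Real.rpow_mul hQ0.le, Real.rpow_add hQ0, Nat.cast_sub hsb, Nat.cast_sub has,
        mul_comm xa, mul_comm xb]
      ring
    _ ≤ (Ca * Cb) ^ (b - a) * (Q : ℝ) ^ (((b : ℝ) - a) * z) := by
      refine mul_le_mul ?_ (Real.rpow_le_rpow_of_exponent_le hQ1 hz) (by positivity) (by positivity)
      rw [mul_pow]
      exact mul_le_mul (pow_le_pow_right₀ hCa (by omega)) (pow_le_pow_right₀ hCb (by omega)) (by positivity)
        (by positivity)
    _ = _ := by
      rw [mul_pow (Ca * Cb), ← Real.rpow_natCast ((Q : ℝ) ^ z), ← Real.rpow_mul hQ0.le, Nat.cast_sub hab.le, mul_comm z]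

theorem NN_final {k p : ℕ} [Fact p.Prime] (hk : 5 ≤ k) (hkp : k < p) : ∃ s : ℕ, m2 k = 2 * s ∧ k ≤ 3 * s ∧
    ∀ ε : ℝ, 0 < ε → ∃ C : ℝ, 1 ≤ C ∧ ∀ Q : ℕ, 1 ≤ Q → ∀ A ⊆ Icc 1 Q, (∀ x ∈ A, ¬ p ∣ x) →
      (NN k s A : ℝ) ≤ C * (Q : ℝ) ^ (2 * (s : ℝ) - 2 * k / 3 + ε) := by
  have H4 : ∀ ε : ℝ, 0 < ε → ∃ C : ℝ, 1 ≤ C ∧ ∀ Q : ℕ, 1 ≤ Q → ∀ A ⊆ Icc 1 Q,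
      (NN k 8 A : ℝ) ≤ C * (Q : ℝ) ^ (12 + ε) := by
    intro ε hε
    obtain ⟨C, hC, h⟩ := hua (k := k) (by omega) 3 (by omega) hε
    refine ⟨C, hC, fun Q hQ A hA => le_trans (Nat.cast_le.2 (NN_mono k 8 hA)) ((h Q hQ).trans (le_of_eq ?_))⟩
    norm_num
  have H3 : ∀ ε : ℝ, 0 < ε → ∃ C : ℝ, 1 ≤ C ∧ ∀ Q : ℕ, 1 ≤ Q → ∀ A ⊆ Icc 1 Q,
      (NN k 4 A : ℝ) ≤ C * (Q : ℝ) ^ (5 + ε) := by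
    intro ε hε
    obtain ⟨C, hC, h⟩ := hua (k := k) (by omega) 2 (by omega) hε
    refine ⟨C, hC, fun Q hQ A hA => le_trans (Nat.cast_le.2 (NN_mono k 4 hA)) ((h Q hQ).trans (le_of_eq ?_))⟩
    norm_num
  unfold m2
  by_cases h5 : k = 5
  · subst h5
    refine ⟨6, ?_, by norm_num, fun ε hε => ?_⟩
    · rw [if_pos rfl]
      have h1 : ⌊2 * ((5 : ℕ) : ℝ) / 3⌋ = 3 := by rw [Int.floor_eq_iff]; norm_num
      rw [h1]
      have h2 : ⌈(2 * ((5 : ℕ) : ℝ) / 3 + 1 - ((3 : ℤ) : ℝ)) * (2 : ℝ) ^ ((3 : ℤ) - 1)⌉ = 6 := by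
        rw [Int.ceil_eq_iff]; norm_num
      rw [h2]; norm_num
    · obtain ⟨C1, hC1, h1⟩ := H3 ε hε
      obtain ⟨C2, hC2, h2⟩ := H4 ε hε
      refine ⟨C1 * C2, one_le_mul_of_one_le_of_one_le hC1 hC2, fun Q hQ A hA _ => ?_⟩
      refine interp (a := 4) (b := 8) (by norm_num) (by norm_num) (by norm_num) ?_ hC1 hC2 hQ hA
        (h1 Q hQ A hA) (h2 Q hQ A hA)
      push_cast; linarith
  rw [if_neg h5]
  by_cases h6 : k = 6
  · subst h6
    refine ⟨8, ?_, by norm_num, fun ε hε => ?_⟩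
    · rw [if_pos (by norm_num)]
      have h2 : ⌈14 * ((6 : ℕ) : ℝ) / 3 - 20⌉ = 8 := by rw [Int.ceil_eq_iff]; norm_num
      rw [h2]; norm_num
    · obtain ⟨C2, hC2, h2⟩ := H4 ε hε
      refine ⟨C2, hC2, fun Q hQ A hA _ => (h2 Q hQ A hA).trans (le_of_eq ?_)⟩
      norm_num
  by_cases h7 : k = 7
  · subst h7
    refine ⟨13, ?_, by norm_num, fun ε hε => ?_⟩
    · rw [if_pos (by norm_num)]
      have h2 : ⌈14 * ((7 : ℕ) : ℝ) / 3 - 20⌉ = 13 := by rw [Int.ceil_eq_iff]; norm_num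
      rw [h2]; norm_num
    · obtain ⟨C1, hC1, h1⟩ := H4 ε hε
      obtain ⟨C2, hC2, h2⟩ := vmvt (p := p) (j := 5) (k := 7) (by norm_num) (by norm_num) hkp hε
      have ht : tri 5 = 15 := by have := two_tri 5; omega
      rw [ht] at h2
      refine ⟨C1 * C2, one_le_mul_of_one_le_of_one_le hC1 hC2, fun Q hQ A hA hp => ?_⟩
      refine interp (a := 8) (b := 15) (by norm_num) (by norm_num) (by norm_num) ?_ hC1 hC2 hQ hA
        (h1 Q hQ A hA) (h2 Q hQ A hA hp)
      push_cast; linarith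
  rw [if_neg (by omega)]
  set f := 2 * k / 3 with hf
  have hf1 : (3 * f : ℝ) ≤ 2 * k := by exact_mod_cast (by omega : 3 * f ≤ 2 * k)
  have hf2 : (2 * k : ℝ) ≤ 3 * f + 2 := by exact_mod_cast (by omega : 2 * k ≤ 3 * f + 2)
  have hf5 : (5 : ℝ) ≤ f := by exact_mod_cast (by omega : 5 ≤ f)
  have hfl : ⌊2 * (k : ℝ) / 3⌋ = (f : ℤ) := by
    rw [Int.floor_eq_iff]; push_cast; constructor <;> linarith
  rw [hfl]
  push_cast
  set x := (2 * (k : ℝ) / 3 - (f : ℝ) / 2) * ((f : ℝ) + 1) with hx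
  have hta : (2 * tri f : ℝ) = f * (f + 1) := by exact_mod_cast two_tri f
  have htb : (2 * tri (f + 1) : ℝ) = (f + 1) * (f + 1 + 1) := by exact_mod_cast two_tri (f + 1)
  have hx1 : (tri f : ℝ) ≤ x := by rw [hx]; nlinarith
  have hx2 : x + 1 ≤ (tri (f + 1) : ℝ) := by rw [hx]; nlinarith
  have hx0 : 0 ≤ x := le_trans (Nat.cast_nonneg _) hx1
  have h3s : k ≤ 3 * ⌈x⌉₊ := by
    have : (k : ℝ) ≤ 3 * ⌈x⌉₊ := by nlinarith [Nat.le_ceil x]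
    exact_mod_cast this
  refine ⟨⌈x⌉₊, ?_, h3s, fun ε hε => ?_⟩
  · rw [← natCast_ceil_eq_intCast_ceil hx0]
  have hs1 := Nat.le_ceil x
  have hs2 := Nat.ceil_lt_add_one hx0
  set s := ⌈x⌉₊
  obtain ⟨C1, hC1, h1⟩ := vmvt (p := p) (j := f) (k := k) (by omega) (by omega) hkp hε
  obtain ⟨C2, hC2, h2⟩ := vmvt (p := p) (j := f + 1) (k := k) (by omega) (by omega) hkp hε
  refine ⟨C1 * C2, one_le_mul_of_one_le_of_one_le hC1 hC2, fun Q hQ A hA hp => ?_⟩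
  have ha : tri f ≤ s := by exact_mod_cast hx1.trans hs1
  have hb : s ≤ tri (f + 1) := by exact_mod_cast (hs2.le.trans hx2)
  have hab : tri f < tri (f + 1) := by
    have : (tri f : ℝ) < tri (f + 1) := by linarith
    exact_mod_cast this
  refine interp ha hb hab ?_ hC1 hC2 hQ hA (h1 Q hQ A hA hp) (h2 Q hQ A hA hp)
  have ea : (f : ℝ) ^ 2 = 2 * tri f - f := by linarith
  have eb : ((f + 1 : ℕ) : ℝ) ^ 2 = 2 * tri (f + 1) - (f + 1) := by push_cast; linarith
  rw [ea, eb]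
  have ed : (tri (f + 1) : ℝ) - tri f = f + 1 := by linarith
  have ex : x = tri f + (2 * (k : ℝ) / 3 - f) * (f + 1) := by rw [hx]; linarith
  have key : ((tri (f + 1) : ℝ) - s) * (2 * tri f - f + ε) + (s - tri f) * (2 * tri (f + 1) - (f + 1) + ε) =
      ((tri (f + 1) : ℝ) - tri f) * (2 * s + ε) - (f * (tri (f + 1) - tri f) + (s - tri f)) := by ring
  rw [key, ed]
  linarith
end hua
end VM

open MeasureTheory Finset
open scoped Classical

set_option linter.all false
namespace VM
section kern
open ProbabilityTheory

/-- smooth majorant of the kernel -/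
noncomputable def Lk (τ α : ℝ) : ℝ := 2 * τ ^ 2 * (1 + (τ * α) ^ 2)⁻¹

lemma Lk_nonneg (τ α : ℝ) : 0 ≤ Lk τ α := by unfold Lk; positivity
lemma Lk_cont (τ : ℝ) : Continuous (Lk τ) := by
  unfold Lk
  exact continuous_const.mul (Continuous.inv₀ (by fun_prop) fun x => by positivity)
lemma Lk_int {τ : ℝ} (hτ : 0 < τ) : Integrable (Lk τ) := by
  unfold Lk
  exact (integrable_inv_one_add_sq.comp_mul_left' hτ.ne').const_mul _
lemma Lk_val {τ : ℝ} (hτ : 0 < τ) : ∫ α, Lk τ α = 2 * Real.pi * τ := by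
  unfold Lk
  rw [integral_const_mul, Measure.integral_comp_mul_left (fun x : ℝ => (1 + x ^ 2)⁻¹), integral_univ_inv_one_add_sq,
    abs_of_pos (inv_pos.2 hτ), smul_eq_mul]
  field_simp

lemma Kf_nonneg (τ α : ℝ) : 0 ≤ Kf τ α := by unfold Kf; split_ifs <;> positivity

lemma Kf_le (τ α : ℝ) : Kf τ α ≤ Lk τ α := by
  unfold Kf Lk
  split_ifs with h
  · subst h; simp; nlinarith [sq_nonneg τ]
  · rw [← div_eq_mul_inv, le_div_iff₀ (by positivity)]
    have hp : 0 < Real.pi * Real.pi := by positivity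
    have h1 : (Real.sin (Real.pi * τ * α) / (Real.pi * α)) ^ 2 ≤ τ ^ 2 := by
      rw [div_pow, div_le_iff₀ (by positivity)]
      have := Real.abs_sin_le_abs (x := Real.pi * τ * α)
      have := sq_le_sq.2 this
      nlinarith
    have h2 : (Real.sin (Real.pi * τ * α) / (Real.pi * α)) ^ 2 * α ^ 2 ≤ 1 := by
      rw [div_pow, div_mul_eq_mul_div, div_le_iff₀ (by positivity)]
      have := Real.sin_sq_le_one (Real.pi * τ * α)
      have hpi : 1 ≤ Real.pi ^ 2 := by nlinarith [Real.pi_gt_three]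
      nlinarith [sq_nonneg α, mul_le_mul hpi this (sq_nonneg _) (by positivity)]
    nlinarith [mul_le_mul_of_nonneg_left h2 (sq_nonneg τ)]

lemma Lk_smooth : ∃ c : ℝ, 0 < c ∧ ∀ τ : ℝ, 0 < τ → τ < 1 → ∀ α : ℝ,
    ENNReal.ofReal (c * Lk τ α) ≤ ∫⁻ y, ENNReal.ofReal (Lk τ y) * gaussianPDF y 1 α := by
  set q : ℝ := (√(2 * Real.pi * (1 : NNReal)))⁻¹ * Real.exp (-1) with hq
  have hq0 : 0 < q := by rw [hq]; simp; positivity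
  refine ⟨q / 3, by positivity, fun τ h0 h1 α => ?_⟩
  calc ENNReal.ofReal (q / 3 * Lk τ α) = ∫⁻ y in Set.Icc α (α + 1), ENNReal.ofReal (q / 3 * Lk τ α) := by
        simp
    _ ≤ ∫⁻ y in Set.Icc α (α + 1), ENNReal.ofReal (Lk τ y) * gaussianPDF y 1 α := by
        refine setLIntegral_mono' measurableSet_Icc fun y hy => ?_
        unfold gaussianPDF
        rw [← ENNReal.ofReal_mul (Lk_nonneg _ _)]
        apply ENNReal.ofReal_le_ofReal
        have hy1 : 0 ≤ y - α := by linarith [hy.1]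
        have hy2 : y - α ≤ 1 := by linarith [hy.2]
        have e1 : q ≤ gaussianPDFReal y 1 α := by
          unfold gaussianPDFReal
          rw [hq]
          refine mul_le_mul_of_nonneg_left (Real.exp_le_exp.2 ?_) (by positivity)
          simp only [NNReal.coe_one]
          nlinarith
        have e2 : Lk τ α / 3 ≤ Lk τ y := by
          unfold Lk
          rw [mul_div_assoc]
          refine mul_le_mul_of_nonneg_left ?_ (by positivity)
          rw [← one_div, ← one_div, div_div]
          refine one_div_le_one_div_of_le (by positivity) ?_
          have h3 : (y - α) ^ 2 ≤ 1 := by nlinarith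
          have h4 : y ^ 2 ≤ 2 * α ^ 2 + 2 := by nlinarith [sq_nonneg (y - 2 * α)]
          have h5 : τ ^ 2 ≤ 1 := by nlinarith
          nlinarith [mul_le_mul_of_nonneg_left h4 (sq_nonneg τ), mul_nonneg (sq_nonneg τ) (sq_nonneg α)]
        calc q / 3 * Lk τ α = Lk τ α / 3 * q := by ring
          _ ≤ _ := mul_le_mul e2 e1 hq0.le (Lk_nonneg _ _)
    _ ≤ _ := setLIntegral_le_lintegral _ _

lemma kern : ∃ C : ℝ, 0 < C ∧ ∀ {F : ℝ → ℝ}, Continuous F → (∀ x, 0 ≤ F x) → ∀ {M : ℝ}, (∀ x, F x ≤ M) →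
    ∀ {B : ℝ}, 0 ≤ B → (∀ y, ∫ x, F x ∂(gaussianReal y 1) ≤ B) → ∀ τ : ℝ, 0 < τ → τ < 1 →
    ∫ x, F x * Kf τ x ≤ C * τ * B := by
  obtain ⟨c, hc, hL⟩ := Lk_smooth
  refine ⟨2 * Real.pi / c, by positivity, fun {F} hF h0 {M} hM {B} hB0 hB τ hτ hτ1 => ?_⟩
  have hnn : ∀ x, ‖F x‖ ≤ M := fun x => by rw [Real.norm_of_nonneg (h0 x)]; exact hM x
  have hi : Integrable (fun x => F x * Lk τ x) := (Lk_int hτ).bdd_mul hF.aestronglyMeasurable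
    (Filter.Eventually.of_forall hnn)
  have h1 : ∫ x, F x * Kf τ x ≤ ∫ x, F x * Lk τ x :=
    integral_mono_of_nonneg (Filter.Eventually.of_forall fun x => mul_nonneg (h0 x) (Kf_nonneg _ _)) hi
      (Filter.Eventually.of_forall fun x => mul_le_mul_of_nonneg_left (Kf_le _ _) (h0 x))
  refine h1.trans ?_
  have hF' : Measurable fun x => ENNReal.ofReal (F x) := hF.measurable.ennreal_ofReal
  have hL' : Measurable fun x => ENNReal.ofReal (Lk τ x) := (Lk_cont τ).measurable.ennreal_ofReal
  have hG : Measurable fun z : ℝ × ℝ => gaussianPDF z.2 1 z.1 := by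
    have : Continuous fun z : ℝ × ℝ => gaussianPDFReal z.2 1 z.1 := by unfold gaussianPDFReal; fun_prop
    exact this.measurable.ennreal_ofReal
  have hnu : ∀ y, ∫⁻ x, ENNReal.ofReal (F x) * gaussianPDF y 1 x ≤ ENNReal.ofReal B := by
    intro y
    have h2 : ∫⁻ x, ENNReal.ofReal (F x) ∂(gaussianReal y 1) ≤ ENNReal.ofReal B := by
      rw [← ofReal_integral_eq_lintegral_ofReal (bint hF hnn y) (Filter.Eventually.of_forall h0)]
      exact ENNReal.ofReal_le_ofReal (hB y)
    rw [gaussianReal_of_var_ne_zero y one_ne_zero,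
      lintegral_withDensity_eq_lintegral_mul _ (measurable_gaussianPDF y 1) hF'] at h2
    refine le_trans (le_of_eq (lintegral_congr fun x => ?_)) h2
    rw [Pi.mul_apply, mul_comm]
  have key : ENNReal.ofReal (c * ∫ x, F x * Lk τ x) ≤ ENNReal.ofReal (B * (2 * Real.pi * τ)) := by
    rw [← integral_const_mul, ofReal_integral_eq_lintegral_ofReal (hi.const_mul c)
      (Filter.Eventually.of_forall fun x => mul_nonneg hc.le (mul_nonneg (h0 x) (Lk_nonneg _ _)))]
    calc _ ≤ ∫⁻ x, ENNReal.ofReal (F x) * ∫⁻ y, ENNReal.ofReal (Lk τ y) * gaussianPDF y 1 x := by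
          refine lintegral_mono fun x => ?_
          rw [mul_left_comm, ENNReal.ofReal_mul (h0 x)]
          gcongr
          exact hL τ hτ hτ1 x
      _ = ∫⁻ x, ∫⁻ y, ENNReal.ofReal (F x) * (ENNReal.ofReal (Lk τ y) * gaussianPDF y 1 x) := by
          refine lintegral_congr fun x => ?_
          rw [lintegral_const_mul']
          exact ENNReal.ofReal_ne_top
      _ = ∫⁻ y, ∫⁻ x, ENNReal.ofReal (F x) * (ENNReal.ofReal (Lk τ y) * gaussianPDF y 1 x) := by
          rw [lintegral_lintegral_swap]
          exact ((hF'.comp measurable_fst).mul ((hL'.comp measurable_snd).mul hG)).aemeasurable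
      _ = ∫⁻ y, ENNReal.ofReal (Lk τ y) * ∫⁻ x, ENNReal.ofReal (F x) * gaussianPDF y 1 x := by
          refine lintegral_congr fun y => ?_
          rw [← lintegral_const_mul' _ _ ENNReal.ofReal_ne_top]
          exact lintegral_congr fun x => mul_left_comm _ _ _
      _ ≤ ∫⁻ y, ENNReal.ofReal (Lk τ y) * ENNReal.ofReal B := by
          refine lintegral_mono fun y => ?_
          gcongr
          exact hnu y
      _ = _ := by
          rw [lintegral_mul_const' _ _ ENNReal.ofReal_ne_top,
            ← ofReal_integral_eq_lintegral_ofReal (Lk_int hτ) (Filter.Eventually.of_forall (Lk_nonneg τ)),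
            Lk_val hτ, mul_comm, ENNReal.ofReal_mul hB0]
  rw [ENNReal.ofReal_le_ofReal_iff (by positivity)] at key
  rw [show 2 * Real.pi / c * τ * B = B * (2 * Real.pi * τ) / c by ring, le_div_iff₀ hc]
  linarith
end kern

section main
open ProbabilityTheory

lemma wtup_e (k s : ℕ) (A : Finset ℕ) (w : ℕ → ℝ) (l α : ℝ) :
    (∑ x ∈ A, (w x : ℂ) * e ((x : ℝ) ^ k * (l * α))) ^ s =
      ∑ u ∈ tup s A, ((∏ i, w (u i) : ℝ) : ℂ) * e (l * psz k s u * α) := by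
  rw [tup_pow]
  refine Finset.sum_congr rfl fun u _ => ?_
  rw [Finset.prod_mul_distrib, ← e_sum]
  push_cast
  congr 2
  unfold psz
  push_cast
  rw [Finset.mul_sum, Finset.sum_mul]
  exact Finset.sum_congr rfl fun i _ => by ring

lemma wprod_le {s : ℕ} {A : Finset ℕ} {w : ℕ → ℝ} {L : ℝ} (h0 : ∀ x ∈ A, 0 ≤ w x) (hL : ∀ x ∈ A, w x ≤ L)
    {u : Fin s → ℕ} (hu : u ∈ tup s A) : 0 ≤ ∏ i, w (u i) ∧ ∏ i, w (u i) ≤ L ^ s := by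
  rw [mem_tup] at hu
  refine ⟨Finset.prod_nonneg fun i _ => h0 _ (hu i), ?_⟩
  refine (Finset.prod_le_prod (fun i _ => h0 _ (hu i)) fun i _ => hL _ (hu i)).trans ?_
  simp

lemma gauss_main {k s : ℕ} {l m ε : ℝ} (hl : l ≠ 0) (hm : m ≠ 0) (hε : 0 < ε) :
    ∃ C : ℝ, 1 ≤ C ∧ ∀ P : ℕ, 1 ≤ P → ∀ (B A : Finset ℕ), B ⊆ Icc 1 P → ∀ (w : ℕ → ℝ) (L : ℝ), 0 ≤ L →
    (∀ x ∈ B, 0 ≤ w x ∧ w x ≤ L) → (∀ x ∈ A, 0 ≤ w x ∧ w x ≤ L) → ∀ y : ℝ,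
    ∫ α, ‖(∑ x ∈ B, (w x : ℂ) * e ((x : ℝ) ^ 3 * (l * α))) ^ 2 *
        (∑ x ∈ A, (w x : ℂ) * e ((x : ℝ) ^ k * (m * α))) ^ s‖ ^ 2 ∂(gaussianReal y 1) ≤
      (L ^ (2 + s)) ^ 2 * (C * P * ((P : ℝ) ^ 2 * NN k s A + (P : ℝ) ^ ε * ((#A : ℝ) ^ s) ^ 2)) := by
  obtain ⟨C, hC, h⟩ := mixed_bound (a := 3) (j := 1) (by norm_num) hl hm hε
  refine ⟨C, hC, fun P hP B A hB w L hL hwB hwA y => ?_⟩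
  let Ω (D : Finset ℕ) := tup 2 D ×ˢ tup s A
  let W : (Fin 2 → ℕ) × (Fin s → ℕ) → ℝ := fun z => (∏ i, w (z.1 i)) * ∏ i, w (z.2 i)
  let θ : (Fin 2 → ℕ) × (Fin s → ℕ) → ℝ := fun z => l * psz 3 2 z.1 + m * psz k s z.2
  have hW : ∀ z ∈ Ω B, 0 ≤ W z ∧ W z ≤ L ^ (2 + s) := by
    intro z hz
    obtain ⟨hz1, hz2⟩ := Finset.mem_product.1 hz
    have h1 := wprod_le (fun x hx => (hwB x hx).1) (fun x hx => (hwB x hx).2) hz1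
    have h2 := wprod_le (fun x hx => (hwA x hx).1) (fun x hx => (hwA x hx).2) hz2
    refine ⟨mul_nonneg h1.1 h2.1, ?_⟩
    rw [pow_add]
    exact mul_le_mul h1.2 h2.2 h2.1 (pow_nonneg hL _)
  have hexp : ∀ α : ℝ, (∑ x ∈ B, (w x : ℂ) * e ((x : ℝ) ^ 3 * (l * α))) ^ 2 *
        (∑ x ∈ A, (w x : ℂ) * e ((x : ℝ) ^ k * (m * α))) ^ s = ∑ z ∈ Ω B, (W z : ℂ) * e (θ z * α) := by
    intro α
    rw [wtup_e, wtup_e, Finset.sum_mul_sum, Finset.sum_product]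
    refine Finset.sum_congr rfl fun u _ => Finset.sum_congr rfl fun v _ => ?_
    rw [show θ (u, v) * α = l * psz 3 2 u * α + m * psz k s v * α from add_mul _ _ _, e_add,
      show W (u, v) = (∏ i, w (u i)) * ∏ i, w (v i) from rfl, Complex.ofReal_mul]
    ring
  simp only [hexp]
  refine (int_sq_le (Ω B) W θ (fun z hz => (hW z hz).1) y).trans ?_
  have hsub : Ω B ⊆ Ω (Icc 1 P) := by
    intro z hz
    obtain ⟨hz1, hz2⟩ := Finset.mem_product.1 hz
    refine Finset.mem_product.2 ⟨mem_tup.2 fun i => hB (mem_tup.1 hz1 i), hz2⟩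
  have h3 := h P hP (tup s A) (psz k s)
  rw [cnt_psz, card_tup] at h3
  have h4 : ∀ α : ℝ, ‖∑ n ∈ Icc 1 (P : ℤ), e (l * (n ^ 3 : ℤ) * α)‖ ^ 2 ^ (1 + 1) *
      ‖∑ u ∈ tup s A, e (m * psz k s u * α)‖ ^ 2 = ‖∑ z ∈ Ω (Icc 1 P), e (θ z * α)‖ ^ 2 := by
    intro α
    rw [sum_int_nat P (fun n => e (l * (n ^ 3 : ℤ) * α)),
      show 2 ^ (1 + 1) = 2 * 2 from rfl, pow_mul, ← norm_pow, ← tup_e, ← mul_pow, ← norm_mul,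
      Finset.sum_mul_sum, Finset.sum_product]
    congr 2
    refine Finset.sum_congr rfl fun u _ => Finset.sum_congr rfl fun v _ => ?_
    rw [show θ (u, v) * α = l * psz 3 2 u * α + m * psz k s v * α from add_mul _ _ _, e_add]
  simp only [h4] at h3
  rw [int_sq0] at h3
  have hLL : 0 ≤ L ^ (2 + s) := pow_nonneg hL _
  calc ∑ u ∈ Ω B, ∑ v ∈ Ω B, W u * W v * Ph (θ u - θ v)
      ≤ ∑ u ∈ Ω B, ∑ v ∈ Ω B, (L ^ (2 + s)) ^ 2 * Ph (θ u - θ v) := by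
        refine Finset.sum_le_sum fun u hu => Finset.sum_le_sum fun v hv => ?_
        refine mul_le_mul_of_nonneg_right ?_ (Ph_nonneg _)
        rw [sq]
        exact mul_le_mul (hW u hu).2 (hW v hv).2 (hW v hv).1 hLL
    _ = (L ^ (2 + s)) ^ 2 * ∑ u ∈ Ω B, ∑ v ∈ Ω B, Ph (θ u - θ v) := by
        simp only [← Finset.mul_sum]
    _ ≤ (L ^ (2 + s)) ^ 2 * ∑ u ∈ Ω (Icc 1 P), ∑ v ∈ Ω (Icc 1 P), Ph (θ u - θ v) := by
        refine mul_le_mul_of_nonneg_left ?_ (sq_nonneg _)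
        refine (Finset.sum_le_sum fun u _ => Finset.sum_le_sum_of_subset_of_nonneg hsub
          fun v _ _ => Ph_nonneg _).trans ?_
        exact Finset.sum_le_sum_of_subset_of_nonneg hsub fun u _ _ => Finset.sum_nonneg fun v _ => Ph_nonneg _
    _ ≤ _ := by
        refine mul_le_mul_of_nonneg_left (h3.trans (le_of_eq ?_)) (sq_nonneg _)
        norm_num
end main
end VM

open MeasureTheory Finset
open scoped Classical

set_option linter.all false
namespace VM
section fin
open ProbabilityTheory

lemma SS_cont (η X : ℝ) (k : ℕ) : Continuous (SS η X k) := by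
  unfold SS
  refine continuous_finset_sum _ fun p _ => continuous_const.mul (e_cont.comp ?_)
  fun_prop

lemma SS_bdd (η X : ℝ) (k : ℕ) : ∃ M : ℝ, ∀ α, ‖SS η X k α‖ ≤ M := by
  refine ⟨∑ p ∈ (Finset.Icc 1 ⌊X ^ ((1:ℝ)/(k:ℝ))⌋₊).filter (fun p : ℕ => p.Prime ∧ (η * X) ^ ((1:ℝ)/(k:ℝ)) ≤ (p : ℝ)), ‖(Real.log p : ℂ)‖, fun α => ?_⟩
  unfold SS
  refine (norm_sum_le _ _).trans (Finset.sum_le_sum fun p _ => ?_)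
  rw [norm_mul, e_norm, mul_one]

lemma log_pow_le {δ : ℝ} (hδ : 0 < δ) (N : ℕ) : ∃ C : ℝ, 1 ≤ C ∧ ∀ X : ℝ, 1 ≤ X →
    (Real.log X) ^ N ≤ C * X ^ δ := by
  set d := δ / (N + 1) with hd
  have hd0 : 0 < d := by positivity
  refine ⟨max 1 ((1 / d) ^ N), le_max_left _ _, fun X hX => ?_⟩
  have h1 := Real.log_le_rpow_div (by linarith : 0 ≤ X) hd0
  have h2 := pow_le_pow_left₀ (Real.log_nonneg hX) h1 N
  refine h2.trans ?_
  have h3 : (X ^ d / d) ^ N = (1 / d) ^ N * X ^ (d * N) := by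
    rw [Real.rpow_mul (by linarith), Real.rpow_natCast, ← mul_pow]; congr 1; ring
  rw [h3]
  refine mul_le_mul (le_max_right _ _) (Real.rpow_le_rpow_of_exponent_le hX ?_) (by positivity) (by positivity)
  rw [hd, div_mul_eq_mul_div, div_le_iff₀ (by positivity)]
  nlinarith

lemma floor_rpow {X : ℝ} (hX : 1 ≤ X) {k : ℕ} (hk : 1 ≤ k) {x : ℝ} (hx : 0 ≤ x) :
    1 ≤ ⌊X ^ ((1 : ℝ) / k)⌋₊ ∧ (⌊X ^ ((1 : ℝ) / k)⌋₊ : ℝ) ≤ X ∧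
      (⌊X ^ ((1 : ℝ) / k)⌋₊ : ℝ) ^ x ≤ X ^ (x / k) := by
  have hk0 : (1 : ℝ) ≤ k := by exact_mod_cast hk
  have h1 : (⌊X ^ ((1 : ℝ) / k)⌋₊ : ℝ) ≤ X ^ ((1 : ℝ) / k) := Nat.floor_le (by positivity)
  refine ⟨Nat.le_floor ?_, h1.trans ?_, ?_⟩
  · rw [Nat.cast_one]; exact Real.one_le_rpow hX (by positivity)
  · conv_rhs => rw [← Real.rpow_one X]
    exact Real.rpow_le_rpow_of_exponent_le hX (by rw [div_le_one (by linarith)]; exact hk0)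
  · refine (Real.rpow_le_rpow (Nat.cast_nonneg _) h1 hx).trans (le_of_eq ?_)
    rw [← Real.rpow_mul (by linarith)]; congr 1; ring
end fin
end VM

theorem S3_Sk_mixed_moment (k : ℕ) (hk : 5 ≤ k) (l2 l7 : ℝ)
    (hl2 : l2 ≠ 0) (hl7 : l7 ≠ 0) (ε : ℝ) (hε : 0 < ε)
    (η : ℝ) (hη : 0 < η) (hη1 : η < 1) :
    ∃ C > (0:ℝ), ∃ X₀ : ℝ, ∀ X ≥ X₀, ∀ τ : ℝ, 0 < τ → τ < 1 →
      (∫ α : ℝ, ‖SS η X 3 (l2 * α)‖ ^ (4:ℕ) * ‖SS η X k (l7 * α)‖ ^ (m2 k) * Kf τ α)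
        ≤ C * τ * X ^ (m2 k / (k:ℝ) + 1/3 + ε) := by
  obtain ⟨p, hpk, hp⟩ := Nat.exists_infinite_primes (k + 1)
  haveI : Fact p.Prime := ⟨hp⟩
  obtain ⟨s, hs, h3s, hNN⟩ := VM.NN_final (k := k) (p := p) hk (by omega)
  have hε2 : 0 < ε / 2 := by positivity
  obtain ⟨C1, hC1, h1⟩ := hNN (ε / 2) hε2
  obtain ⟨C2, hC2, h2⟩ := VM.gauss_main (k := k) (s := s) hl2 hl7 hε2
  obtain ⟨C3, hC3, h3⟩ := VM.log_pow_le hε2 ((2 + s) * 2)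
  obtain ⟨C4, hC4, h4⟩ := VM.kern
  refine ⟨C4 * (C3 * (C2 * (C1 + 1))), by positivity, max 1 (((p : ℝ) + 1) ^ k / η), fun X hX τ hτ hτ1 => ?_⟩
  have hX1 : 1 ≤ X := le_trans (le_max_left _ _) hX
  have hX0 : 0 < X := by linarith
  have hXp : ((p : ℝ) + 1) ^ k ≤ η * X := by
    have := le_trans (le_max_right _ _) hX
    rw [div_le_iff₀ hη] at this; linarith
  have hk0 : (5 : ℝ) ≤ k := by exact_mod_cast hk
  have hks : (k : ℝ) ≤ 3 * s := by exact_mod_cast h3s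
  rw [hs]
  set F : ℝ → ℝ := fun α => ‖SS η X 3 (l2 * α) ^ 2 * SS η X k (l7 * α) ^ s‖ ^ 2 with hF
  have hFe : ∀ α, ‖SS η X 3 (l2 * α)‖ ^ (4:ℕ) * ‖SS η X k (l7 * α)‖ ^ (2 * (s : ℝ)) = F α := by
    intro α
    rw [hF]
    rw [show (2 * (s : ℝ)) = ((2 * s : ℕ) : ℝ) by push_cast; ring, Real.rpow_natCast]
    simp only [norm_mul, norm_pow, mul_pow, ← pow_mul]
    rw [mul_comm 2 s]
  simp only [hFe]
  have hFc : Continuous F := by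
    have c1 := (VM.SS_cont η X 3).comp (continuous_const.mul continuous_id : Continuous fun α : ℝ => l2 * α)
    have c2 := (VM.SS_cont η X k).comp (continuous_const.mul continuous_id : Continuous fun α : ℝ => l7 * α)
    exact (((c1.pow 2).mul (c2.pow s)).norm).pow 2
  obtain ⟨M1, hM1⟩ := VM.SS_bdd η X 3
  obtain ⟨M2, hM2⟩ := VM.SS_bdd η X k
  have hFM : ∀ α, F α ≤ (M1 ^ 2 * M2 ^ s) ^ 2 := by
    intro α
    rw [hF]
    simp only [norm_mul, norm_pow]
    have hM0 : 0 ≤ M1 := (norm_nonneg _).trans (hM1 0)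
    gcongr
    · exact hM1 _
    · exact hM2 _
  set P := ⌊X ^ ((1:ℝ)/((3 : ℕ):ℝ))⌋₊ with hP
  set Q := ⌊X ^ ((1:ℝ)/(k:ℝ))⌋₊ with hQ
  set z := 2 * (s : ℝ) / k + 1 / 3 with hz
  set A := (Finset.Icc 1 Q).filter (fun p : ℕ => p.Prime ∧ (η * X) ^ ((1:ℝ)/(k:ℝ)) ≤ (p : ℝ)) with hA
  set B := (Finset.Icc 1 P).filter (fun p : ℕ => p.Prime ∧ (η * X) ^ ((1:ℝ)/((3 : ℕ):ℝ)) ≤ (p : ℝ)) with hB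
  have hAQ : A ⊆ Finset.Icc 1 Q := Finset.filter_subset _ _
  have hBP : B ⊆ Finset.Icc 1 P := Finset.filter_subset _ _
  obtain ⟨hP1, hPX, hPe⟩ := VM.floor_rpow hX1 (k := 3) (by norm_num) (x := 1 + ε / 2) (by positivity)
  have hPc := (VM.floor_rpow hX1 (k := 3) (by norm_num) (x := 3) (by norm_num)).2.2
  have hze : 0 ≤ 2 * (s : ℝ) - 2 * k / 3 + ε / 2 := by linarith
  obtain ⟨hQ1, hQX, hQe⟩ := VM.floor_rpow hX1 (k := k) (by omega) hze
  have hQs := (VM.floor_rpow hX1 (k := k) (by omega) (x := 2 * s) (by positivity)).2.2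
  rw [← hP] at hP1 hPX hPe hPc
  rw [← hQ] at hQ1 hQX hQe hQs
  have hApr : ∀ x ∈ A, ¬ p ∣ x := by
    intro x hx hd
    rw [hA] at hx
    obtain ⟨hx1, hx2, hx3⟩ := Finset.mem_filter.1 hx
    have hpx : p = x := (Nat.prime_dvd_prime_iff_eq hp hx2).1 hd
    have h5 : (p : ℝ) + 1 ≤ (η * X) ^ ((1:ℝ)/(k:ℝ)) := by
      have := Real.rpow_le_rpow (by positivity) hXp (by positivity : (0 : ℝ) ≤ (1:ℝ)/(k:ℝ))
      rw [one_div, Real.pow_rpow_inv_natCast (by positivity) (by omega)] at this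
      rw [one_div]; exact this
    rw [← hpx] at hx3
    linarith
  have hlog : ∀ (R : ℕ), (R : ℝ) ≤ X → ∀ x ∈ Finset.Icc 1 R, 0 ≤ Real.log (x : ℕ) ∧ Real.log (x : ℕ) ≤ Real.log X := by
    intro R hR x hx
    obtain ⟨hx1, hx2⟩ := Finset.mem_Icc.1 hx
    have : (1 : ℝ) ≤ x := by exact_mod_cast hx1
    have hx3 : (x : ℝ) ≤ R := by exact_mod_cast hx2
    exact ⟨Real.log_nonneg this, Real.log_le_log (by linarith) (by linarith)⟩
  have hNA := h1 Q hQ1 A hAQ hApr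
  have hcA : (Finset.card A : ℝ) ≤ Q := by
    have := Finset.card_le_card hAQ
    rw [Nat.card_Icc, Nat.add_sub_cancel] at this
    exact_mod_cast this
  have hP0 : (0 : ℝ) < P := by exact_mod_cast hP1
  have hQ0 : (0 : ℝ) < Q := by exact_mod_cast hQ1
  have hzz : X ^ (ε / 2) * X ^ (z + ε / 2) = X ^ (z + ε) := by
    rw [← Real.rpow_add hX0]; congr 1; ring
  have hbound : ∀ y, ∫ α, F α ∂(ProbabilityTheory.gaussianReal y 1) ≤
      (C3 * (C2 * (C1 + 1))) * X ^ (z + ε) := by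
    intro y
    have h6 := h2 P hP1 B A hBP (fun x => Real.log x) (Real.log X) (Real.log_nonneg hX1)
      (fun x hx => hlog P hPX x (hBP hx)) (fun x hx => hlog Q hQX x (hAQ hx)) y
    refine le_trans (le_of_eq ?_) (h6.trans ?_)
    · rfl
    have t1 : (P : ℝ) * ((P : ℝ) ^ 2 * VM.NN k s A) ≤ C1 * X ^ (z + ε / 2) := by
      have e1 : (P : ℝ) * (P : ℝ) ^ 2 ≤ X ^ (1 : ℝ) := by
        have : (P : ℝ) * (P : ℝ) ^ 2 = (P : ℝ) ^ (3 : ℝ) := by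
          rw [← pow_succ']; norm_cast
        rw [this]; refine hPc.trans (le_of_eq ?_); norm_num
      calc (P : ℝ) * ((P : ℝ) ^ 2 * VM.NN k s A) = ((P : ℝ) * (P : ℝ) ^ 2) * VM.NN k s A := by ring
        _ ≤ X ^ (1 : ℝ) * (C1 * X ^ ((2 * (s : ℝ) - 2 * k / 3 + ε / 2) / k)) := by
          refine mul_le_mul e1 (hNA.trans ?_) (Nat.cast_nonneg _) (by positivity)
          exact mul_le_mul_of_nonneg_left hQe (by linarith)
        _ = C1 * X ^ (1 + (2 * (s : ℝ) - 2 * k / 3 + ε / 2) / k) := by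
          rw [Real.rpow_add hX0]; ring
        _ ≤ _ := by
          refine mul_le_mul_of_nonneg_left (Real.rpow_le_rpow_of_exponent_le hX1 ?_) (by linarith)
          have e2 : (2 * (s : ℝ) - 2 * k / 3 + ε / 2) / k = 2 * (s : ℝ) / k - 2 / 3 + ε / 2 / k := by
            field_simp
          have e3 : ε / 2 / k ≤ ε / 2 := div_le_self hε2.le (by linarith)
          rw [e2, hz]; linarith
    have t2 : (P : ℝ) * ((P : ℝ) ^ (ε / 2) * ((Finset.card A : ℝ) ^ s) ^ 2) ≤ X ^ (z + ε / 2) := by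
      have e1 : ((Finset.card A : ℝ) ^ s) ^ 2 ≤ X ^ (2 * (s : ℝ) / k) := by
        refine le_trans ?_ hQs
        rw [← pow_mul, show (2 * (s : ℝ)) = ((s * 2 : ℕ) : ℝ) by push_cast; ring, Real.rpow_natCast]
        exact pow_le_pow_left₀ (Nat.cast_nonneg _) hcA _
      calc _ = (P : ℝ) ^ (1 + ε / 2) * ((Finset.card A : ℝ) ^ s) ^ 2 := by
            rw [Real.rpow_add hP0, Real.rpow_one]; ring
        _ ≤ X ^ ((1 + ε / 2) / (3 : ℕ)) * X ^ (2 * (s : ℝ) / k) :=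
            mul_le_mul hPe e1 (by positivity) (by positivity)
        _ = X ^ ((1 + ε / 2) / (3 : ℕ) + 2 * (s : ℝ) / k) := (Real.rpow_add hX0 _ _).symm
        _ ≤ _ := by
          refine Real.rpow_le_rpow_of_exponent_le hX1 ?_
          rw [hz]; push_cast; linarith
    have t3 := h3 X hX1
    rw [pow_mul] at t3
    calc _ ≤ (C3 * X ^ (ε / 2)) * (C2 * ((C1 + 1) * X ^ (z + ε / 2))) := by
          refine mul_le_mul t3 ?_ (by positivity) (by positivity)
          rw [mul_assoc]
          refine mul_le_mul_of_nonneg_left ?_ (by linarith)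
          rw [mul_add]; linarith
      _ = (C3 * (C2 * (C1 + 1))) * (X ^ (ε / 2) * X ^ (z + ε / 2)) := by ring
      _ = _ := by rw [hzz]
  refine (h4 hFc (fun x => sq_nonneg _) hFM (by positivity) hbound τ hτ hτ1).trans (le_of_eq ?_)
  ring
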